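/- Let f, g : 𝔹 → ℂ be holomorphic, F(x) = f(x)·x and G(x) = g(x)·x for x ∈ 𝔹. Assume F is biholomorphic on 𝔹 and G is subordinate to F. Then for every s ≥ 1 and every w ∈ X with ‖w‖ = 1, ‖P_s(w)‖ ≤ s·‖DF(0)‖, where P_s(w) = (1/s!)·DˢG(0)(w,…,w) is the s-th homogeneous Taylor term of G at 0 and DF(0) is the Fréchet derivative of F at 0. -/

import Mathlib

open Metric Set

noncomputable section

/-- A holomorphic map is biholomorphic on an open set `s` if it is holomorphic and injective
on `s` and admits a holomorphic inverse on the image `f '' s`. -/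
def IsBiholoOn {E₁ E₂ : Type*} [NormedAddCommGroup E₁] [NormedSpace ℂ E₁]
    [NormedAddCommGroup E₂] [NormedSpace ℂ E₂] (f : E₁ → E₂) (s : Set E₁) : Prop :=
  DifferentiableOn ℂ f s ∧ Set.InjOn f s ∧
    ∃ g : E₂ → E₁, DifferentiableOn ℂ g (f '' s) ∧ ∀ x ∈ s, g (f x) = x

/-- `G` is subordinate to `F` on the unit ball if `G = F ∘ V` for some Schwarz mapping `V`,
i.e. a holomorphic self-map of the ball fixing the origin. -/
def Subordinate {X : Type*} [NormedAddCommGroup X] [NormedSpace ℂ X]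
    (G F : X → X) : Prop :=
  ∃ V : X → X, DifferentiableOn ℂ V (ball (0 : X) 1) ∧
    Set.MapsTo V (ball (0 : X) 1) (ball (0 : X) 1) ∧ V 0 = 0 ∧
    ∀ x ∈ ball (0 : X) 1, G x = F (V x)


namespace DB
open Polynomial

/-- Coefficients of `q^k` in `U_n (1 - s + s (q + 1/q)/2)`, as polynomials in `s`. -/
def lam : ℕ → ℤ → Polynomial ℝ
  | 0, k => if k = 0 then 1 else 0
  | 1, k => if k = 0 then 2 * (1 - X) else if k = 1 ∨ k = -1 then X else 0
  | (n+2), k => 2 * (1 - X) * lam (n+1) k + X * (lam (n+1) (k+1) + lam (n+1) (k-1)) - lam n k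

lemma lam_rec (n : ℕ) (k : ℤ) : lam (n+2) k =
  2 * (1 - X) * lam (n+1) k + X * (lam (n+1) (k+1) + lam (n+1) (k-1)) - lam n k := by
  rw [lam]

lemma lam_one (k : ℤ) : lam 1 k =
  2 * (1 - X) * lam 0 k + X * (lam 0 (k+1) + lam 0 (k-1)) := by
  simp only [lam]
  split_ifs <;> first | omega | simp

lemma lam_zero (k : ℤ) : lam 0 k = if k = 0 then 1 else 0 := by
  simp only [lam]

lemma lam_symm (n : ℕ) : ∀ k : ℤ, lam n (-k) = lam n k := by
  induction n using Nat.strong_induction_on with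
  | _ n ih =>
    intro k
    match n with
    | 0 => simp [lam_zero]
    | 1 =>
      rw [lam_one, lam_one]; simp only [lam_zero]
      split_ifs <;> first | omega | simp
    | n+2 =>
      rw [lam_rec, lam_rec, ih (n+1) (by omega), ih n (by omega)]
      rw [show -k+1 = -(k-1) by ring, show -k-1 = -(k+1) by ring, ih (n+1) (by omega),
        ih (n+1) (by omega)]
      ring

lemma lam_big (n : ℕ) : ∀ k : ℤ, (n:ℤ) < |k| → lam n k = 0 := by
  induction n using Nat.strong_induction_on with
  | _ n ih =>
    intro k hk
    match n with
    | 0 =>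
      rw [lam_zero, if_neg]; rintro rfl; simp at hk
    | 1 =>
      rw [lam_one]; simp only [lam_zero]
      rw [lt_abs] at hk
      push_cast at hk
      split_ifs <;> first | omega | simp
    | n+2 =>
      rw [lam_rec, ih (n+1) (by omega), ih n (by omega), ih (n+1) (by omega), ih (n+1) (by omega)]
      · ring
      all_goals (rw [lt_abs] at *; push_cast at *; omega)

lemma lam_ode (n : ℕ) : ∀ k : ℤ, X * (derivative (lam n (k+1)) + derivative (lam n k)) =
    (k : Polynomial ℝ) * lam n k - (k+1 : Polynomial ℝ) * lam n (k+1) := by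
  induction n using Nat.strong_induction_on with
  | _ n ih =>
    intro k
    match n with
    | 0 =>
      simp only [lam_zero]
      split_ifs with h1 h2 h2
      · omega
      · have : (k:Polynomial ℝ) + 1 = 0 := by exact_mod_cast h1
        simp [this]
      · subst h2; simp
      · simp
    | 1 =>
      simp only [lam_one]
      have h0 := ih 0 (by omega) k
      have h1 := ih 0 (by omega) (k+1)
      have h2 := ih 0 (by omega) (k-1)
      simp only [derivative_mul, derivative_sub, derivative_add, derivative_X, derivative_one, derivative_ofNat]
      push_cast at *
      rw [show k + 1 - 1 = k by ring]
      rw [show k - 1 + 1 = k by ring] at h2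
      linear_combination (2*(1-X)) * h0 + X * h1 + X * h2
    | n+2 =>
      simp only [lam_rec]
      have h0 := ih (n+1) (by omega) k
      have h1 := ih (n+1) (by omega) (k+1)
      have h2 := ih (n+1) (by omega) (k-1)
      have h3 := ih n (by omega) k
      simp only [derivative_mul, derivative_sub, derivative_add, derivative_X, derivative_one, derivative_ofNat]
      push_cast at *
      rw [show k + 1 - 1 = k by ring]
      rw [show k - 1 + 1 = k by ring] at h2
      linear_combination (2*(1-X)) * h0 + X * h1 + X * h2 - h3

lemma lam_at_one (n : ℕ) : ∀ k : ℤ, (lam n k).eval 1 + (lam n (k+1)).eval 1 =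
    if (-(n:ℤ) - 1 ≤ k ∧ k ≤ n) then 1 else 0 := by
  induction n using Nat.strong_induction_on with
  | _ n ih =>
    intro k
    match n with
    | 0 =>
      simp only [lam_zero]
      split_ifs <;> first | (push_cast at *; omega) | simp
    | 1 =>
      simp only [lam_one, lam_zero]
      split_ifs <;> first | (push_cast at *; omega) | simp
    | n+2 =>
      have h1 := ih (n+1) (by omega) (k+1)
      have h2 := ih (n+1) (by omega) (k-1)
      have h3 := ih n (by omega) k
      rw [show k - 1 + 1 = k by ring] at h2
      simp only [lam_rec, eval_add, eval_sub, eval_mul, eval_X, eval_one, eval_ofNat]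
      rw [show k + 1 - 1 = k by ring]
      have : ∀ P : ℝ, (eval 1 (lam (n+1) (k+1)) + eval 1 (lam (n+1) (k+1+1)) +
        (eval 1 (lam (n+1) (k-1)) + eval 1 (lam (n+1) k)) -
        (eval 1 (lam n k) + eval 1 (lam n (k+1)))) = P →
        2 * (1 - 1) * eval 1 (lam (n + 1) k) + 1 * (eval 1 (lam (n + 1) (k + 1)) + eval 1 (lam (n + 1) (k - 1))) -
        eval 1 (lam n k) +
      (2 * (1 - 1) * eval 1 (lam (n + 1) (k + 1)) +
          1 * (eval 1 (lam (n + 1) (k + 1 + 1)) + eval 1 (lam (n + 1) k)) -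
        eval 1 (lam n (k + 1))) = P := by
        intro P hP; rw [← hP]; ring
      apply this
      rw [h1, h2, h3]
      push_cast
      split_ifs <;> first | omega | norm_num

/-- homogenization of a polynomial -/
def hom {R : Type*} [CommRing R] [Algebra ℝ R] (n : ℕ) (P : Polynomial ℝ) (u v : R) : R :=
  ∑ j ∈ Finset.range (n+1), algebraMap ℝ R (P.coeff j) * (u^j * v^(n-j))

lemma hom_mul {R : Type*} [CommRing R] [Algebra ℝ R] (n : ℕ) (P : Polynomial ℝ) (hP : P.natDegree ≤ n)
    (a b : ℝ) (u v : R) : hom (n+1) ((C a * X + C b) * P) u v =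
    (algebraMap ℝ R a * u + algebraMap ℝ R b * v) * hom n P u v := by
  have e1 : hom (n+1) (X * P) u v = u * hom n P u v := by
    unfold hom
    rw [Finset.sum_range_succ']
    simp only [coeff_X_mul, mul_coeff_zero, coeff_X_zero, zero_mul, map_zero, add_zero]
    rw [Finset.mul_sum]
    apply Finset.sum_congr rfl
    intro j hj
    rw [show n + 1 - (j+1) = n - j by omega]; ring
  have e2 : hom (n+1) P u v = v * hom n P u v := by
    unfold hom
    rw [Finset.sum_range_succ, coeff_eq_zero_of_natDegree_lt (by omega : P.natDegree < n+1)]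
    simp only [map_zero, zero_mul, add_zero]
    rw [Finset.mul_sum]
    apply Finset.sum_congr rfl
    intro j hj
    simp at hj
    rw [show n + 1 - j = n - j + 1 by omega]; ring
  have e3 : hom (n+1) ((C a * X + C b) * P) u v = algebraMap ℝ R a * hom (n+1) (X*P) u v
     + algebraMap ℝ R b * hom (n+1) P u v := by
    unfold hom
    rw [Finset.mul_sum, Finset.mul_sum, ← Finset.sum_add_distrib]
    apply Finset.sum_congr rfl
    intro j hj
    rw [add_mul, mul_assoc, coeff_add, coeff_C_mul, coeff_C_mul, map_add, map_mul, map_mul]; ring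
  rw [e3, e1, e2]; ring

/-- row polynomial -/
def rowP (a b c d : ℝ) (i m : ℕ) : Polynomial ℝ := (C a * X + C b)^i * (C c * X + C d)^m

lemma rowP_deg (a b c d : ℝ) (i m : ℕ) : (rowP a b c d i m).natDegree ≤ i + m := by
  unfold rowP
  refine natDegree_mul_le_of_le ?_ ?_
  · refine (natDegree_pow_le).trans ?_
    have : (C a * X + C b).natDegree ≤ 1 := natDegree_linear_le
    nlinarith
  · refine (natDegree_pow_le).trans ?_
    have : (C c * X + C d).natDegree ≤ 1 := natDegree_linear_le
    nlinarith

lemma hom_rowP {R : Type*} [CommRing R] [Algebra ℝ R] (a b c d : ℝ) (i m : ℕ) (u v : R) :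
    hom (i+m) (rowP a b c d i m) u v =
    (algebraMap ℝ R a * u + algebraMap ℝ R b * v)^i *
    (algebraMap ℝ R c * u + algebraMap ℝ R d * v)^m := by
  induction i with
  | zero =>
    simp only [zero_add, pow_zero, one_mul]
    induction m with
    | zero => simp [hom, rowP]
    | succ m ih =>
      have : rowP a b c d 0 (m+1) = (C c * X + C d) * rowP a b c d 0 m := by
        unfold rowP; ring
      rw [this, hom_mul _ _ (by simpa using rowP_deg a b c d 0 m), ih]; ring
  | succ i ih =>
    have : rowP a b c d (i+1) m = (C a * X + C b) * rowP a b c d i m := by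
      unfold rowP; ring
    rw [this, show i + 1 + m = i + m + 1 by ring, hom_mul _ _ (rowP_deg a b c d i m), ih]; ring

/-- symmetric power of a matrix -/
def symP (n : ℕ) (A : Matrix (Fin 2) (Fin 2) ℝ) : Matrix (Fin (n+1)) (Fin (n+1)) ℝ :=
  fun i j => (rowP (A 0 0) (A 0 1) (A 1 0) (A 1 1) i (n - i)).coeff j

lemma symP_apply (n : ℕ) (A : Matrix (Fin 2) (Fin 2) ℝ) (i j : Fin (n+1)) : symP n A i j =
    (rowP (A 0 0) (A 0 1) (A 1 0) (A 1 1) i (n - i)).coeff j := rfl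

lemma symP_mul (n : ℕ) (A B : Matrix (Fin 2) (Fin 2) ℝ) : symP n (A * B) = symP n A * symP n B := by
  ext i k
  rw [Matrix.mul_apply]
  have hi : (i:ℕ) + (n - i) = n := by omega
  have h := hom_rowP (A 0 0) (A 0 1) (A 1 0) (A 1 1) i (n - i) (C (B 0 0) * X + C (B 0 1))
    (C (B 1 0) * X + C (B 1 1))
  rw [hi] at h
  have h2 := congrArg (fun p => coeff p k) h
  simp only [hom, finsetSum_coeff, Polynomial.algebraMap_apply, Algebra.algebraMap_self, RingHom.id_apply, coeff_C_mul] at h2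
  rw [Finset.sum_range] at h2
  have h3 : ∑ j, symP n A i j * symP n B j k = ∑ j : Fin (n+1), (rowP (A 0 0) (A 0 1) (A 1 0) (A 1 1) i (n - i)).coeff j * coeff ((C (B 0 0) * X + C (B 0 1))^(j:ℕ) * (C (B 1 0) * X + C (B 1 1))^(n-j)) k := rfl
  rw [h3, h2, symP_apply]
  unfold rowP
  congr 2
  · congr 1
    simp only [Matrix.mul_apply, Fin.sum_univ_two, C_add, C_mul]; ring
  · congr 1
    simp only [Matrix.mul_apply, Fin.sum_univ_two, C_add, C_mul]; ring

lemma symP_diag (n : ℕ) (A : Matrix (Fin 2) (Fin 2) ℝ) (h1 : A 0 1 = 0) (h2 : A 1 0 = 0) (i j : Fin (n+1)) :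
    symP n A i j = if i = j then (A 0 0)^(i:ℕ) * (A 1 1)^(n-i) else 0 := by
  unfold symP rowP
  rw [h1, h2]
  simp only [map_zero, add_zero, zero_mul, zero_add, mul_pow]
  rw [← C_pow, ← C_pow, mul_assoc, coeff_C_mul, mul_comm (X^_), coeff_C_mul, coeff_X_pow]
  simp only [Fin.ext_iff, eq_comm]
  split_ifs <;> simp

end DB


namespace DB
open Polynomial

lemma hasSum_cg {ι : Type*} {f g : ι → ℝ} {a : ℝ} (h : HasSum f a) (e : ∀ k, g k = f k) : HasSum g a := by
  rw [show g = f from funext e]; exact h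

lemma symP_transpose (n : ℕ) (A : Matrix (Fin 2) (Fin 2) ℝ) (i j : Fin (n+1)) :
    (n.choose i : ℝ) * symP n A i j = (n.choose j : ℝ) * symP n A.transpose j i := by
  have key : (∑ l ∈ Finset.range (n+1), C ((n.choose l : ℝ) * (rowP (A 0 0) (A 0 1) (A 1 0) (A 1 1) l (n - l)).coeff j) * X^l)
      = C (n.choose j : ℝ) * rowP (A 0 0) (A 1 0) (A 0 1) (A 1 1) j (n - j) := by
    apply Polynomial.funext
    intro y
    have h1 : (C y * (C (A 0 0) * X + C (A 0 1)) + (C (A 1 0) * X + C (A 1 1)))^n =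
      (C (A 0 0 * y + A 1 0) * X + C (A 0 1 * y + A 1 1))^n := by
      congr 1; simp only [C_add, C_mul]; ring
    rw [add_pow, add_pow] at h1
    have h2 := congrArg (fun p => coeff p j) h1
    simp only [finsetSum_coeff] at h2
    rw [eval_finsetSum]
    have e1 : ∀ l ∈ Finset.range (n+1), eval y (C ((n.choose l : ℝ) * (rowP (A 0 0) (A 0 1) (A 1 0) (A 1 1) l (n - l)).coeff j) * X^l) = ((C y * (C (A 0 0) * X + C (A 0 1)))^l * (C (A 1 0) * X + C (A 1 1))^(n-l) * (n.choose l : Polynomial ℝ)).coeff j := by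
      intro l hl
      have : ((C y * (C (A 0 0) * X + C (A 0 1)))^l * (C (A 1 0) * X + C (A 1 1))^(n-l) * (n.choose l : Polynomial ℝ)) = C ((n.choose l : ℝ) * y^l) * rowP (A 0 0) (A 0 1) (A 1 0) (A 1 1) l (n - l) := by
        unfold rowP; simp only [C_mul, C_pow, map_natCast, mul_pow]; ring
      rw [this, coeff_C_mul]; simp; ring
    rw [Finset.sum_congr rfl e1, h2]
    rw [Finset.sum_eq_single (j:ℕ)]
    · have : ((C (A 0 0 * y + A 1 0) * X)^(j:ℕ) * C (A 0 1 * y + A 1 1)^(n-j) * (n.choose j : Polynomial ℝ)) = C ((A 0 0 * y + A 1 0)^(j:ℕ) * (A 0 1 * y + A 1 1)^(n-j) * (n.choose j : ℝ)) * X^(j:ℕ) := by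
        simp only [C_mul, C_pow, map_natCast]; ring
      rw [this, coeff_C_mul, coeff_X_pow]
      simp [rowP]; ring
    · intro b _ hb
      have : ((C (A 0 0 * y + A 1 0) * X)^b * C (A 0 1 * y + A 1 1)^(n-b) * (n.choose b : Polynomial ℝ)) = C ((A 0 0 * y + A 1 0)^b * (A 0 1 * y + A 1 1)^(n-b) * (n.choose b : ℝ)) * X^b := by
        simp only [C_mul, C_pow, map_natCast]; ring
      rw [this, coeff_C_mul, coeff_X_pow, if_neg (fun h => hb h.symm), mul_zero]
    · intro h; exact absurd (Finset.mem_range.mpr j.2) h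
  have h3 := congrArg (fun p => coeff p i) key
  simp only [finsetSum_coeff, coeff_C_mul, coeff_X_pow] at h3
  rw [Finset.sum_eq_single (i:ℕ)] at h3
  · rw [symP_apply, symP_apply]; simpa using h3
  · intro b _ hb; rw [if_neg (fun h => hb h.symm), mul_zero]
  · intro h; exact absurd (Finset.mem_range.mpr i.2) h

lemma symP_pair_nonneg (n : ℕ) (A : Matrix (Fin 2) (Fin 2) ℝ) (i j : Fin (n+1)) :
    0 ≤ symP n A i j * symP n A.transpose j i := by
  have h := symP_transpose n A i j
  have hj : (0:ℝ) < n.choose j := by exact_mod_cast Nat.choose_pos (by omega)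
  have hi : (0:ℝ) < n.choose i := by exact_mod_cast Nat.choose_pos (by omega)
  have : symP n A.transpose j i = (n.choose i : ℝ) / n.choose j * symP n A i j := by
    field_simp; linarith
  rw [this]
  have : 0 ≤ (n.choose i : ℝ) / n.choose j := by positivity
  nlinarith [mul_nonneg this (mul_self_nonneg (symP n A i j))]

lemma trace_symP_diagzable (n : ℕ) (A P : Matrix (Fin 2) (Fin 2) ℝ) (α β : ℝ) (hP : IsUnit P.det)
    (h : A * P = P * !![α, 0; 0, β]) :
    (symP n A).trace = ∑ i ∈ Finset.range (n+1), α^i * β^(n-i) := by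
  have hA : A = P * !![α, 0; 0, β] * P⁻¹ := by
    rw [← h, Matrix.mul_assoc, Matrix.mul_nonsing_inv _ hP, Matrix.mul_one]
  have h1 : symP n P⁻¹ * symP n P = 1 := by
    rw [← symP_mul, Matrix.nonsing_inv_mul _ hP]
    ext i j
    rw [symP_diag _ _ (by simp) (by simp)]
    simp [Matrix.one_apply]
  rw [hA, symP_mul, symP_mul, Matrix.trace_mul_comm, ← Matrix.mul_assoc, h1, Matrix.one_mul]
  unfold Matrix.trace
  rw [Finset.sum_range]
  apply Finset.sum_congr rfl
  intro i _
  rw [Matrix.diag_apply, symP_diag _ _ (by simp) (by simp)]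
  simp

lemma hsum_rec (α β : ℝ) (h : α ≠ β) (n : ℕ) : ∑ i ∈ Finset.range (n+3), α^i * β^(n+2-i) =
    (α + β) * (∑ i ∈ Finset.range (n+2), α^i * β^(n+1-i)) -
    α * β * ∑ i ∈ Finset.range (n+1), α^i * β^(n-i) := by
  have h1 := (Commute.all α β).geom_sum₂_mul (n+3)
  have h2 := (Commute.all α β).geom_sum₂_mul (n+2)
  have h3 := (Commute.all α β).geom_sum₂_mul (n+1)
  simp only [show n+3-1 = n+2 by omega, show n+2-1 = n+1 by omega, show n+1-1 = n by omega] at h1 h2 h3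
  have : α - β ≠ 0 := sub_ne_zero.mpr h
  apply mul_right_cancel₀ this
  linear_combination h1 - (α+β) * h2 + α*β*h3

lemma lam_hasSum (s q α β : ℝ) (hq : q ≠ 0) (h : α ≠ β) (hab : α * β = 1)
    (hs : α + β = 2 * (1 - s) + s * (q + q⁻¹)) (n : ℕ) :
    HasSum (fun k : ℤ => (lam n k).eval s * q^k) (∑ i ∈ Finset.range (n+1), α^i * β^(n-i)) := by
  have shift : ∀ (m : ℕ) (a : ℝ), HasSum (fun k : ℤ => (lam m k).eval s * q^k) a →
     HasSum (fun k : ℤ => ((2 * (1 - s)) * (lam m k).eval s + s * ((lam m (k+1)).eval s + (lam m (k-1)).eval s)) * q^k) ((α + β) * a) := by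
    intro m a ha
    have h1 : HasSum (fun k : ℤ => (lam m (k+1)).eval s * q^(k+1)) a := by
      have := (Equiv.addRight (1:ℤ)).hasSum_iff (f := fun k : ℤ => (lam m k).eval s * q^k) (a := a)
      simp only [Function.comp_def, Equiv.coe_addRight] at this
      exact this.mpr ha
    have h2 : HasSum (fun k : ℤ => (lam m (k-1)).eval s * q^(k-1)) a := by
      have := (Equiv.subRight (1:ℤ)).hasSum_iff (f := fun k : ℤ => (lam m k).eval s * q^k) (a := a)
      simp only [Function.comp_def, Equiv.subRight_apply] at this
      exact this.mpr ha
    have h3 := ((ha.mul_left (2*(1-s))).add (h1.mul_left (s * q⁻¹))).add (h2.mul_left (s*q))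
    rw [show (α + β) * a = 2 * (1 - s) * a + s * q⁻¹ * a + s * q * a by rw [hs]; ring]
    refine hasSum_cg h3 ?_
    · intro k
      rw [zpow_add_one₀ hq, zpow_sub_one₀ hq]
      field_simp
      ring
  have base : HasSum (fun k : ℤ => (lam 0 k).eval s * q^k) 1 := by
    convert hasSum_ite_eq (0:ℤ) (1:ℝ) using 1
    ext k
    rw [lam_zero]
    split_ifs with hk
    · simp [hk]
    · simp
  induction n using Nat.strong_induction_on with
  | _ n ih =>
    match n with
    | 0 => simpa using base
    | 1 =>
      have := shift 0 _ base
      convert this using 1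
      · ext k
        rw [lam_one]; simp
      · simp [Finset.sum_range_succ]; ring
    | n+2 =>
      have h1 := shift (n+1) _ (ih (n+1) (by omega))
      have h2 := ih n (by omega)
      rw [hsum_rec α β h n, hab, one_mul]
      refine hasSum_cg (h1.sub h2) ?_
      · intro k
        rw [lam_rec]; simp; ring

lemma lam_nonneg_aux (n : ℕ) (s : ℝ) (h0 : 0 < s) (h1 : s < 1) (m : ℕ) :
    0 ≤ (lam n ((m:ℤ) - n)).eval s := by
  set a := √(1 - s) with ha
  set b := √s with hb
  have ha2 : a^2 = 1 - s := Real.sq_sqrt (by linarith)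
  have hb2 : b^2 = s := Real.sq_sqrt (by linarith)
  have hapos : 0 < a := Real.sqrt_pos.mpr (by linarith)
  have hbpos : 0 < b := Real.sqrt_pos.mpr (by linarith)
  set M : Matrix (Fin 2) (Fin 2) ℝ := !![a, b; -b, a] with hM
  set w : Fin (n+1) → Fin (n+1) → ℝ := fun i j => symP n M i j * symP n M.transpose j i with hw
  set p1 : Polynomial ℝ := ∑ l ∈ Finset.range (2*n+1), C ((lam n ((l:ℤ) - n)).eval s) * X^l with hp1
  set p2 : Polynomial ℝ := ∑ i : Fin (n+1), ∑ j : Fin (n+1), C (w i j) * X^((i:ℕ) + (n - j)) with hp2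
  have key : ∀ q : ℝ, 1 < q → p1.eval q = p2.eval q := by
    intro q hq
    have hq0 : q ≠ 0 := by positivity
    set T := 2 * (1 - s) + s * (q + q⁻¹) with hT
    have hqi : 2 < q + q⁻¹ := by
      have : q + q⁻¹ - 2 = (q-1)^2/q := by field_simp; ring
      have : 0 < (q-1)^2/q := by
        apply div_pos; apply pow_pos; linarith; linarith
      linarith
    have hT2 : 2 < T := by nlinarith
    set r := √(T^2 - 4) with hr
    have hr2 : r^2 = T^2 - 4 := Real.sq_sqrt (by nlinarith)
    have hrpos : 0 < r := Real.sqrt_pos.mpr (by nlinarith)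
    set α := (T + r)/2 with hα
    set β := (T - r)/2 with hβ
    have hne : α ≠ β := by intro h; rw [hα, hβ] at h; linarith
    have hab : α * β = 1 := by rw [hα, hβ]; linear_combination (-1/4) * hr2
    have hsum : α + β = T := by rw [hα, hβ]; ring
    have H := lam_hasSum s q α β hq0 hne hab hsum n
    -- first polynomial
    have e1 : p1.eval q = q^n * ∑ i ∈ Finset.range (n+1), α^i * β^(n-i) := by
      have inj : Function.Injective (fun l : ℕ => (l:ℤ) - n) := by
        intro x y hxy; simp at hxy; exact hxy
      have H2 := (inj.hasSum_iff (by
        intro k hk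
        have : k < -n := by
          by_contra hcon
          apply hk
          exact ⟨(k + n).toNat, by simp; omega⟩
        rw [lam_big n k (by rw [lt_abs]; right; omega)]; simp)).mpr H
      have H3 : HasSum ((fun k : ℤ => (lam n k).eval s * q^k) ∘ (fun l : ℕ => (l:ℤ) - n)) (∑ l ∈ Finset.range (2*n+1), ((fun k : ℤ => (lam n k).eval s * q^k) ∘ (fun l : ℕ => (l:ℤ) - n)) l) := by
        apply hasSum_sum_of_ne_finset_zero
        intro l hl
        simp at hl
        simp only [Function.comp]
        rw [lam_big n _ (by rw [lt_abs]; left; omega)]; simp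
      rw [H2.unique H3, Finset.mul_sum, hp1, eval_finsetSum]
      apply Finset.sum_congr rfl
      intro l _
      simp only [eval_mul, eval_C, eval_pow, eval_X, Function.comp]
      rw [zpow_sub₀ hq0]
      simp only [zpow_natCast]
      field_simp
    have e2 : p2.eval q = q^n * ∑ i ∈ Finset.range (n+1), α^i * β^(n-i) := by
      set A : Matrix (Fin 2) (Fin 2) ℝ := !![q, 0; 0, 1] * M * !![q⁻¹, 0; 0, 1] * M.transpose with hA
      have hA' : A = !![a^2 + q*b^2, a*b*(q-1); a*b*(1-q⁻¹), a^2+b^2*q⁻¹] := by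
        rw [hA, hM]
        ext i j
        fin_cases i <;> fin_cases j <;> simp [Matrix.mul_apply, Fin.sum_univ_two, Matrix.transpose] <;> field_simp <;> ring
      have hTr := trace_symP_diagzable n A !![a*b*(q-1), a*b*(q-1); α - (a^2+q*b^2), β - (a^2+q*b^2)] α β (by
        rw [Matrix.det_fin_two_of, isUnit_iff_ne_zero]
        have : a*b*(q-1) * (β - (a^2+q*b^2)) - a*b*(q-1)*(α - (a^2+q*b^2)) = -(a*b*(q-1)*(α - β)) := by ring
        rw [this, neg_ne_zero]
        have : α - β ≠ 0 := sub_ne_zero.mpr hne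
        have : q - 1 ≠ 0 := by linarith
        positivity) (by
        have hqq : q * q⁻¹ = 1 := mul_inv_cancel₀ hq0
        have hca : α^2 = T * α - 1 := by rw [← hsum, ← hab]; ring
        have hcb : β^2 = T * β - 1 := by rw [← hsum, ← hab]; ring
        rw [hA']
        rw [hT, ← hb2] at hca hcb
        have hone : a^2 = 1 - b^2 := by rw [ha2, hb2]
        have e4 : ∀ c : ℝ, c^2 = (2*(1-b^2) + b^2*(q+q⁻¹))*c - 1 → a*b*(1-q⁻¹)*(a*b*(q-1)) + (a^2+b^2*q⁻¹)*(c - (a^2+q*b^2)) = (c - (a^2+q*b^2)) * c := by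
          intro c hc
          rw [show a*b*(1-q⁻¹)*(a*b*(q-1)) = a^2*b^2*(1-q⁻¹)*(q-1) by ring, hone]
          linear_combination (-1) * hc - b^2 * hqq
        ext i j
        fin_cases i <;> fin_cases j <;> simp [Matrix.mul_apply, Fin.sum_univ_two]
        · ring
        · ring
        · exact e4 α hca
        · exact e4 β hcb)
      rw [← hTr, hA, symP_mul, symP_mul, symP_mul, hp2, eval_finsetSum]
      unfold Matrix.trace
      rw [Finset.mul_sum]
      apply Finset.sum_congr rfl
      intro i _
      rw [Matrix.diag_apply, Matrix.mul_apply, eval_finsetSum, Finset.mul_sum]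
      apply Finset.sum_congr rfl
      intro j _
      have hd1 : ∀ x y : ℝ, symP n !![x, 0; 0, 1] = Matrix.diagonal (fun i : Fin (n+1) => x^(i:ℕ)) := by
        intro x y
        ext i j
        rw [symP_diag _ _ (by simp) (by simp), Matrix.diagonal_apply]; simp
      rw [hd1 q 0, hd1 q⁻¹ 0, Matrix.mul_diagonal, Matrix.diagonal_mul]
      simp only [eval_mul, eval_C, eval_pow, eval_X, hw]
      have : q^n = q^(n-j) * q^(j:ℕ) := by rw [← pow_add]; congr 1; omega
      rw [this, pow_add, inv_pow]
      field_simp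
    rw [e1, e2]
  have heq : p1 = p2 := by
    apply Polynomial.eq_of_infinite_eval_eq
    apply Set.Infinite.mono (s := Set.Ioi 1)
    · intro q hq; exact key q hq
    · exact Set.Ioi_infinite 1
  by_cases hm : m < 2*n+1
  · have c1 : p1.coeff m = (lam n ((m:ℤ) - n)).eval s := by
      rw [hp1, finsetSum_coeff]
      simp only [coeff_C_mul, coeff_X_pow]
      rw [Finset.sum_eq_single m]
      · simp
      · intro b _ hb; rw [if_neg (Ne.symm hb), mul_zero]
      · intro h; exfalso; apply h; simpa using hm
    rw [← c1, heq, hp2, finsetSum_coeff]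
    apply Finset.sum_nonneg; intro i _
    rw [finsetSum_coeff]
    apply Finset.sum_nonneg; intro j _
    rw [coeff_C_mul, coeff_X_pow]
    apply mul_nonneg (symP_pair_nonneg n M i j)
    split_ifs <;> norm_num
  · rw [lam_big n _ (by rw [lt_abs]; left; omega)]; simp

lemma lam_nonneg (n : ℕ) (k : ℤ) (s : ℝ) (h0 : 0 ≤ s) (h1 : s ≤ 1) : 0 ≤ (lam n k).eval s := by
  by_cases hk : k < -n
  · rw [lam_big n _ (by rw [lt_abs]; right; omega)]; simp
  have hk' : k = (((k + n).toNat : ℕ) : ℤ) - n := by omega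
  rw [hk']
  have hcl : s ∈ closure (Set.Ioo (0:ℝ) 1) := by
    rw [closure_Ioo (by norm_num)]; exact ⟨h0, h1⟩
  have hc : IsClosed {x : ℝ | 0 ≤ (lam n (((k + n).toNat : ℕ) - n)).eval x} :=
    isClosed_le continuous_const (Polynomial.continuous _)
  exact hc.closure_subset_iff.mpr (fun x hx => lam_nonneg_aux n x hx.1 hx.2 _) hcl

end DB


namespace DB
open Polynomial

/-- de Branges weight functions, as polynomials in `s = exp (-t)` -/
def tauP (n k : ℕ) : Polynomial ℝ := ∑ j ∈ Finset.Ico k (n+1), (lam n j + lam n (j+1))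

lemma tauP_sub (n k : ℕ) : tauP n k - tauP n (k+1) = lam n k + lam n (k+1) := by
  unfold tauP
  by_cases h : k < n + 1
  · rw [Finset.sum_eq_sum_Ico_succ_bot h]; ring
  · rw [Finset.Ico_eq_empty (by omega), Finset.Ico_eq_empty (by omega), lam_big n k (by rw [lt_abs]; left; omega),
      lam_big n (k+1) (by rw [lt_abs]; left; omega)]; simp

lemma tauP_big (n k : ℕ) (h : n < k) : tauP n k = 0 := by
  unfold tauP; rw [Finset.Ico_eq_empty (by omega)]; simp

lemma tauP_one (n k : ℕ) (h : k ≤ n + 1) : (tauP n k).eval 1 = n + 1 - k := by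
  unfold tauP
  rw [eval_finsetSum, Finset.sum_congr rfl (g := fun _ => (1:ℝ))]
  · simp; push_cast [Nat.cast_sub h]; ring
  · intro j hj
    simp at hj
    rw [eval_add, lam_at_one, if_pos (by omega)]

lemma tauP_deriv (n k : ℕ) : X * derivative (tauP n k) = (k : Polynomial ℝ) * lam n k := by
  by_cases h : k ≤ n + 1
  · induction h using Nat.decreasingInduction with
    | self => rw [tauP_big n _ (by omega), lam_big n _ (by rw [lt_abs]; left; omega)]; simp
    | of_succ k hk ih =>
      have h1 := tauP_sub n k
      have : tauP n k = lam n k + lam n (k+1) + tauP n (k+1) := by rw [← h1]; ring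
      have h3 := lam_ode n k
      rw [this, derivative_add, derivative_add, mul_add, ih]
      push_cast at *
      linear_combination h3
  · rw [tauP_big n _ (by omega), lam_big n _ (by rw [lt_abs]; left; omega)]; simp

lemma tauP_nonneg (n k : ℕ) (s : ℝ) (h0 : 0 ≤ s) (h1 : s ≤ 1) : 0 ≤ (tauP n k).eval s := by
  unfold tauP
  rw [eval_finsetSum]
  apply Finset.sum_nonneg; intro j _
  rw [eval_add]
  exact add_nonneg (lam_nonneg n _ s h0 h1) (lam_nonneg n _ s h0 h1)

/-- de Branges weight functions -/
def tau (n k : ℕ) (t : ℝ) : ℝ := (tauP n k).eval (Real.exp (-t))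
/-- de Branges weight derivative -/
def la (n k : ℕ) (t : ℝ) : ℝ := (lam n k).eval (Real.exp (-t))

lemma la_nonneg (n k : ℕ) (t : ℝ) (ht : 0 ≤ t) : 0 ≤ la n k t :=
  lam_nonneg n k _ (Real.exp_pos _).le (by simpa using ht)

lemma tau_nonneg (n k : ℕ) (t : ℝ) (ht : 0 ≤ t) : 0 ≤ tau n k t :=
  tauP_nonneg n k _ (Real.exp_pos _).le (by simpa using ht)

lemma tau_zero (n k : ℕ) (h : k ≤ n + 1) : tau n k 0 = n + 1 - k := by
  unfold tau; simpa using tauP_one n k h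

lemma tau_big (n k : ℕ) (h : n < k) (t : ℝ) : tau n k t = 0 := by
  unfold tau; rw [tauP_big n k h]; simp

lemma tau_sub (n k : ℕ) (t : ℝ) : tau n k t - tau n (k+1) t = la n k t + la n (k+1) t := by
  unfold tau la; rw [← eval_sub, tauP_sub, eval_add]; push_cast; rfl

lemma la_big (n k : ℕ) (h : n < k) (t : ℝ) : la n k t = 0 := by
  unfold la; rw [lam_big n k (by rw [lt_abs]; left; omega)]; simp

lemma tau_hasDerivAt (n k : ℕ) (t : ℝ) : HasDerivAt (tau n k) (-(k * la n k t)) t := by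
  unfold tau la
  have h1 : HasDerivAt (fun t : ℝ => Real.exp (-t)) (-Real.exp (-t)) t := by
    have := (hasDerivAt_neg t).exp
    simpa using this
  have h2 := ((tauP n k).hasDerivAt (Real.exp (-t))).comp t h1
  refine h2.congr_deriv ?_
  have := congrArg (eval (Real.exp (-t))) (tauP_deriv n k)
  simp at this
  rw [← this]; ring

lemma la_contDiff (n k : ℕ) : ContDiff ℝ 1 (la n k) := by
  unfold la
  have h1 : ContDiff ℝ 1 (fun t : ℝ => Real.exp (-t)) := by fun_prop
  simp only [Polynomial.eval_eq_sum_range]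
  fun_prop

/-- second-order Taylor estimate of the weights -/
lemma tau_taylor (n : ℕ) (T : ℝ) : ∃ C : ℝ, 0 ≤ C ∧ ∀ k ≤ n, ∀ s ∈ Icc 0 T, ∀ t ∈ Icc 0 T,
    |tau n k s - tau n k t + (s - t) * (k * la n k t)| ≤ C * (s - t)^2 := by
  have one : ∀ k, ∃ C : ℝ, 0 ≤ C ∧ ∀ s ∈ Icc 0 T, ∀ t ∈ Icc 0 T,
    |tau n k s - tau n k t + (s - t) * (k * la n k t)| ≤ C * (s - t)^2 := by
    intro k
    obtain ⟨K, hK⟩ := ((la_contDiff n k).contDiffOn (s := Icc 0 T)).exists_lipschitzOnWith (by norm_num) (convex_Icc 0 T) isCompact_Icc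
    refine ⟨k * K, by positivity, ?_⟩
    intro s hs t ht
    have hf : ∀ x ∈ uIcc t s, HasDerivWithinAt (fun x => tau n k x + x * (k * la n k t)) (-(k * la n k x) + 1 * (k * la n k t)) (uIcc t s) x := by
      intro x _
      exact ((tau_hasDerivAt n k x).add ((hasDerivAt_id x).mul_const _)).hasDerivWithinAt
    have hb : ∀ x ∈ uIcc t s, ‖-(k * la n k x) + 1 * (k * la n k t)‖ ≤ k * K * |s - t| := by
      intro x hx
      have hxI : x ∈ Icc 0 T := (uIcc_subset_Icc ht hs) hx
      have := hK.dist_le_mul x hxI t ht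
      rw [Real.dist_eq, Real.dist_eq] at this
      have h2 : |x - t| ≤ |s - t| := by
        have := abs_sub_left_of_mem_uIcc hx
        simpa [abs_sub_comm] using this
      rw [show -(k * la n k x) + 1 * (k * la n k t) = -(k * (la n k x - la n k t)) by ring, norm_neg, Real.norm_eq_abs, abs_mul, Nat.abs_cast, mul_assoc]
      gcongr
      exact this.trans (by gcongr)
    have := (convex_uIcc t s).norm_image_sub_le_of_norm_hasDerivWithin_le hf hb left_mem_uIcc right_mem_uIcc
    rw [Real.norm_eq_abs, Real.norm_eq_abs] at this
    calc _ = |tau n k s + s * (k * la n k t) - (tau n k t + t * (k * la n k t))| := by congr 1; ring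
      _ ≤ _ := this
      _ = _ := by rw [mul_assoc, ← sq, sq_abs]
  choose C hC0 hC using one
  refine ⟨∑ k ∈ Finset.range (n+1), C k, Finset.sum_nonneg (fun k _ => hC0 k), ?_⟩
  intro k hk s hs t ht
  refine (hC k s hs t ht).trans ?_
  gcongr
  exact Finset.single_le_sum (f := C) (fun k _ => hC0 k) (by simp; omega)

/-- the key positivity of the first variation along a Poisson kernel -/
lemma key_identity (n : ℕ) (τ l : ℕ → ℝ) (hl : ∀ k, 0 ≤ l k) (hln : l (n+1) = 0) (hτn : τ (n+1) = 0)
    (hτ : ∀ k, τ k - τ (k+1) = l k + l (k+1)) (c : ℕ → ℂ) (κ : ℂ) (hκ : ‖κ‖ = 1) (P : ℕ → ℂ)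
    (hP0 : P 0 = 1) (hP : ∀ m, 1 ≤ m → P m = 2 * κ^m) :
    0 ≤ ∑ k ∈ Finset.Icc 1 n, (-(k * l k) * (k * ‖c k‖^2 - 4 / k) +
      2 * k * τ k * ((starRingEnd ℂ (c k)) * (P k + ∑ j ∈ Finset.Icc 1 k, j * c j * P (k - j))).re) := by
  have hκ0 : κ ≠ 0 := by intro h; rw [h] at hκ; simp at hκ
  set b : ℕ → ℂ := fun k => ∑ j ∈ Finset.Icc 1 k, j * c j * (κ^j)⁻¹ with hb
  have hb0 : b 0 = 0 := by simp [hb]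
  have hbs : ∀ k, b (k+1) = b k + (k+1) * c (k+1) * (κ^(k+1))⁻¹ := by
    intro k
    simp only [hb]
    rw [Finset.sum_Icc_succ_top (by omega)]; push_cast; rfl
  have hc : ∀ k : ℕ, ((k:ℂ)+1) * c (k+1) = κ^(k+1) * (b (k+1) - b k) := by
    intro k; rw [hbs]; field_simp; ring
  have hD : ∀ k, P (k+1) + ∑ j ∈ Finset.Icc 1 (k+1), j * c j * P (k + 1 - j) = κ^(k+1) * (b (k+1) + b k + 2) := by
    intro k
    rw [Finset.sum_Icc_succ_top (by omega), Nat.sub_self, hP0, hP _ (by omega)]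
    have : ∑ j ∈ Finset.Icc 1 k, j * c j * P (k + 1 - j) = 2 * κ^(k+1) * b k := by
      simp only [hb]
      rw [Finset.mul_sum]
      apply Finset.sum_congr rfl
      intro j hj
      simp at hj
      rw [hP _ (by omega)]
      have : κ^(k+1) = κ^(k+1-j) * κ^j := by rw [← pow_add]; congr 1; omega
      rw [this]; field_simp
    rw [this]
    have := hc k
    push_cast at *
    linear_combination this
  set x : ℕ → ℝ := fun k => ‖b k + 1‖^2 - 1 with hx
  have hterm : ∀ k, (-((k+1:ℕ) * l (k+1)) * ((k+1:ℕ) * ‖c (k+1)‖^2 - 4 / (k+1:ℕ)) +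
      2 * (k+1:ℕ) * τ (k+1) * ((starRingEnd ℂ (c (k+1))) * (P (k+1) + ∑ j ∈ Finset.Icc 1 (k+1), j * c j * P (k + 1 - j))).re) =
      l (k+1) * ‖b (k+1) + b k + 2‖^2 + 2 * τ (k+1) * (x (k+1) - x k) - 2 * l (k+1) * (x (k+1) + x k) := by
    intro k
    rw [hD]
    have hk : ((k+1:ℕ):ℝ) ≠ 0 := by positivity
    have h1 : ((k+1:ℕ):ℝ)^2 * ‖c (k+1)‖^2 = ‖b (k+1) - b k‖^2 := by
      have := congrArg norm (hc k)
      rw [norm_mul, norm_mul, norm_pow, hκ, one_pow, one_mul] at this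
      rw [← this, mul_pow]
      congr 2
      have : ((k:ℂ)+1) = (((k:ℝ)+1 : ℝ) : ℂ) := by push_cast; rfl
      rw [this, Complex.norm_real, Real.norm_of_nonneg (by positivity)]; push_cast; rfl
    have h2 : ((k+1:ℕ):ℝ) * ((starRingEnd ℂ (c (k+1))) * (κ^(k+1) * (b (k+1) + b k + 2))).re = ((starRingEnd ℂ (b (k+1) - b k)) * (b (k+1) + b k + 2)).re := by
      have e : ((k+1:ℕ):ℂ) * (starRingEnd ℂ (c (k+1))) = (starRingEnd ℂ (κ^(k+1))) * starRingEnd ℂ (b (k+1) - b k) := by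
        rw [← map_mul, ← hc k, map_mul]; simp
      have e2 : (starRingEnd ℂ (κ^(k+1))) * κ^(k+1) = 1 := by
        rw [← Complex.normSq_eq_conj_mul_self, Complex.normSq_eq_norm_sq, norm_pow, hκ]; simp
      have e3 : ((k+1:ℕ):ℂ) * ((starRingEnd ℂ (c (k+1))) * (κ^(k+1) * (b (k+1) + b k + 2))) = (starRingEnd ℂ (b (k+1) - b k)) * (b (k+1) + b k + 2) := by
        linear_combination (κ^(k+1) * (b (k+1) + b k + 2)) * e + (starRingEnd ℂ (b (k+1) - b k)) * (b (k+1) + b k + 2) * e2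
      rw [← e3]
      have : (((k+1:ℕ)):ℂ) = ((((k+1:ℕ):ℝ)):ℂ) := by push_cast; rfl
      rw [this, Complex.re_ofReal_mul]
    have h3 : -(((k+1:ℕ):ℝ) * l (k+1)) * (((k+1:ℕ):ℝ) * ‖c (k+1)‖^2 - 4 / (k+1:ℕ)) = - l (k+1) * (‖b (k+1) - b k‖^2 - 4) := by
      rw [← h1]; field_simp
    rw [h3, mul_comm (2 * ((k+1:ℕ):ℝ)), mul_assoc, mul_assoc 2, h2]
    simp only [hx]
    rw [← Complex.normSq_eq_norm_sq, ← Complex.normSq_eq_norm_sq, ← Complex.normSq_eq_norm_sq, ← Complex.normSq_eq_norm_sq]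
    simp [Complex.normSq_apply]
    ring
  have hsum : ∀ m, ∑ k ∈ Finset.Icc 1 m, (2 * τ k * (x k - x (k-1)) - 2 * l k * (x k + x (k-1))) = 2 * (τ (m+1) + l (m+1)) * x m := by
    intro m
    induction m with
    | zero => simp [hx, hb0]
    | succ m ih =>
      rw [Finset.sum_Icc_succ_top (by omega), ih, show m + 1 - 1 = m by omega]
      linear_combination 2 * (x (m+1)) * hτ (m+1)
  have : ∑ k ∈ Finset.Icc 1 n, (-(k * l k) * (k * ‖c k‖^2 - 4 / k) +
      2 * k * τ k * ((starRingEnd ℂ (c k)) * (P k + ∑ j ∈ Finset.Icc 1 k, j * c j * P (k - j))).re) =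
      ∑ k ∈ Finset.Icc 1 n, l k * ‖b k + b (k-1) + 2‖^2 + ∑ k ∈ Finset.Icc 1 n, (2 * τ k * (x k - x (k-1)) - 2 * l k * (x k + x (k-1))) := by
    rw [← Finset.sum_add_distrib]
    apply Finset.sum_congr rfl
    intro k hk
    simp at hk
    obtain ⟨k', rfl⟩ : ∃ k', k = k' + 1 := ⟨k - 1, by omega⟩
    rw [hterm, show k' + 1 - 1 = k' by omega]; ring
  rw [this, hsum, hln, hτn]
  simp only [add_zero, mul_zero, zero_mul]
  exact Finset.sum_nonneg (fun k _ => mul_nonneg (hl k) (by positivity))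

end DB


namespace DB

lemma lebedev_milin (α β : ℕ → ℂ) (h0 : β 0 = 1)
    (hrec : ∀ k : ℕ, 1 ≤ k → (k:ℂ) * β k = ∑ j ∈ Finset.Icc 1 k, (j:ℂ) * α j * β (k - j)) (n : ℕ) :
    ∑ k ∈ Finset.range (n+1), ‖β k‖^2 ≤ (n+1) * Real.exp ((1/(n+1)) *
      ∑ k ∈ Finset.Icc 1 n, ((n:ℝ)+1-k) * (k * ‖α k‖^2 - 1/k)) := by
  induction n with
  | zero => simp [h0]
  | succ n ih =>
    set A : ℝ := ∑ k ∈ Finset.Icc 1 (n+1), (k:ℝ)^2 * ‖α k‖^2 with hA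
    set B : ℝ := ∑ k ∈ Finset.range (n+1), ‖β k‖^2 with hB
    have hA0 : 0 ≤ A := Finset.sum_nonneg (fun k _ => by positivity)
    have hB0 : 0 ≤ B := Finset.sum_nonneg (fun k _ => by positivity)
    have hn : (0:ℝ) < n + 1 := by positivity
    have cs : ((n:ℝ)+1)^2 * ‖β (n+1)‖^2 ≤ A * B := by
      have h1 := congrArg norm (hrec (n+1) (by omega))
      rw [norm_mul, Complex.norm_natCast] at h1
      have h2 : ((n+1:ℕ):ℝ) * ‖β (n+1)‖ ≤ ∑ j ∈ Finset.Icc 1 (n+1), ((j:ℝ) * ‖α j‖) * ‖β (n + 1 - j)‖ := by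
        rw [h1]
        refine (norm_sum_le _ _).trans (le_of_eq ?_)
        apply Finset.sum_congr rfl
        intro j _
        rw [norm_mul, norm_mul, Complex.norm_natCast]
      have h3 := Finset.sum_mul_sq_le_sq_mul_sq (Finset.Icc 1 (n+1)) (fun j => (j:ℝ) * ‖α j‖) (fun j => ‖β (n+1-j)‖)
      have h4 : ∑ j ∈ Finset.Icc 1 (n+1), ‖β (n+1-j)‖^2 = B := by
        rw [hB, ← Finset.sum_range_reflect, Finset.range_eq_Ico, Finset.sum_Ico_eq_sum_range]
        rw [show Finset.Icc 1 (n+1) = Finset.Ico 1 (n+1+1) from rfl, Finset.sum_Ico_eq_sum_range]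
        apply Finset.sum_congr (by simp)
        intro j _
        congr 3; omega
      rw [h4] at h3
      have h5 : ∑ j ∈ Finset.Icc 1 (n+1), ((j:ℝ) * ‖α j‖)^2 = A := by
        rw [hA]; apply Finset.sum_congr rfl; intro j _; ring
      rw [h5] at h3
      refine le_trans ?_ h3
      rw [← mul_pow]
      push_cast at h2
      gcongr
    have step : (1/(((n+1:ℕ):ℝ)+1)) * ∑ k ∈ Finset.Icc 1 (n+1), (((n+1:ℕ):ℝ)+1-k) * (k * ‖α k‖^2 - 1/k)
        = (1/((n:ℝ)+1)) * ∑ k ∈ Finset.Icc 1 n, ((n:ℝ)+1-k) * (k * ‖α k‖^2 - 1/k) + (A - (n+1)) / ((n+1)*(n+2)) := by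
      have e1 : ∑ k ∈ Finset.Icc 1 n, ((n:ℝ)+1-k) * (k * ‖α k‖^2 - 1/k) = ∑ k ∈ Finset.Icc 1 (n+1), ((n:ℝ)+1-k) * (k * ‖α k‖^2 - 1/k) := by
        rw [Finset.sum_Icc_succ_top (by omega)]; simp
      have e2 : A - (n+1) = ∑ k ∈ Finset.Icc 1 (n+1), (k:ℝ) * (k * ‖α k‖^2 - 1/k) := by
        have : ((n:ℝ)+1) = ∑ k ∈ Finset.Icc 1 (n+1), (1:ℝ) := by simp
        rw [this, hA, ← Finset.sum_sub_distrib]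
        apply Finset.sum_congr rfl
        intro k hk
        have : (k:ℝ) ≠ 0 := by simp only [Finset.mem_Icc] at hk; have := hk.1; exact_mod_cast (by omega : k ≠ 0)
        field_simp
      rw [e1, e2, Finset.mul_sum, Finset.mul_sum, Finset.sum_div, ← Finset.sum_add_distrib]
      apply Finset.sum_congr rfl
      intro k _
      push_cast
      field_simp
      ring
    rw [Finset.sum_range_succ, step, Real.exp_add]
    have hx : 1 + (A - (n+1)) / ((n+1)*(n+2)) ≤ Real.exp ((A - (n+1)) / ((n+1)*(n+2))) := by
      linarith [Real.add_one_le_exp ((A - (n+1)) / ((n+1)*(n+2)))]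
    have hb : ‖β (n+1)‖^2 ≤ A * B / ((n:ℝ)+1)^2 := by
      rw [le_div_iff₀ (by positivity)]; linarith
    have hpos : 0 ≤ 1 + (A - (n+1)) / (((n:ℝ)+1)*(n+2)) := by
      have : 1 + (A - (n+1)) / (((n:ℝ)+1)*(n+2)) = (A + (n+1)^2)/ (((n:ℝ)+1)*(n+2)) := by field_simp; ring
      rw [this]; positivity
    calc B + ‖β (n+1)‖^2 ≤ B + A * B / ((n:ℝ)+1)^2 := by linarith
      _ = B * ((n+2)/(n+1)) * (1 + (A - (n+1)) / ((n+1)*(n+2))) := by field_simp; ring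
      _ ≤ ((n+1) * Real.exp ((1/(n+1)) * ∑ k ∈ Finset.Icc 1 n, ((n:ℝ)+1-k) * (k * ‖α k‖^2 - 1/k))) * ((n+2)/(n+1)) * Real.exp ((A - (n+1)) / ((n+1)*(n+2))) := by
          gcongr
      _ = _ := by push_cast; field_simp; ring

lemma robertson_of_milin (α β : ℕ → ℂ) (h0 : β 0 = 1)
    (hrec : ∀ k : ℕ, 1 ≤ k → (k:ℂ) * β k = ∑ j ∈ Finset.Icc 1 k, (j:ℂ) * α j * β (k - j)) (n : ℕ)
    (hm : ∑ k ∈ Finset.Icc 1 n, ((n:ℝ)+1-k) * (k * ‖α k‖^2 - 1/k) ≤ 0) :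
    ∑ k ∈ Finset.range (n+1), ‖β k‖^2 ≤ n+1 := by
  refine (lebedev_milin α β h0 hrec n).trans ?_
  have : Real.exp ((1/((n:ℝ)+1)) *
      ∑ k ∈ Finset.Icc 1 n, ((n:ℝ)+1-k) * (k * ‖α k‖^2 - 1/k)) ≤ 1 := by
    rw [Real.exp_le_one_iff]
    exact mul_nonpos_of_nonneg_of_nonpos (by positivity) hm
  nlinarith

end DB


namespace DB
open scoped Topology

/-- Taylor coefficient at the origin -/
def co (f : ℂ → ℂ) (k : ℕ) : ℂ := iteratedDeriv k f 0 / (k.factorial : ℂ)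

lemma co_congr {f g : ℂ → ℂ} (h : f =ᶠ[𝓝 0] g) (k : ℕ) : co f k = co g k := by
  unfold co; rw [h.iteratedDeriv_eq]

lemma co_zero (f : ℂ → ℂ) : co f 0 = f 0 := by simp [co]
lemma co_one (f : ℂ → ℂ) : co f 1 = deriv f 0 := by simp [co]

lemma co_add {f g : ℂ → ℂ} (hf : AnalyticAt ℂ f 0) (hg : AnalyticAt ℂ g 0) (k : ℕ) :
    co (fun z => f z + g z) k = co f k + co g k := by
  unfold co
  rw [iteratedDeriv_fun_add hf.contDiffAt hg.contDiffAt, add_div]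

lemma co_sub {f g : ℂ → ℂ} (hf : AnalyticAt ℂ f 0) (hg : AnalyticAt ℂ g 0) (k : ℕ) :
    co (fun z => f z - g z) k = co f k - co g k := by
  unfold co
  rw [iteratedDeriv_fun_sub hf.contDiffAt hg.contDiffAt, sub_div]

lemma co_neg (f : ℂ → ℂ) (k : ℕ) : co (fun z => - f z) k = - co f k := by
  unfold co
  rw [iteratedDeriv_fun_neg, neg_div]

lemma co_const_mul (c : ℂ) (f : ℂ → ℂ) (k : ℕ) : co (fun z => c * f z) k = c * co f k := by
  unfold co
  rw [iteratedDeriv_const_mul_field, mul_div_assoc]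

lemma co_const (c : ℂ) (k : ℕ) : co (fun _ => c) k = if k = 0 then c else 0 := by
  unfold co
  rw [iteratedDeriv_const]
  split_ifs with h
  · simp [h]
  · simp

lemma co_sum {ι : Type*} (s : Finset ι) (f : ι → ℂ → ℂ) (h : ∀ i ∈ s, AnalyticAt ℂ (f i) 0) (k : ℕ) :
    co (fun z => ∑ i ∈ s, f i z) k = ∑ i ∈ s, co (f i) k := by
  classical
  induction s using Finset.induction_on with
  | empty => simp [co_const]
  | insert a s ha ih =>
    simp only [Finset.sum_insert ha]
    rw [co_add (h a (by simp)), ih (fun i hi => h i (by simp [hi]))]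
    exact Finset.analyticAt_fun_sum _ (fun i hi => h i (by simp [hi]))

lemma co_mul {f g : ℂ → ℂ} (hf : AnalyticAt ℂ f 0) (hg : AnalyticAt ℂ g 0) (k : ℕ) :
    co (fun z => f z * g z) k = ∑ i ∈ Finset.range (k+1), co f i * co g (k - i) := by
  unfold co
  rw [iteratedDeriv_fun_mul hf.contDiffAt hg.contDiffAt, Finset.sum_div]
  apply Finset.sum_congr rfl
  intro i hi
  have hi' : i ≤ k := by simp at hi; omega
  rw [Nat.cast_choose ℂ hi']
  have h1 : (k.factorial : ℂ) ≠ 0 := by exact_mod_cast k.factorial_ne_zero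
  have h2 : (i.factorial : ℂ) ≠ 0 := by exact_mod_cast i.factorial_ne_zero
  have h3 : ((k-i).factorial : ℂ) ≠ 0 := by exact_mod_cast (k-i).factorial_ne_zero
  field_simp

lemma co_id (k : ℕ) : co (fun z => z) k = if k = 1 then 1 else 0 := by
  unfold co
  rw [iteratedDeriv_fun_id_zero]
  split_ifs with h
  · simp [h]
  · simp

lemma co_zmul_succ {f : ℂ → ℂ} (hf : AnalyticAt ℂ f 0) (k : ℕ) : co (fun z => z * f z) (k+1) = co f k := by
  rw [co_mul (f := fun z => z) analyticAt_id hf, Finset.sum_eq_single 1]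
  · simp [co_id]
  · intro b _ hb; simp [co_id, hb]
  · intro h; simp at h

lemma co_zpow_mul {f : ℂ → ℂ} (hf : AnalyticAt ℂ f 0) (m k : ℕ) :
    co (fun z => z^m * f z) k = if k < m then 0 else co f (k - m) := by
  induction m generalizing k with
  | zero => simp
  | succ m ih =>
    have e : (fun z : ℂ => z^(m+1) * f z) = fun z => z * (z^m * f z) := by ext z; ring
    have ha : AnalyticAt ℂ (fun z : ℂ => z^m * f z) 0 := (analyticAt_id.pow m).mul hf
    rw [e]
    cases k with
    | zero => rw [co_zero]; simp
    | succ k => rw [co_zmul_succ ha, ih]; simp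

lemma co_deriv (f : ℂ → ℂ) (k : ℕ) : co (deriv f) k = (k+1) * co f (k+1) := by
  unfold co
  rw [iteratedDeriv_succ', Nat.factorial_succ]
  have h1 : (k.factorial : ℂ) ≠ 0 := by exact_mod_cast k.factorial_ne_zero
  have h2 : (k:ℂ) + 1 ≠ 0 := by exact_mod_cast (k.succ_ne_zero)
  push_cast
  field_simp

lemma anAt {f : ℂ → ℂ} {R : ℝ} (hR : 0 < R) (hf : DifferentiableOn ℂ f (ball 0 R)) : AnalyticAt ℂ f 0 :=
  hf.analyticAt (ball_mem_nhds 0 hR)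

lemma co_bound {f : ℂ → ℂ} {R C : ℝ} (hR : 0 < R) (hf : DifferentiableOn ℂ f (ball 0 R))
    (hC : ∀ z ∈ ball (0:ℂ) R, ‖f z‖ ≤ C) (k : ℕ) : ‖co f k‖ ≤ C / R^k := by
  have key : ∀ r ∈ Ioo 0 R, ‖co f k‖ ≤ C / r^k := by
    intro r hr
    have hd : DiffContOnCl ℂ f (ball 0 r) := by
      apply DifferentiableOn.diffContOnCl
      rw [closure_ball _ hr.1.ne']
      exact hf.mono (closedBall_subset_ball hr.2)
    have := Complex.norm_iteratedDeriv_le_of_forall_mem_sphere_norm_le k hr.1 hd (C := C) (fun z hz => hC z (by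
      rw [mem_sphere_iff_norm] at hz; rw [mem_ball, dist_eq_norm, hz]; exact hr.2))
    unfold co
    rw [norm_div, Complex.norm_natCast, div_le_iff₀ (by exact_mod_cast k.factorial_pos)]
    refine this.trans (le_of_eq (by ring))
  have hcont : ContinuousWithinAt (fun r : ℝ => C / r^k) (Iio R) R :=
    (continuousAt_const.div (continuousAt_id.pow k) (by simp; intro h; exact absurd h hR.ne')).continuousWithinAt
  refine ge_of_tendsto hcont ?_
  filter_upwards [Ioo_mem_nhdsLT hR] with r hr using key r hr

lemma co_hasSum {f : ℂ → ℂ} {R : ℝ} (hf : DifferentiableOn ℂ f (ball 0 R)) {z : ℂ} (hz : z ∈ ball (0:ℂ) R) :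
    HasSum (fun k => co f k * z^k) (f z) := by
  have := Complex.hasSum_taylorSeries_on_ball hf hz
  have e : (fun k => co f k * z^k) = fun n : ℕ => (n.factorial : ℂ)⁻¹ • (z - 0) ^ n • iteratedDeriv n f 0 := by
    ext k
    simp only [co, sub_zero, smul_eq_mul]; ring
  rw [e]; exact this

lemma co_circle {f : ℂ → ℂ} {R r : ℝ} (hf : DifferentiableOn ℂ f (ball 0 R)) (hr : 0 < r) (hrR : r < R) (k : ℕ) :
    co f k * r^k = (2 * Real.pi : ℂ)⁻¹ * ∫ θ in (0:ℝ)..(2 * Real.pi), f (circleMap 0 r θ) * Complex.exp (-(k * θ * Complex.I)) := by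
  have hd : DiffContOnCl ℂ f (ball 0 r) := by
    apply DifferentiableOn.diffContOnCl
    rw [closure_ball _ hr.ne']
    exact hf.mono (closedBall_subset_ball hrR)
  have h := hd.circleIntegral_one_div_sub_center_pow_smul hr k
  rw [circleIntegral] at h
  unfold co
  have hr0 : (r:ℂ) ≠ 0 := by exact_mod_cast hr.ne'
  have h1 : (k.factorial : ℂ) ≠ 0 := by exact_mod_cast k.factorial_ne_zero
  have hpi : (Real.pi : ℂ) ≠ 0 := by exact_mod_cast Real.pi_ne_zero
  have e : ∀ θ : ℝ, deriv (circleMap 0 r) θ • (1 / (circleMap 0 r θ - 0)^(k+1)) • f (circleMap 0 r θ) = (Complex.I / r^k) * (f (circleMap 0 r θ) * Complex.exp (-(k * θ * Complex.I))) := by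
    intro θ
    have hE : Complex.exp (-(k * θ * Complex.I)) = (Complex.exp (θ * Complex.I)^k)⁻¹ := by
      rw [Complex.exp_neg, ← Complex.exp_nat_mul]; congr 2; ring
    rw [deriv_circleMap, hE]
    simp only [smul_eq_mul, sub_zero]
    simp only [circleMap, zero_add]
    have := Complex.exp_ne_zero (θ * Complex.I)
    field_simp
    ring
  simp only [e] at h
  rw [intervalIntegral.integral_const_mul] at h
  simp only [smul_eq_mul] at h
  set J := ∫ θ in (0:ℝ)..(2 * Real.pi), f (circleMap 0 r θ) * Complex.exp (-(k * θ * Complex.I))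
  have hI := Complex.I_ne_zero
  field_simp at h ⊢
  linear_combination -h

lemma circle_pos_zero {f : ℂ → ℂ} {R r : ℝ} (hf : DifferentiableOn ℂ f (ball 0 R)) (hr : 0 < r) (hrR : r < R) (k : ℕ) (hk : 1 ≤ k) :
    ∫ θ in (0:ℝ)..(2 * Real.pi), f (circleMap 0 r θ) * Complex.exp (k * θ * Complex.I) = 0 := by
  have hdf : DifferentiableOn ℂ (fun z => z^k * f z) (ball 0 R) := (differentiableOn_pow k).mul hf
  have h := co_circle hdf hr hrR 0
  rw [co_zero] at h
  have hpi : (Real.pi : ℂ) ≠ 0 := by exact_mod_cast Real.pi_ne_zero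
  have hr0 : (r:ℂ) ≠ 0 := by exact_mod_cast hr.ne'
  have e : ∀ θ : ℝ, (circleMap 0 r θ)^k * f (circleMap 0 r θ) * Complex.exp (-((0:ℕ) * θ * Complex.I)) = r^k * (f (circleMap 0 r θ) * Complex.exp (k * θ * Complex.I)) := by
    intro θ
    simp only [circleMap, zero_add, mul_pow, ← Complex.exp_nat_mul]
    simp only [Nat.cast_zero, zero_mul, neg_zero, Complex.exp_zero]
    rw [show (k:ℂ) * (θ * Complex.I) = k * θ * Complex.I by ring]; ring
  simp only [e] at h
  rw [intervalIntegral.integral_const_mul, zero_pow (by omega)] at h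
  simp [hr0, hpi] at h
  exact h

lemma co_scale {f : ℂ → ℂ} (hf : AnalyticAt ℂ f 0) (r : ℂ) (k : ℕ) : co (fun z => f (r * z)) k = r^k * co f k := by
  unfold co
  rcases eq_or_ne r 0 with rfl | hr
  · simp only [zero_mul]
    rw [iteratedDeriv_const]
    cases k <;> simp
  · have hnhds : ∀ᶠ z in 𝓝 (0:ℂ), AnalyticAt ℂ f z := hf.eventually_analyticAt
    have key : ∀ k, (fun z => iteratedDeriv k (fun z => f (r * z)) z) =ᶠ[𝓝 0] (fun z => r^k * iteratedDeriv k f (r * z)) := by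
      intro k
      induction k with
      | zero => simp
      | succ k ih =>
        have ht : Filter.Tendsto (fun z : ℂ => r * z) (𝓝 0) (𝓝 0) := by
          have : Continuous (fun z : ℂ => r * z) := by fun_prop
          simpa using this.tendsto 0
        filter_upwards [ih.eventuallyEq_nhds, ht.eventually hnhds] with z hz ha
        rw [iteratedDeriv_succ, hz.deriv_eq, iteratedDeriv_succ]
        have hd : DifferentiableAt ℂ (iteratedDeriv k f) (r * z) := by
          rw [iteratedDeriv_eq_iterate]; exact (ha.iterated_deriv k).differentiableAt
        have h2 : HasDerivAt (fun z => r^k * iteratedDeriv k f (r * z)) (r^k * (deriv (iteratedDeriv k f) (r * z) * r)) z := by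
          apply HasDerivAt.const_mul
          exact hd.hasDerivAt.comp z (by simpa using (hasDerivAt_id z).const_mul r)
        rw [h2.deriv, pow_succ]; ring
    have := (key k).self_of_nhds
    simp only [mul_zero] at this
    rw [this, mul_div_assoc]

lemma dslope_diff {f : ℂ → ℂ} {R : ℝ} (hR : 0 < R) (hf : DifferentiableOn ℂ f (ball 0 R)) :
    DifferentiableOn ℂ (dslope f 0) (ball 0 R) :=
  (Complex.differentiableOn_dslope (ball_mem_nhds 0 hR)).mpr hf

lemma eq_dslope (f : ℂ → ℂ) (z : ℂ) : f z = f 0 + z * dslope f 0 z := by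
  have := sub_smul_dslope f 0 z
  simp at this
  rw [this]; ring

lemma co_dslope {f : ℂ → ℂ} {R : ℝ} (hR : 0 < R) (hf : DifferentiableOn ℂ f (ball 0 R)) (k : ℕ) :
    co (dslope f 0) k = co f (k+1) := by
  have ha := anAt hR (dslope_diff hR hf)
  have e : f = fun z => f 0 + z * dslope f 0 z := funext (eq_dslope f)
  conv_rhs => rw [e]
  rw [co_add analyticAt_const (g := fun z => z * dslope f 0 z) (analyticAt_id.mul ha), co_const, if_neg (by omega), zero_add]
  exact (co_zmul_succ ha k).symm

/-- Taylor expansion with holomorphic remainder -/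
lemma taylor_rem {f : ℂ → ℂ} {R : ℝ} (hR : 0 < R) (hf : DifferentiableOn ℂ f (ball 0 R)) (N : ℕ) :
    ∃ h : ℂ → ℂ, DifferentiableOn ℂ h (ball 0 R) ∧ ∀ z, f z = ∑ j ∈ Finset.range N, co f j * z^j + z^N * h z := by
  induction N generalizing f with
  | zero => exact ⟨f, hf, by simp⟩
  | succ N ih =>
    obtain ⟨h, hd, he⟩ := ih (dslope_diff hR hf)
    refine ⟨h, hd, fun z => ?_⟩
    rw [eq_dslope f z, he z, Finset.sum_range_succ', co_zero, mul_add, Finset.mul_sum]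
    simp only [co_dslope hR hf, pow_zero, mul_one]
    have : ∑ i ∈ Finset.range N, z * (co f (i+1) * z^i) = ∑ k ∈ Finset.range N, co f (k+1) * z^(k+1) :=
      Finset.sum_congr rfl (fun i _ => by ring)
    rw [this]; ring

lemma co_pow_zero_of_lt {w : ℂ → ℂ} {R : ℝ} (hR : 0 < R) (hw : DifferentiableOn ℂ w (ball 0 R)) (hw0 : w 0 = 0)
    {g : ℂ → ℂ} (hg : AnalyticAt ℂ g 0) (N k : ℕ) (hk : k < N) : co (fun z => w z^N * g z) k = 0 := by
  have e : (fun z => w z^N * g z) = fun z => z^N * ((dslope w 0 z)^N * g z) := by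
    ext z; rw [eq_dslope w z, hw0]; ring
  rw [e, co_zpow_mul (((anAt hR (dslope_diff hR hw)).fun_pow N).fun_mul hg), if_pos hk]

lemma co_comp {f w : ℂ → ℂ} {R S : ℝ} (hR : 0 < R) (hS : 0 < S) (hf : DifferentiableOn ℂ f (ball 0 S))
    (hw : DifferentiableOn ℂ w (ball 0 R)) (hw0 : w 0 = 0) (hm : MapsTo w (ball 0 R) (ball 0 S)) (k N : ℕ) (hN : k < N) :
    co (fun z => f (w z)) k = ∑ j ∈ Finset.range N, co f j * co (fun z => w z^j) k := by
  obtain ⟨h, hd, he⟩ := taylor_rem hS hf N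
  have e : (fun z => f (w z)) = fun z => ∑ j ∈ Finset.range N, co f j * w z^j + w z^N * h (w z) := by
    ext z; rw [he (w z)]
  have hwa := anAt hR hw
  have hha : AnalyticAt ℂ (fun z => h (w z)) 0 := anAt hR (hd.comp hw hm)
  rw [e, co_add _ ((hwa.fun_pow N).fun_mul hha), co_pow_zero_of_lt hR hw hw0 hha N k hN, add_zero, co_sum]
  · simp only [co_const_mul]
  · intro i _; exact analyticAt_const.mul (hwa.pow i)
  · exact Finset.analyticAt_fun_sum _ (fun i _ => analyticAt_const.mul (hwa.pow i))

end DB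


namespace DB
open scoped Topology

lemma herglotz_r {P : ℂ → ℂ} (hP : DifferentiableOn ℂ P (ball 0 1)) (hre : ∀ z ∈ ball (0:ℂ) 1, 0 ≤ (P z).re)
    (h0 : (P 0).im = 0) (n : ℕ) (l : ℕ → ℂ)
    (hl : ∀ κ : ℂ, ‖κ‖ = 1 → 0 ≤ (l 0 + ∑ m ∈ Finset.Icc 1 n, 2 * l m * κ^m).re) (r : ℝ) (hr : r ∈ Ioo (0:ℝ) 1) :
    0 ≤ (l 0 * P 0 + ∑ m ∈ Finset.Icc 1 n, l m * (co P m * r^m)).re := by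
  set k : ℝ → ℂ := fun θ => l 0 + ∑ m ∈ Finset.Icc 1 n, 2 * l m * Complex.exp (-(m * θ * Complex.I)) with hk
  set p : ℝ → ℂ := fun θ => P (circleMap 0 r θ) with hp
  have hmem : ∀ θ, circleMap 0 r θ ∈ ball (0:ℂ) 1 := by
    intro θ; simp [abs_of_pos hr.1, hr.2]
  have hpc : Continuous p := by
    have := hP.continuousOn.comp_continuous (continuous_circleMap 0 r) hmem
    exact this
  have hkc : Continuous k := by
    rw [hk]; fun_prop
  have hexp : ∀ m : ℕ, Continuous (fun θ : ℝ => Complex.exp (-(m * θ * Complex.I))) := by intro m; fun_prop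
  have hexp' : ∀ m : ℕ, Continuous (fun θ : ℝ => Complex.exp (m * θ * Complex.I)) := by intro m; fun_prop
  have hpi : (Real.pi : ℂ) ≠ 0 := by exact_mod_cast Real.pi_ne_zero
  have c0 : ∫ θ in (0:ℝ)..(2 * Real.pi), p θ = 2 * Real.pi * P 0 := by
    have := co_circle hP hr.1 hr.2 0
    rw [co_zero] at this
    simp only [pow_zero, mul_one, Nat.cast_zero, zero_mul, neg_zero, Complex.exp_zero] at this
    rw [this]; field_simp; rfl
  have cm : ∀ m : ℕ, ∫ θ in (0:ℝ)..(2 * Real.pi), p θ * Complex.exp (-(m * θ * Complex.I)) = 2 * Real.pi * (co P m * r^m) := by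
    intro m
    rw [co_circle hP hr.1 hr.2 m, ← mul_assoc, mul_inv_cancel₀ (by simp [hpi]), one_mul]
  have I1 : ∫ θ in (0:ℝ)..(2 * Real.pi), p θ * k θ = 2 * Real.pi * (l 0 * P 0 + ∑ m ∈ Finset.Icc 1 n, 2 * l m * (co P m * r^m)) := by
    have e : ∀ θ, p θ * k θ = l 0 * p θ + ∑ m ∈ Finset.Icc 1 n, 2 * l m * (p θ * Complex.exp (-(m * θ * Complex.I))) := by
      intro θ; simp only [hk]; rw [mul_add, Finset.mul_sum]; congr 1
      · ring
      · apply Finset.sum_congr rfl; intro m _; ring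
    simp only [e]
    rw [intervalIntegral.integral_add, intervalIntegral.integral_finsetSum, intervalIntegral.integral_const_mul, c0]
    · simp only [intervalIntegral.integral_const_mul, cm]
      rw [mul_add, Finset.mul_sum]; congr 1
      · ring
      · apply Finset.sum_congr rfl; intro m _; ring
    · intro m _
      exact (continuous_const.mul (hpc.mul (hexp m))).intervalIntegrable _ _
    · exact (continuous_const.mul hpc).intervalIntegrable _ _
    · exact (continuous_finsetSum _ (fun m _ => continuous_const.mul (hpc.mul (hexp m)))).intervalIntegrable _ _
  have I2 : ∫ θ in (0:ℝ)..(2 * Real.pi), p θ * starRingEnd ℂ (k θ) = 2 * Real.pi * (starRingEnd ℂ (l 0) * P 0) := by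
    have e : ∀ θ, p θ * starRingEnd ℂ (k θ) = starRingEnd ℂ (l 0) * p θ + ∑ m ∈ Finset.Icc 1 n, 2 * starRingEnd ℂ (l m) * (p θ * Complex.exp (m * θ * Complex.I)) := by
      intro θ; simp only [hk]; rw [map_add, map_sum, mul_add, Finset.mul_sum]; congr 1
      · ring
      · apply Finset.sum_congr rfl; intro m _
        rw [map_mul, map_mul, ← Complex.exp_conj]
        have h2 : (starRingEnd ℂ) 2 = 2 := Complex.conj_ofNat 2
        rw [h2]
        simp
        ring
    simp only [e]
    rw [intervalIntegral.integral_add, intervalIntegral.integral_finsetSum, intervalIntegral.integral_const_mul, c0]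
    · simp only [intervalIntegral.integral_const_mul]
      rw [Finset.sum_eq_zero]
      · ring
      · intro m hm
        rw [circle_pos_zero hP hr.1 hr.2 m (by simp at hm; omega)]; simp
    · intro m _
      exact (continuous_const.mul (hpc.mul (hexp' m))).intervalIntegrable _ _
    · exact (continuous_const.mul hpc).intervalIntegrable _ _
    · exact (continuous_finsetSum _ (fun m _ => continuous_const.mul (hpc.mul (hexp' m)))).intervalIntegrable _ _
  have hkc' : Continuous (fun θ => starRingEnd ℂ (k θ)) := Complex.continuous_conj.comp hkc
  have I3 : ∫ θ in (0:ℝ)..(2 * Real.pi), (p θ * k θ + p θ * starRingEnd ℂ (k θ)) =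
      2 * Real.pi * (l 0 * P 0 + ∑ m ∈ Finset.Icc 1 n, 2 * l m * (co P m * r^m)) + 2 * Real.pi * (starRingEnd ℂ (l 0) * P 0) := by
    rw [intervalIntegral.integral_add (f := fun θ => p θ * k θ) (g := fun θ => p θ * starRingEnd ℂ (k θ)) ((hpc.mul hkc).intervalIntegrable _ _) ((hpc.mul hkc').intervalIntegrable _ _), I1, I2]
  have I4 := Complex.reCLM.intervalIntegral_comp_comm (a := 0) (b := 2 * Real.pi) (μ := MeasureTheory.volume) (f := fun θ => (p θ * k θ + p θ * starRingEnd ℂ (k θ))) (((hpc.mul hkc).add (hpc.mul hkc')).intervalIntegrable _ _)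
  rw [I3] at I4
  have hnn : 0 ≤ ∫ θ in (0:ℝ)..(2 * Real.pi), Complex.reCLM (p θ * k θ + p θ * starRingEnd ℂ (k θ)) := by
    apply intervalIntegral.integral_nonneg (by positivity)
    intro θ _
    have hkre : 0 ≤ (k θ).re := by
      have := hl (Complex.exp (-(θ * Complex.I))) (by rw [Complex.norm_exp]; simp)
      simp only [hk]
      convert this using 6 with m hm
      rw [← Complex.exp_nat_mul]; congr 1; ring
    have hpre : 0 ≤ (p θ).re := hre _ (hmem θ)
    have : Complex.reCLM (p θ * k θ + p θ * starRingEnd ℂ (k θ)) = 2 * ((p θ).re * (k θ).re) := by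
      simp; ring
    rw [this]; positivity
  rw [I4] at hnn
  have hfin : Complex.reCLM (2 * Real.pi * (l 0 * P 0 + ∑ m ∈ Finset.Icc 1 n, 2 * l m * (co P m * r^m)) + 2 * Real.pi * (starRingEnd ℂ (l 0) * P 0)) = (4 * Real.pi) * (l 0 * P 0 + ∑ m ∈ Finset.Icc 1 n, l m * (co P m * r^m)).re := by
    have e : ∑ m ∈ Finset.Icc 1 n, 2 * l m * (co P m * r^m) = 2 * ∑ m ∈ Finset.Icc 1 n, l m * (co P m * r^m) := by
      rw [Finset.mul_sum]; apply Finset.sum_congr rfl; intro m _; ring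
    rw [e]
    simp [h0]
    ring
  rw [hfin] at hnn
  exact nonneg_of_mul_nonneg_right hnn (by positivity)

lemma herglotz {P : ℂ → ℂ} (hP : DifferentiableOn ℂ P (ball 0 1)) (hre : ∀ z ∈ ball (0:ℂ) 1, 0 ≤ (P z).re)
    (h0 : (P 0).im = 0) (n : ℕ) (l : ℕ → ℂ)
    (hl : ∀ κ : ℂ, ‖κ‖ = 1 → 0 ≤ (l 0 + ∑ m ∈ Finset.Icc 1 n, 2 * l m * κ^m).re) :
    0 ≤ (l 0 * P 0 + ∑ m ∈ Finset.Icc 1 n, l m * co P m).re := by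
  have hc : ContinuousWithinAt (fun r : ℝ => (l 0 * P 0 + ∑ m ∈ Finset.Icc 1 n, l m * (co P m * (r:ℂ)^m)).re) (Iio 1) 1 := by
    have : Continuous (fun r : ℝ => (l 0 * P 0 + ∑ m ∈ Finset.Icc 1 n, l m * (co P m * (r:ℂ)^m)).re) := by fun_prop
    exact this.continuousWithinAt
  have : 0 ≤ (l 0 * P 0 + ∑ m ∈ Finset.Icc 1 n, l m * (co P m * ((1:ℝ):ℂ)^m)).re := by
    refine ge_of_tendsto hc ?_
    filter_upwards [Ioo_mem_nhdsLT (show (0:ℝ) < 1 by norm_num)] with r hr using herglotz_r hP hre h0 n l hl r hr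
  simpa using this

lemma carath {P : ℂ → ℂ} (hP : DifferentiableOn ℂ P (ball 0 1)) (hre : ∀ z ∈ ball (0:ℂ) 1, 0 ≤ (P z).re)
    (h0 : (P 0).im = 0) (k : ℕ) (hk : 1 ≤ k) : ‖co P k‖ ≤ 2 * (P 0).re := by
  by_cases hz : co P k = 0
  · rw [hz]; simpa using hre 0 (by simp)
  set u : ℂ := -(starRingEnd ℂ (co P k)) / (2 * ‖co P k‖) with hu
  have hn : (‖co P k‖ : ℂ) ≠ 0 := by simpa using hz
  have hun : ‖u‖ = 1/2 := by
    rw [hu]; simp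
    have : ‖co P k‖ ≠ 0 := by simpa using hz
    field_simp
  have := herglotz hP hre h0 k (fun m => if m = 0 then 1 else if m = k then u else 0) (by
    intro κ hκ
    rw [Finset.sum_eq_single k]
    · rw [if_pos rfl, if_neg (by omega), if_pos rfl]
      have h1 : ‖2 * u * κ^k‖ ≤ 1 := by
        rw [norm_mul, norm_mul, norm_pow, hκ, hun]; norm_num
      have h2 := (Complex.abs_re_le_norm (2 * u * κ^k)).trans h1
      rw [Complex.add_re, Complex.one_re]
      linarith [(abs_le.mp h2).1]
    · intro b hb hbk; simp at hb; rw [if_neg (by omega), if_neg hbk]; simp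
    · intro h; exfalso; apply h; simp; omega)
  rw [Finset.sum_eq_single k] at this
  · rw [if_pos rfl, if_neg (by omega), if_pos rfl] at this
    have e : u * co P k = ((-‖co P k‖/2 : ℝ) : ℂ) := by
      have h1 : starRingEnd ℂ (co P k) * co P k = (‖co P k‖:ℂ)^2 := by
        rw [← Complex.normSq_eq_conj_mul_self, Complex.normSq_eq_norm_sq]; push_cast; rfl
      rw [hu]; push_cast; field_simp; linear_combination (-1) * h1
    rw [e, Complex.add_re, Complex.ofReal_re, one_mul] at this
    linarith
  · intro b hb hbk; simp at hb; rw [if_neg (by omega), if_neg hbk]; simp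
  · intro h; exfalso; apply h; simp; omega

/-- positivity of the first variation -/
lemma first_variation (n : ℕ) (τ l : ℕ → ℝ) (hl : ∀ k, 0 ≤ l k) (hln : l (n+1) = 0) (hτn : τ (n+1) = 0)
    (hτ : ∀ k, τ k - τ (k+1) = l k + l (k+1)) (c : ℕ → ℂ)
    {P : ℂ → ℂ} (hP : DifferentiableOn ℂ P (ball 0 1)) (hre : ∀ z ∈ ball (0:ℂ) 1, 0 ≤ (P z).re)
    (ε : ℝ) (h0 : P 0 = ε) :
    0 ≤ ∑ k ∈ Finset.Icc 1 n, (-(k * l k) * (k * ‖c k‖^2 - 4 / k) * ε +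
      2 * k * τ k * ((starRingEnd ℂ (c k)) * (co P k + ∑ j ∈ Finset.Icc 1 k, j * c j * co P (k - j))).re) := by
  set Λ : (ℕ → ℂ) →ₗ[ℂ] ℂ := ∑ k ∈ Finset.Icc 1 n, ((((-(k * l k) * (k * ‖c k‖^2 - 4 / k) : ℝ)) : ℂ) • LinearMap.proj 0 +
     (((2 * k * τ k : ℝ) : ℂ) * starRingEnd ℂ (c k)) • (LinearMap.proj k + ∑ j ∈ Finset.Icc 1 k, ((j:ℂ) * c j) • LinearMap.proj (k - j))) with hΛ
  have hΛa : ∀ p : ℕ → ℂ, Λ p = ∑ k ∈ Finset.Icc 1 n, ((((-(k * l k) * (k * ‖c k‖^2 - 4 / k) : ℝ)) : ℂ) * p 0 +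
     (((2 * k * τ k : ℝ) : ℂ) * starRingEnd ℂ (c k)) * (p k + ∑ j ∈ Finset.Icc 1 k, ((j:ℂ) * c j) * p (k - j))) := by
    intro p
    rw [hΛ]
    simp only [LinearMap.sum_apply, LinearMap.add_apply, LinearMap.smul_apply, LinearMap.proj_apply, smul_eq_mul]
  have hre' : ∀ p : ℕ → ℂ, ∀ e : ℝ, p 0 = e → (Λ p).re = ∑ k ∈ Finset.Icc 1 n, (-(k * l k) * (k * ‖c k‖^2 - 4 / k) * e +
      2 * k * τ k * ((starRingEnd ℂ (c k)) * (p k + ∑ j ∈ Finset.Icc 1 k, j * c j * p (k - j))).re) := by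
    intro p e he
    rw [hΛa, Complex.re_sum]
    apply Finset.sum_congr rfl
    intro k _
    rw [Complex.add_re, he, ← Complex.ofReal_mul, Complex.ofReal_re, mul_assoc (((2 * k * τ k : ℝ) : ℂ)), Complex.re_ofReal_mul]
  have hdep : ∀ p q : ℕ → ℂ, (∀ m ≤ n, p m = q m) → Λ p = Λ q := by
    intro p q h
    rw [hΛa, hΛa]
    apply Finset.sum_congr rfl
    intro k hk
    simp at hk
    rw [h 0 (by omega), h k (by omega)]
    congr 3
    apply Finset.sum_congr rfl
    intro j _
    rw [h (k - j) (by omega)]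
  have hexp : ∀ p : ℕ → ℂ, Λ p = Λ (Pi.single 0 1) * p 0 + ∑ m ∈ Finset.Icc 1 n, Λ (Pi.single m 1) * p m := by
    intro p
    have e : Λ p = Λ (∑ m ∈ Finset.range (n+1), p m • (Pi.single m (1:ℂ) : ℕ → ℂ)) := by
      apply hdep
      intro m hm
      rw [Finset.sum_apply, Finset.sum_eq_single m]
      · simp
      · intro b _ hb; simp [Pi.single_apply, Ne.symm hb]
      · intro h; exfalso; apply h; simp; omega
    rw [e, map_sum, Finset.sum_range_eq_add_Ico _ (by omega)]
    simp only [map_smul, smul_eq_mul]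
    rw [mul_comm]
    congr 1
    apply Finset.sum_congr rfl
    intro m _; ring
  have H := herglotz hP hre (by rw [h0]; simp) n (fun m => Λ (Pi.single m 1)) (by
    intro κ hκ
    set p : ℕ → ℂ := fun m => if m = 0 then 1 else 2 * κ^m with hp
    have h1 := key_identity n τ l hl hln hτn hτ c κ hκ p (by simp [hp]) (by intro m hm; simp [hp]; omega)
    have h2 := hre' p 1 (by simp [hp])
    simp only [mul_one] at h2
    rw [← h2, hexp p] at h1
    convert h1 using 3
    · simp [hp]
    · apply Finset.sum_congr rfl
      intro m hm
      simp at hm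
      simp only [hp]
      rw [if_neg (by omega)]; ring)
  have h3 := hexp (co P)
  rw [co_zero] at h3
  rw [← h3, hre' (co P) ε (by rw [co_zero, h0])] at H
  exact H

end DB


namespace DB
open scoped Topology

lemma P_half {P : ℂ → ℂ} (hP : DifferentiableOn ℂ P (ball 0 1)) (hre : ∀ z ∈ ball (0:ℂ) 1, 0 ≤ (P z).re)
    (ε : ℝ) (h0 : P 0 = ε) (z : ℂ) (hz : z ∈ ball (0:ℂ) (1/2)) : ‖P z‖ ≤ 4 * ε := by
  have hε : 0 ≤ ε := by have := hre 0 (by simp); rw [h0] at this; simpa using this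
  have hb : ∀ k, ‖co P k‖ ≤ 2 * ε := by
    intro k
    rcases Nat.eq_zero_or_pos k with rfl | hk
    · rw [co_zero, h0]; simp [abs_of_nonneg hε]; linarith
    · have := carath hP hre (by rw [h0]; simp) k hk
      rw [h0] at this; simpa using this
  have hz' : ‖z‖ ≤ 1/2 := by simp at hz; simpa using hz.le
  have hs := co_hasSum hP (z := z) (by simp; linarith)
  have hg : HasSum (fun k : ℕ => 2 * ε * (1/2:ℝ)^k) (2 * ε * 2) := hasSum_geometric_two.mul_left _
  rw [← hs.tsum_eq]
  refine (tsum_of_norm_bounded hg ?_).trans (by linarith)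
  intro k
  rw [norm_mul, norm_pow]
  gcongr
  exact hb k

lemma rho_bound {P : ℂ → ℂ} (hP : DifferentiableOn ℂ P (ball 0 1)) (hre : ∀ z ∈ ball (0:ℂ) 1, 0 ≤ (P z).re)
    (ε : ℝ) (h0 : P 0 = ε) (T : ℝ) (hT : ε ≤ T) (n j m : ℕ) (hj : j ≤ n) (hm : m ≤ n) :
    ‖co (fun z => Complex.exp (-(j * P z))) m - (if m = 0 then 1 else 0) + j * co P m‖ ≤
      (4 * n)^2 * Real.exp (4 * n * T) * 2^n * ε^2 := by
  have hε : 0 ≤ ε := by have := hre 0 (by simp); rw [h0] at this; simpa using this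
  have hP' : DifferentiableOn ℂ P (ball 0 (1/2)) := hP.mono (ball_subset_ball (by norm_num))
  have a1 : AnalyticAt ℂ P 0 := anAt one_pos hP
  have a2 : AnalyticAt ℂ (fun z => Complex.exp (-(j * P z))) 0 :=
    anAt one_pos (R := 1) (by fun_prop)
  have e : co (fun z => (Complex.exp (-(j * P z)) - 1) + j * P z) m = co (fun z => Complex.exp (-(j * P z))) m - (if m = 0 then 1 else 0) + j * co P m := by
    rw [co_add (f := fun z => Complex.exp (-(j * P z)) - 1) (g := fun z => j * P z), co_sub a2 analyticAt_const, co_const, co_const_mul]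
    · exact a2.fun_sub analyticAt_const
    · exact analyticAt_const.fun_mul a1
  rw [← e]
  have hb := co_bound (f := fun z => (Complex.exp (-(j * P z)) - 1) + j * P z) (R := 1/2) (C := (4 * n * ε)^2 * Real.exp (4 * n * T)) (by norm_num) (by fun_prop) (by
    intro z hz
    have h1 := P_half hP hre ε h0 z hz
    set x := -(j * P z) with hx
    have hxn : ‖x‖ ≤ 4 * n * ε := by
      rw [hx, norm_neg, norm_mul]
      simp only [Complex.norm_natCast]
      have : (j:ℝ) ≤ n := by exact_mod_cast hj
      calc (j:ℝ) * ‖P z‖ ≤ n * (4 * ε) := by gcongr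
        _ = _ := by ring
    have h2 := Complex.norm_exp_sub_sum_le_norm_mul_exp x 2
    simp [Finset.sum_range_succ] at h2
    have e2 : Complex.exp x - 1 + j * P z = Complex.exp x - (1 + x) := by rw [hx]; ring
    rw [e2]
    refine h2.trans ?_
    gcongr
    refine hxn.trans ?_
    gcongr) m
  refine hb.trans ?_
  have h3 : (4 * n * ε)^2 * Real.exp (4 * n * T) / (1/2)^m = (4 * n)^2 * Real.exp (4 * n * T) * 2^m * ε^2 := by
    rw [one_div, inv_pow]; field_simp
  rw [h3]
  have : (2:ℝ)^m ≤ 2^n := pow_le_pow_right₀ (by norm_num) hm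
  gcongr

lemma coeff_step (n : ℕ) (T : ℝ) (hT0 : 0 ≤ T) : ∃ M : ℝ, 0 ≤ M ∧ ∀ (A B P : ℂ → ℂ) (ε : ℝ),
    DifferentiableOn ℂ P (ball 0 1) → (∀ z ∈ ball (0:ℂ) 1, 0 ≤ (P z).re) → P 0 = ε → ε ≤ T →
    DifferentiableOn ℂ B (ball 0 1) → (∀ k, 1 ≤ k → ‖co B k‖ ≤ 2 * T) →
    (∀ z ∈ ball (0:ℂ) 1, A z = - P z + B (z * Complex.exp (- P z))) →
    ∀ k, 1 ≤ k → k ≤ n → ∃ E : ℂ, co A k = co B k - (co P k + ∑ j ∈ Finset.Icc 1 k, j * co B j * co P (k - j)) + E ∧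
      ‖E‖ ≤ M * ε^2 ∧ ‖co P k + ∑ j ∈ Finset.Icc 1 k, j * co B j * co P (k - j)‖ ≤ M * ε := by
  obtain ⟨K, hK⟩ : ∃ K, K = (4 * n)^2 * Real.exp (4 * n * T) * 2^n := ⟨_, rfl⟩
  have hK0 : 0 ≤ K := by rw [hK]; positivity
  refine ⟨n * (2 * T * K) + 2 + n * (n * (2 * T) * 2), by positivity, ?_⟩
  intro A B P ε hP hre h0 hεT hB hcB hA k hk hkn
  have hε : 0 ≤ ε := by have := hre 0 (by simp); rw [h0] at this; simpa using this
  have hkn' : (k:ℝ) ≤ n := by exact_mod_cast hkn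
  have hpb : ∀ k, ‖co P k‖ ≤ 2 * ε := by
    intro k
    rcases Nat.eq_zero_or_pos k with rfl | hk
    · rw [co_zero, h0]; simp [abs_of_nonneg hε]; linarith
    · have := carath hP hre (by rw [h0]; simp) k hk
      rw [h0] at this; simpa using this
  set ρ : ℕ → ℂ := fun j => co (fun z => Complex.exp (-(j * P z))) (k-j) - (if k - j = 0 then 1 else 0) + j * co P (k-j) with hρ
  have hρb : ∀ j ≤ k, ‖ρ j‖ ≤ K * ε^2 := fun j hj => hK ▸ rho_bound hP hre ε h0 T hεT n j (k-j) (by omega) (by omega)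
  refine ⟨∑ j ∈ Finset.Icc 1 k, co B j * ρ j, ?_, ?_, ?_⟩
  · have a1 : AnalyticAt ℂ P 0 := anAt one_pos hP
    have hw : DifferentiableOn ℂ (fun z => z * Complex.exp (- P z)) (ball 0 1) := by fun_prop
    have hm : MapsTo (fun z => z * Complex.exp (- P z)) (ball 0 1) (ball (0:ℂ) 1) := by
      intro z hz
      have := hre z hz
      simp only [mem_ball_zero_iff] at hz ⊢
      rw [norm_mul, Complex.norm_exp]
      have : Real.exp ((-P z).re) ≤ 1 := by rw [Real.exp_le_one_iff]; simp; exact this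
      nlinarith [norm_nonneg z]
    have e1 : co A k = - co P k + co (fun z => B (z * Complex.exp (- P z))) k := by
      rw [← co_neg, ← co_add (g := fun z => B (z * Complex.exp (- P z))) a1.fun_neg (anAt one_pos (hB.comp hw hm))]
      apply co_congr
      filter_upwards [ball_mem_nhds (0:ℂ) one_pos] with z hz using hA z hz
    have e2 : ∀ j, co (fun z => (z * Complex.exp (- P z))^j) k = if k < j then 0 else co (fun z => Complex.exp (-(j * P z))) (k-j) := by
      intro j
      rw [← co_zpow_mul (anAt one_pos (R := 1) (by fun_prop))]
      congr 1; ext z; rw [mul_pow, ← Complex.exp_nat_mul]; congr 2; ring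
    rw [e1, co_comp one_pos one_pos hB hw (by simp) hm k (k+1) (by omega), Finset.sum_range_eq_add_Ico _ (by omega)]
    simp only [e2]
    have e3 : co (fun z => Complex.exp (-(((0:ℕ):ℂ) * P z))) (k-0) = 0 := by
      have : (fun z => Complex.exp (-(((0:ℕ):ℂ) * P z))) = fun _ => 1 := by ext z; simp
      rw [this, co_const, if_neg (by omega)]
    rw [if_neg (by omega), e3, mul_zero, zero_add]
    have e4 : co B k = ∑ j ∈ Finset.Icc 1 k, co B j * (if k - j = 0 then 1 else 0) := by
      rw [Finset.sum_eq_single k]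
      · simp
      · intro b hb hbk; simp at hb; rw [if_neg (by omega)]; simp
      · intro h; exfalso; apply h; simp; omega
    have e5 : ∑ j ∈ Finset.Ico 1 (k+1), co B j * (if k < j then 0 else co (fun z => Complex.exp (-(j * P z))) (k-j)) =
        ∑ j ∈ Finset.Icc 1 k, co B j * (if k - j = 0 then 1 else 0) - ∑ j ∈ Finset.Icc 1 k, j * co B j * co P (k - j) + ∑ j ∈ Finset.Icc 1 k, co B j * ρ j := by
      rw [← Finset.sum_sub_distrib, ← Finset.sum_add_distrib]
      apply Finset.sum_congr rfl
      intro j hj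
      simp at hj
      rw [if_neg (by omega)]
      simp only [hρ]; ring
    rw [e5, ← e4]; ring
  · refine (norm_sum_le _ _).trans ?_
    have : ∀ j ∈ Finset.Icc 1 k, ‖co B j * ρ j‖ ≤ 2 * T * (K * ε^2) := by
      intro j hj
      simp at hj
      rw [norm_mul]
      exact mul_le_mul (hcB j hj.1) (hρb j hj.2) (norm_nonneg _) (by positivity)
    refine (Finset.sum_le_sum this).trans ?_
    simp only [Finset.sum_const, Nat.card_Icc, nsmul_eq_mul, Nat.add_sub_cancel]
    have h1 : (k:ℝ) * (2 * T * (K * ε^2)) ≤ n * (2 * T * (K * ε^2)) := by gcongr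
    have h2 : 0 ≤ (2 + n * (n * (2 * T) * 2)) * ε^2 := by positivity
    nlinarith
  · refine (norm_add_le _ _).trans ?_
    have : ∀ j ∈ Finset.Icc 1 k, ‖j * co B j * co P (k-j)‖ ≤ n * (2 * T) * (2 * ε) := by
      intro j hj
      simp at hj
      rw [norm_mul, norm_mul, Complex.norm_natCast]
      have hjn : (j:ℝ) ≤ n := by exact_mod_cast hj.2.trans hkn
      exact mul_le_mul (mul_le_mul hjn (hcB j hj.1) (norm_nonneg _) (by positivity)) (hpb _) (norm_nonneg _) (by positivity)
    have h0 := (norm_sum_le (Finset.Icc 1 k) (fun j => (j:ℂ) * co B j * co P (k-j))).trans (Finset.sum_le_sum this)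
    simp only [Finset.sum_const, Nat.card_Icc, nsmul_eq_mul, Nat.add_sub_cancel] at h0
    have h1 : (k:ℝ) * (n * (2 * T) * (2 * ε)) ≤ n * (n * (2 * T) * (2 * ε)) := by gcongr
    have h2 : 0 ≤ (n * (2 * T * K)) * ε := by positivity
    have := hpb k
    nlinarith

lemma norm_step {M ε : ℝ} {c D E : ℂ} (hε0 : 0 ≤ ε) (hε : ε ≤ M) (hc : ‖c‖ ≤ M) (hD : ‖D‖ ≤ M * ε) (hE : ‖E‖ ≤ M * ε^2) :
    ‖c - D + E‖^2 ≤ ‖c‖^2 - 2 * (starRingEnd ℂ c * D).re + (2 * M^2 + (M + M^2)^2) * ε^2 := by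
  have hM : 0 ≤ M := hε0.trans hε
  have e : ‖c - D + E‖^2 = ‖c‖^2 - 2 * (starRingEnd ℂ c * D).re + 2 * (starRingEnd ℂ c * E).re + ‖E - D‖^2 := by
    simp only [← Complex.normSq_eq_norm_sq, Complex.normSq_apply]
    simp
    ring
  have h1 : (starRingEnd ℂ c * E).re ≤ M * (M * ε^2) := by
    refine (Complex.re_le_norm _).trans ?_
    rw [norm_mul, RCLike.norm_conj]
    exact mul_le_mul hc hE (norm_nonneg _) hM
  have h2 : ‖E - D‖ ≤ (M + M^2) * ε := by
    have := norm_sub_le E D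
    have : M * ε^2 ≤ M * (M * ε) := by rw [pow_two]; gcongr
    nlinarith
  have h3 : ‖E - D‖^2 ≤ ((M + M^2) * ε)^2 := by gcongr
  rw [e]; nlinarith

lemma step_real {M k la τs τt ε X Y a e : ℝ} (hk : 0 < k) (hkM : k ≤ M) (hla0 : 0 ≤ la) (hla : la ≤ M) (hτs0 : 0 ≤ τs) (hτs : τs ≤ M)
    (he : τs = τt + ε * (k * la) + e) (heM : |e| ≤ M * ε^2) (hX : |X| ≤ M) (hY : |Y| ≤ M * ε) (hε0 : 0 ≤ ε) (hε : ε ≤ M)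
    (ha : a ≤ X - Y + M * ε^2) :
    τs * a ≤ τt * X - (-(k * la) * X * ε + τt * Y) + (M^3 + M * (M + M^2) + M^2) * ε^2 := by
  have hM : 0 ≤ M := hε0.trans hε
  have h1 : τs * a ≤ τs * (X - Y) + τs * (M * ε^2) := by rw [← mul_add]; gcongr
  have h2 : τs * (M * ε^2) ≤ M * (M * ε^2) := by gcongr
  have h3 : τs * (X - Y) = τt * X - (-(k * la) * X * ε + τt * Y) + (-(ε * (k * la) * Y) + e * (X - Y)) := by rw [he]; ring
  have h4 : |ε * (k * la) * Y| ≤ ε * (M * M) * (M * ε) := by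
    rw [abs_mul, abs_of_nonneg (by positivity)]; gcongr
  have h5 : |e * (X - Y)| ≤ (M * ε^2) * (M + M * M) := by
    rw [abs_mul]
    have : |X - Y| ≤ M + M * M := by
      refine (abs_sub _ _).trans ?_
      have : M * ε ≤ M * M := by gcongr
      linarith
    gcongr
  have h6 := (abs_le.mp h4).1
  have h7 := (abs_le.mp h5).2
  nlinarith

def Phi (n : ℕ) (t : ℝ) (A : ℂ → ℂ) : ℝ := ∑ k ∈ Finset.Icc 1 n, tau n k t * (k * ‖co A k‖^2 - 4 / k)

lemma bdd_aux (n : ℕ) (T : ℝ) (F : ℕ → ℝ → ℝ) (hF : ∀ k, Continuous (F k)) : ∃ M, 0 ≤ M ∧ ∀ k ≤ n, ∀ t ∈ Icc 0 T, |F k t| ≤ M := by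
  have : ∀ k, ∃ M, ∀ t ∈ Icc 0 T, |F k t| ≤ M := by
    intro k
    obtain ⟨M, hM⟩ := (isCompact_Icc (a := 0) (b := T)).exists_bound_of_continuousOn (hF k).continuousOn
    exact ⟨M, hM⟩
  choose M hM using this
  refine ⟨∑ k ∈ Finset.range (n+1), |M k|, by positivity, ?_⟩
  intro k hk t ht
  refine (hM k t ht).trans ((le_abs_self _).trans ?_)
  exact Finset.single_le_sum (f := fun k => |M k|) (fun _ _ => abs_nonneg _) (by simp; omega)

set_option maxHeartbeats 1000000 in
lemma Phi_step (n : ℕ) (T : ℝ) (hT0 : 0 ≤ T) : ∃ C : ℝ, 0 ≤ C ∧ ∀ (A B P : ℂ → ℂ) (s t : ℝ), 0 ≤ s → s ≤ t → t ≤ T →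
    DifferentiableOn ℂ P (ball 0 1) → (∀ z ∈ ball (0:ℂ) 1, 0 ≤ (P z).re) → P 0 = ((t - s : ℝ) : ℂ) →
    DifferentiableOn ℂ B (ball 0 1) → (∀ k, 1 ≤ k → ‖co B k‖ ≤ 2 * T) →
    (∀ z ∈ ball (0:ℂ) 1, A z = - P z + B (z * Complex.exp (- P z))) →
    Phi n s A ≤ Phi n t B + C * (t-s)^2 := by
  obtain ⟨M1, hM1, hstep⟩ := coeff_step n T hT0
  obtain ⟨M2, hM2, hM2'⟩ := bdd_aux n T (fun k t => tau n k t) (fun k => continuous_iff_continuousAt.mpr fun t => (tau_hasDerivAt n k t).continuousAt)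
  obtain ⟨M3, hM3, hM3'⟩ := bdd_aux n T (fun k t => la n k t) (fun k => (la_contDiff n k).continuous)
  obtain ⟨M4, hM4, hM4'⟩ := tau_taylor n T
  obtain ⟨M0, hM0p, hM0M1, hM0T⟩ : ∃ M0, 0 ≤ M0 ∧ M1 ≤ M0 ∧ 2 * T ≤ M0 := ⟨M1 + 2 * T, by positivity, by linarith, by linarith⟩
  have p1 : 0 ≤ n * (2 * M0^2 + (M0 + M0^2)^2) := by positivity
  have p2 : 0 ≤ 2 * n * (M0 * M0) := by positivity
  have p3 : (0:ℝ) ≤ n * (2*T)^2 + 4 := by positivity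
  have p4 : (0:ℝ) ≤ n := by positivity
  obtain ⟨M, hMp, m2, m3, m4, m5, m6, m7, m8, m9⟩ : ∃ M, 0 ≤ M ∧ M2 ≤ M ∧ M3 ≤ M ∧ M4 ≤ M ∧ (n:ℝ) ≤ M ∧ T ≤ M ∧ n * (2*T)^2 + 4 ≤ M ∧
      2 * n * (M0 * M0) ≤ M ∧ n * (2 * M0^2 + (M0 + M0^2)^2) ≤ M := by
    generalize n * (2 * M0^2 + (M0 + M0^2)^2) = q1 at *
    generalize 2 * n * (M0 * M0) = q2 at *
    generalize n * (2*T)^2 + 4 = q3 at *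
    refine ⟨M2 + M3 + M4 + n + T + q3 + q2 + q1, ?_, ?_, ?_, ?_, ?_, ?_, ?_, ?_, ?_⟩ <;> linarith
  refine ⟨n * (M^3 + M * (M + M^2) + M^2), by positivity, ?_⟩
  intro A B P s t hs hst htT hP hre h0 hB hcB hA
  set ε := t - s with hε
  have hε0 : 0 ≤ ε := by linarith
  have hεT : ε ≤ T := by linarith
  have hεM0 : ε ≤ M0 := by linarith
  have hV := first_variation n (fun k => tau n k t) (fun k => la n k t) (fun k => la_nonneg n k t (by linarith)) (la_big n (n+1) (by omega) t) (tau_big n (n+1) (by omega) t) (fun k => tau_sub n k t) (co B) hP hre ε h0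
  unfold Phi
  have key : ∀ k ∈ Finset.Icc 1 n, tau n k s * (k * ‖co A k‖^2 - 4 / k) ≤ tau n k t * (k * ‖co B k‖^2 - 4 / k) -
      (-(k * la n k t) * (k * ‖co B k‖^2 - 4 / k) * ε + 2 * k * tau n k t * ((starRingEnd ℂ (co B k)) * (co P k + ∑ j ∈ Finset.Icc 1 k, j * co B j * co P (k - j))).re) + (M^3 + M * (M + M^2) + M^2) * ε^2 := by
    intro k hk
    simp at hk
    obtain ⟨E, hE, hEb, hDb⟩ := hstep A B P ε hP hre h0 hεT hB hcB hA k hk.1 hk.2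
    obtain ⟨D, hD⟩ : ∃ D, D = co P k + ∑ j ∈ Finset.Icc 1 k, j * co B j * co P (k - j) := ⟨_, rfl⟩
    rw [← hD] at hE hDb ⊢
    have hkn : (k:ℝ) ≤ n := by exact_mod_cast hk.2
    have hk1 : (1:ℝ) ≤ k := by exact_mod_cast hk.1
    have hk0 : (0:ℝ) < k := by linarith
    have hcb0 := hcB k hk.1
    have n1 := norm_step (c := co B k) (D := D) (E := E) hε0 hεM0 (hcb0.trans (by linarith)) (hDb.trans (by gcongr)) (hEb.trans (by gcongr))
    rw [← hE] at n1
    have hy : |(starRingEnd ℂ (co B k) * D).re| ≤ M0 * (M0 * ε) := by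
      refine (Complex.abs_re_le_norm _).trans ?_
      rw [norm_mul, RCLike.norm_conj]
      exact mul_le_mul (hcb0.trans (by linarith)) (hDb.trans (by gcongr)) (norm_nonneg _) hM0p
    have hfin := step_real (M := M) (k := k) (la := la n k t) (τs := tau n k s) (τt := tau n k t) (ε := ε)
      (X := k * ‖co B k‖^2 - 4 / k) (Y := k * (2 * (starRingEnd ℂ (co B k) * D).re)) (a := k * ‖co A k‖^2 - 4 / k)
      (e := tau n k s - tau n k t + (s-t)*(k*la n k t)) hk0 (by linarith) (la_nonneg n k t (by linarith))
      (by have := (abs_le.mp (hM3' k hk.2 t ⟨by linarith, htT⟩)).2; linarith) (tau_nonneg n k s hs)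
      (by have := (abs_le.mp (hM2' k hk.2 s ⟨by linarith, by linarith⟩)).2; linarith)
      (by rw [hε]; ring) (by
        refine (hM4' k hk.2 s ⟨hs, by linarith⟩ t ⟨by linarith, htT⟩).trans ?_
        have : (s-t)^2 = ε^2 := by rw [hε]; ring
        rw [this]; gcongr) (by
        have h1 : (4:ℝ)/k ≤ 4 := by rw [div_le_iff₀ hk0]; linarith
        have h2 : (0:ℝ) ≤ 4/k := by positivity
        have h3 : k * ‖co B k‖^2 ≤ n * (2*T)^2 := by gcongr
        have h4 : 0 ≤ k * ‖co B k‖^2 := by positivity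
        rw [abs_le]; constructor <;> linarith) (by
        rw [abs_mul, abs_mul, abs_of_pos hk0, abs_two]
        have : (k:ℝ) * (2 * |(starRingEnd ℂ (co B k) * D).re|) ≤ n * (2 * (M0 * (M0 * ε))) := by gcongr
        refine this.trans ?_
        have : n * (2 * (M0 * (M0 * ε))) = (2 * n * (M0 * M0)) * ε := by ring
        rw [this]; gcongr) hε0 (by linarith) (by
        have h1 : (k:ℝ) * ‖co A k‖^2 ≤ k * (‖co B k‖^2 - 2 * (starRingEnd ℂ (co B k) * D).re + (2 * M0^2 + (M0 + M0^2)^2) * ε^2) := by gcongr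
        have h2 : (k:ℝ) * ((2 * M0^2 + (M0 + M0^2)^2) * ε^2) ≤ (n * (2 * M0^2 + (M0 + M0^2)^2)) * ε^2 := by
          rw [← mul_assoc]; gcongr
        have h3 : (n * (2 * M0^2 + (M0 + M0^2)^2)) * ε^2 ≤ M * ε^2 := by gcongr
        rw [mul_add, mul_sub] at h1
        linarith)
    refine hfin.trans (le_of_eq ?_)
    ring
  refine (Finset.sum_le_sum key).trans ?_
  rw [Finset.sum_add_distrib, Finset.sum_sub_distrib]
  simp only [Finset.sum_const, Nat.card_Icc, nsmul_eq_mul, Nat.add_sub_cancel]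
  rw [← mul_assoc]
  linarith

theorem milin_of_chain (T : ℝ) (hT : 0 ≤ T) (L : ℝ → ℂ → ℂ) (hL : ∀ t ∈ Icc 0 T, DifferentiableOn ℂ (L t) (ball 0 1))
    (hL0 : ∀ t ∈ Icc 0 T, L t 0 = (t:ℂ)) (hLT : ∀ t ∈ Icc 0 T, ∀ z ∈ ball (0:ℂ) 1, (L t z).re ≤ T)
    (hsub : ∀ s t, 0 ≤ s → s ≤ t → t ≤ T → ∃ P : ℂ → ℂ, DifferentiableOn ℂ P (ball 0 1) ∧ (∀ z ∈ ball (0:ℂ) 1, 0 ≤ (P z).re) ∧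
      P 0 = ((t - s : ℝ) : ℂ) ∧ ∀ z ∈ ball (0:ℂ) 1, L s z = - P z + L t (z * Complex.exp (- P z))) (n : ℕ) :
    ∑ k ∈ Finset.Icc 1 n, ((n:ℝ) + 1 - k) * (k * ‖co (L 0) k‖^2 - 4 / k) ≤ 0 := by
  have hc : ∀ t ∈ Icc 0 T, ∀ k, 1 ≤ k → ‖co (L t) k‖ ≤ 2 * (T - t) := by
    intro t ht k hk
    have h := carath (P := fun z => T - L t z) ((differentiableOn_const _).sub (hL t ht)) (by
      intro z hz; have := hLT t ht z hz; simp; exact this) (by rw [hL0 t ht]; simp) k hk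
    rw [co_sub analyticAt_const (anAt one_pos (hL t ht)), co_const, if_neg (by omega), zero_sub, norm_neg, hL0 t ht] at h
    simpa using h
  obtain ⟨C, hC, hstep⟩ := Phi_step n T hT
  have h0 : ∑ k ∈ Finset.Icc 1 n, ((n:ℝ) + 1 - k) * (k * ‖co (L 0) k‖^2 - 4 / k) = Phi n 0 (L 0) := by
    unfold Phi; apply Finset.sum_congr rfl; intro k hk; simp at hk
    rw [tau_zero n k (by omega)]
  have hTn : Phi n T (L T) ≤ 0 := by
    unfold Phi; apply Finset.sum_nonpos; intro k hk; simp at hk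
    have := hc T ⟨hT, le_rfl⟩ k hk.1
    have h1 : ‖co (L T) k‖ = 0 := le_antisymm (by linarith) (norm_nonneg _)
    rw [h1]
    have h2 := tau_nonneg n k T hT
    have h3 : (0:ℝ) ≤ 4/k := by positivity
    nlinarith
  have hst : ∀ s t, 0 ≤ s → s ≤ t → t ≤ T → Phi n s (L s) ≤ Phi n t (L t) + C * (t-s)^2 := by
    intro s t hs hst htT
    obtain ⟨P, hP, hre, hP0, hPe⟩ := hsub s t hs hst htT
    exact hstep (L s) (L t) P s t hs hst htT hP hre hP0 (hL t ⟨by linarith, htT⟩) (fun k hk => (hc t ⟨by linarith, htT⟩ k hk).trans (by linarith)) hPe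
  have hN : ∀ N : ℕ, Phi n 0 (L 0) ≤ C * T^2 / ((N:ℝ)+1) := by
    intro N
    have hN1 : (0:ℝ) < N + 1 := by positivity
    have ind : ∀ i : ℕ, i ≤ N + 1 → Phi n 0 (L 0) ≤ Phi n (i * (T/(N+1))) (L (i * (T/(N+1)))) + i * (C * (T/(N+1))^2) := by
      intro i
      induction i with
      | zero => intro _; simp
      | succ i ih =>
        intro hi
        have hi' : ((i:ℝ)+1) ≤ N + 1 := by exact_mod_cast hi
        have hq : 0 ≤ T/((N:ℝ)+1) := by positivity
        have h1 := hst (i * (T/(N+1))) (((i+1:ℕ):ℝ) * (T/(N+1))) (by positivity) (by push_cast; nlinarith) (by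
          push_cast
          calc ((i:ℝ)+1) * (T/(N+1)) ≤ (N+1) * (T/(N+1)) := by gcongr
            _ = T := by field_simp)
        have h2 := ih (by omega)
        have h3 : ((i+1:ℕ):ℝ) * (T/(N+1)) - i * (T/(N+1)) = T/(N+1) := by push_cast; ring
        rw [h3] at h1
        push_cast at h1 ⊢
        linarith
    have h1 := ind (N+1) le_rfl
    have h2 : ((N+1:ℕ):ℝ) * (T/(N+1)) = T := by push_cast; field_simp
    rw [h2] at h1
    have h3 : ((N+1:ℕ):ℝ) * (C * (T/(N+1))^2) = C * T^2/(N+1) := by push_cast; field_simp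
    linarith
  rw [h0]
  have hlim : Filter.Tendsto (fun N : ℕ => C * T^2 / ((N:ℝ)+1)) Filter.atTop (𝓝 0) := by
    have := (tendsto_one_div_add_atTop_nhds_zero_nat (𝕜 := ℝ)).const_mul (C * T^2)
    simpa [div_eq_mul_inv] using this
  exact ge_of_tendsto' hlim hN

end DB


namespace DB
open scoped Topology
open Filter

lemma lip_of_bdd {f : ℂ → ℂ} {z : ℂ} {r M : ℝ} (hr : 0 < r) (hf : DifferentiableOn ℂ f (ball z r)) (hM : ∀ x ∈ ball z r, ‖f x‖ ≤ M)
    {x y : ℂ} (hx : x ∈ ball z (r/2)) (hy : y ∈ ball z (r/2)) : ‖f y - f x‖ ≤ (4 * M / r) * ‖y - x‖ := by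
  have hda : ∀ x ∈ ball z r, DifferentiableAt ℂ f x := fun x hx => hf.differentiableAt (isOpen_ball.mem_nhds hx)
  refine Convex.norm_image_sub_le_of_norm_deriv_le (s := ball z (r/2)) (𝕜 := ℂ) (fun x hx => hda x (ball_subset_ball (by linarith) hx)) ?_ (convex_ball _ _) hx hy
  intro x hx
  have hsub : closedBall x (r/4) ⊆ ball z r := by
    intro w hw
    simp only [mem_ball, mem_closedBall] at *
    linarith [dist_triangle w x z]
  have := Complex.norm_deriv_le_of_forall_mem_sphere_norm_le (f := f) (c := x) (R := r/4) (C := M) (by linarith)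
    (DifferentiableOn.diffContOnCl (hf.mono (by rw [closure_ball _ (by linarith)]; exact hsub)))
    (fun w hw => hM w (hsub (sphere_subset_closedBall hw)))
  refine this.trans (le_of_eq ?_)
  field_simp

/-- Montel's theorem along an ultrafilter. -/
lemma montel {ι : Type*} (U : Ultrafilter ι) (F : ι → ℂ → ℂ) (W : Set ℂ) (M : ℝ)
    (h : ∀ z ∈ W, ∃ r > 0, ∀ᶠ i in (U : Filter ι), DifferentiableOn ℂ (F i) (ball z r) ∧ ∀ x ∈ ball z r, ‖F i x‖ ≤ M) :
    ∃ f : ℂ → ℂ, ∀ z ∈ W, ∃ r > 0, (∀ᶠ i in (U : Filter ι), DifferentiableOn ℂ (F i) (ball z r)) ∧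
      (DifferentiableOn ℂ f (ball z r)) ∧ TendstoUniformlyOn F f U (ball z r) := by
  have hp : ∀ z, ∃ w, (∃ M : ℝ, ∀ᶠ i in (U : Filter ι), ‖F i z‖ ≤ M) → Tendsto (fun i => F i z) U (𝓝 w) := by
    intro z
    by_cases hz : ∃ M : ℝ, ∀ᶠ i in (U : Filter ι), ‖F i z‖ ≤ M
    · obtain ⟨M, hM⟩ := hz
      obtain ⟨w, -, hw⟩ := (isCompact_closedBall (0:ℂ) M).ultrafilter_le_nhds (U.map (fun i => F i z)) (by
        rw [le_principal_iff]
        change ∀ᶠ i in (U : Filter ι), F i z ∈ closedBall 0 M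
        filter_upwards [hM] with i hi using by simpa using hi)
      exact ⟨w, fun _ => hw⟩
    · exact ⟨0, fun h => absurd h hz⟩
  choose f hf using hp
  refine ⟨f, fun z hz => ?_⟩
  obtain ⟨r, hr, hev⟩ := h z hz
  have hconv : ∀ x ∈ ball z r, Tendsto (fun i => F i x) U (𝓝 (f x)) := by
    intro x hx
    apply hf
    exact ⟨M, by filter_upwards [hev] with i hi using hi.2 x hx⟩
  have hMnn : 0 ≤ M := by
    obtain ⟨i, hi⟩ := hev.exists
    exact (norm_nonneg _).trans (hi.2 z (mem_ball_self hr))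
  have hlip : ∀ᶠ i in (U : Filter ι), ∀ x ∈ ball z (r/2), ∀ y ∈ ball z (r/2), ‖F i y - F i x‖ ≤ (4 * M / r) * ‖y - x‖ := by
    filter_upwards [hev] with i hi x hx y hy using lip_of_bdd hr hi.1 hi.2 hx hy
  have hlipf : ∀ x ∈ ball z (r/2), ∀ y ∈ ball z (r/2), ‖f y - f x‖ ≤ (4 * M / r) * ‖y - x‖ := by
    intro x hx y hy
    have hss : ball z (r/2) ⊆ ball z r := ball_subset_ball (by linarith)
    refine le_of_tendsto (((hconv y (hss hy)).sub (hconv x (hss hx))).norm) ?_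
    filter_upwards [hlip] with i hi using hi x hx y hy
  have hunif : TendstoUniformlyOn F f U (ball z (r/4)) := by
    rw [Metric.tendstoUniformlyOn_iff]
    intro ε hε
    set L := 4 * M / r with hL
    have hLnn : 0 ≤ L := by positivity
    set δ := ε / (3 * (L + 1)) with hδ
    have hδp : 0 < δ := by positivity
    obtain ⟨t, hts, htfin, htc⟩ := ((isCompact_closedBall z (r/4)).finite_cover_balls hδp)
    have hfin : ∀ᶠ i in (U : Filter ι), ∀ x ∈ t, ‖F i x - f x‖ < ε/3 := by
      rw [eventually_all_finite htfin]
      intro x hx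
      have hx' : x ∈ ball z r := closedBall_subset_ball (by linarith) (hts hx)
      have := (hconv x hx')
      rw [Metric.tendsto_nhds] at this
      filter_upwards [this (ε/3) (by linarith)] with i hi using by rwa [dist_eq_norm] at hi
    filter_upwards [hlip, hfin] with i h1 h2 y hy
    have hy' := htc (ball_subset_closedBall hy)
    simp only [mem_iUnion] at hy'
    obtain ⟨x, hx, hxy⟩ := hy'
    have hxb : x ∈ ball z (r/2) := closedBall_subset_ball (by linarith) (hts hx)
    have hyb : y ∈ ball z (r/2) := ball_subset_ball (by linarith) hy
    have a1 := h1 x hxb y hyb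
    have a2 := hlipf x hxb y hyb
    have a3 := h2 x hx
    have hd : ‖y - x‖ < δ := by rwa [mem_ball, dist_eq_norm] at hxy
    have a4 : L * ‖y - x‖ ≤ ε/3 := by
      calc L * ‖y - x‖ ≤ (L+1) * δ := by gcongr; linarith
        _ = ε/3 := by rw [hδ]; field_simp
    rw [dist_eq_norm]
    have e : f y - F i y = (f y - f x) - (F i x - f x) - (F i y - F i x) := by ring
    rw [e]
    have := norm_sub_le ((f y - f x) - (F i x - f x)) (F i y - F i x)
    have := norm_sub_le (f y - f x) (F i x - f x)
    linarith
  have hdev : ∀ᶠ i in (U : Filter ι), DifferentiableOn ℂ (F i) (ball z (r/4)) := by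
    filter_upwards [hev] with i hi using hi.1.mono (ball_subset_ball (by linarith))
  exact ⟨r/4, by linarith, hdev, hunif.tendstoLocallyUniformlyOn.differentiableOn hdev isOpen_ball, hunif⟩

/-- Hurwitz, local nonvanishing form. -/
lemma hurwitz {ι : Type*} {U : Filter ι} [U.NeBot] {F : ι → ℂ → ℂ} {f : ℂ → ℂ} {z : ℂ} {r : ℝ} (hr : 0 < r)
    (hF : ∀ᶠ i in U, DifferentiableOn ℂ (F i) (ball z r) ∧ ∀ x ∈ ball z r, F i x ≠ 0)
    (hu : TendstoUniformlyOn F f U (ball z r)) (hf : DifferentiableOn ℂ f (ball z r)) (h0 : f z = 0) :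
    ∀ᶠ x in 𝓝 z, f x = 0 := by
  rcases (hf.analyticAt (ball_mem_nhds z hr)).eventually_eq_zero_or_eventually_ne_zero with h | h
  · exact h
  exfalso
  rw [eventually_nhdsWithin_iff, Metric.eventually_nhds_iff] at h
  obtain ⟨ε, hε, h⟩ := h
  set ρ := min (ε/2) (r/2) with hρ
  have hρ0 : 0 < ρ := by positivity
  have hρr : ρ < r := lt_of_le_of_lt (min_le_right _ _) (by linarith)
  have hρε : ρ < ε := lt_of_le_of_lt (min_le_left _ _) (by linarith)
  have hsub : closedBall z ρ ⊆ ball z r := closedBall_subset_ball hρr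
  obtain ⟨x0, hx0, hmin⟩ := (isCompact_sphere z ρ).exists_isMinOn (NormedSpace.sphere_nonempty.mpr hρ0.le)
    (hf.continuousOn.mono (sphere_subset_closedBall.trans hsub)).norm
  have hm : 0 < ‖f x0‖ := by
    rw [norm_pos_iff]
    apply h
    · rw [mem_sphere.mp hx0]; exact hρε
    · rintro rfl; simp at hx0; linarith
  set m := ‖f x0‖ with hmd
  rw [Metric.tendstoUniformlyOn_iff] at hu
  obtain ⟨i, ⟨hi1, hi2⟩, hi3⟩ := (hF.and (hu (m/2) (by linarith))).exists
  have hz := hi3 z (mem_ball_self hr)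
  rw [h0, dist_zero_left] at hz
  have hs : ∀ x ∈ sphere z ρ, ‖(F i x)⁻¹‖ ≤ (m/2)⁻¹ := by
    intro x hx
    have h1 := hi3 x (hsub (sphere_subset_closedBall hx))
    have h2 : m ≤ ‖f x‖ := hmin hx
    rw [dist_eq_norm] at h1
    have h3 := norm_sub_norm_le (f x) (F i x)
    rw [norm_inv]
    apply inv_anti₀ (by linarith)
    linarith
  have := Complex.norm_le_of_forall_mem_frontier_norm_le (f := fun x => (F i x)⁻¹) (U := ball z ρ) isBounded_ball
    (DifferentiableOn.diffContOnCl (by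
      rw [closure_ball _ hρ0.ne']
      exact (hi1.mono hsub).inv (fun x hx => hi2 x (hsub hx)))) (C := (m/2)⁻¹) (by
      rw [frontier_ball _ hρ0.ne']; exact hs) (z := z) (subset_closure (mem_ball_self hρ0))
  rw [norm_inv, inv_le_inv₀ (norm_pos_iff.mpr (hi2 z (mem_ball_self hr))) (by linarith)] at this
  linarith

lemma inj_not_const {f : ℂ → ℂ} {W : Set ℂ} (hW : IsOpen W) (hi : InjOn f W) {z : ℂ} (hz : z ∈ W) (c : ℂ) : ¬ ∀ᶠ x in 𝓝 z, f x = c := by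
  intro h
  have h2 : ∀ᶠ x in 𝓝[≠] z, x ∈ W ∧ f x = c := ((hW.eventually_mem hz).and h).filter_mono nhdsWithin_le_nhds
  obtain ⟨x, ⟨hx, hxc⟩, hne⟩ := (h2.and self_mem_nhdsWithin).exists
  exact hne (hi hx hz (hxc.trans h.self_of_nhds.symm))

lemma inj_open {f : ℂ → ℂ} {W : Set ℂ} (hW : IsOpen W) (hf : DifferentiableOn ℂ f W) (hi : InjOn f W) {z : ℂ} (hz : z ∈ W) :
    𝓝 (f z) ≤ map f (𝓝 z) := by
  rcases (hf.analyticAt (hW.mem_nhds hz)).eventually_constant_or_nhds_le_map_nhds with h | h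
  · exact absurd h (inj_not_const hW hi hz _)
  · exact h

lemma inj_isOpen {f : ℂ → ℂ} {W : Set ℂ} (hW : IsOpen W) (hf : DifferentiableOn ℂ f W) (hi : InjOn f W) : IsOpen (f '' W) := by
  rw [isOpen_iff_mem_nhds]
  rintro _ ⟨z, hz, rfl⟩
  exact inj_open hW hf hi hz (image_mem_map (hW.mem_nhds hz))

lemma inj_inv {f g : ℂ → ℂ} {W : Set ℂ} (hW : IsOpen W) (hf : DifferentiableOn ℂ f W) (hi : InjOn f W) (hg : ∀ z ∈ W, g (f z) = z) :
    DifferentiableOn ℂ g (f '' W) := by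
  have hcont : ∀ z ∈ W, ContinuousAt g (f z) := by
    intro z hz
    rw [ContinuousAt, hg z hz]
    intro V hV
    have : f '' (V ∩ W) ∈ 𝓝 (f z) := inj_open hW hf hi hz (image_mem_map (inter_mem hV (hW.mem_nhds hz)))
    change ∀ᶠ y in 𝓝 (f z), g y ∈ V
    filter_upwards [this]
    rintro _ ⟨x, ⟨hx, hxW⟩, rfl⟩
    rwa [hg x hxW]
  have hopen := inj_isOpen hW hf hi
  have hreg : ∀ z ∈ W, deriv f z ≠ 0 → DifferentiableAt ℂ g (f z) := by
    intro z hz hd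
    refine (HasDerivAt.of_local_left_inverse (f := f) (f' := deriv f z) (hcont z hz) ?_ hd ?_).differentiableAt
    · rw [hg z hz]; exact (hf.differentiableAt (hW.mem_nhds hz)).hasDerivAt
    · filter_upwards [hopen.mem_nhds (mem_image_of_mem f hz)]
      rintro _ ⟨x, hx, rfl⟩
      rw [hg x hx]
  rintro _ ⟨z, hz, rfl⟩
  have han : AnalyticAt ℂ (deriv f) z := ((hf.analyticOnNhd hW) z hz).deriv
  rcases han.eventually_eq_zero_or_eventually_ne_zero with h | h
  · exfalso
    obtain ⟨ε, hε, hb⟩ := Metric.mem_nhds_iff.mp (inter_mem h (hW.mem_nhds hz))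
    apply inj_not_const hW hi hz (f z)
    filter_upwards [ball_mem_nhds z hε] with x hx
    have := Convex.norm_image_sub_le_of_norm_deriv_le (s := ball z ε) (𝕜 := ℂ) (f := f) (C := 0) (x := z) (y := x)
      (fun y hy => hf.differentiableAt (hW.mem_nhds (hb hy).2)) (fun y hy => by rw [show deriv f y = 0 from (hb hy).1]; simp) (convex_ball _ _) (mem_ball_self hε) hx
    simp at this
    exact sub_eq_zero.mp this
  · rw [eventually_nhdsWithin_iff] at h
    set V := {x | x ≠ z → deriv f x ≠ 0} ∩ W with hV
    have hVn : V ∈ 𝓝 z := inter_mem h (hW.mem_nhds hz)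
    have hs : f '' V ∈ 𝓝 (f z) := inj_open hW hf hi hz (image_mem_map hVn)
    have h1 : DifferentiableOn ℂ g (f '' V) := by
      rw [← Complex.differentiableOn_compl_singleton_and_continuousAt_iff hs]
      refine ⟨?_, hcont z hz⟩
      rintro _ ⟨⟨x, hx, rfl⟩, hne⟩
      exact (hreg x hx.2 (hx.1 (by rintro rfl; exact hne rfl))).differentiableWithinAt
    exact (h1.differentiableAt hs).differentiableWithinAt

lemma inj_deriv_ne {f : ℂ → ℂ} {W : Set ℂ} (hW : IsOpen W) (hf : DifferentiableOn ℂ f W) (hi : InjOn f W) {z : ℂ} (hz : z ∈ W) : deriv f z ≠ 0 := by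
  have hg : ∀ z ∈ W, Function.invFunOn f W (f z) = z := fun z hz => hi.leftInvOn_invFunOn hz
  have h1 := (inj_inv hW hf hi hg).differentiableAt ((inj_isOpen hW hf hi).mem_nhds (mem_image_of_mem f hz))
  have h2 := h1.hasDerivAt.comp z (hf.differentiableAt (hW.mem_nhds hz)).hasDerivAt
  have h3 : HasDerivAt (Function.invFunOn f W ∘ f) 1 z := by
    refine (hasDerivAt_id z).congr_of_eventuallyEq ?_
    filter_upwards [hW.mem_nhds hz] with x hx using hg x hx
  intro h0
  rw [h0, mul_zero] at h2
  exact zero_ne_one (h2.unique h3)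

/-- locally constant analytic functions on preconnected sets are constant -/
lemma const_of_ev {f : ℂ → ℂ} {W : Set ℂ} (hW : IsOpen W) (hc : IsPreconnected W) (hf : DifferentiableOn ℂ f W) {z c : ℂ} (hz : z ∈ W)
    (h : ∀ᶠ x in 𝓝 z, f x = c) : ∀ x ∈ W, f x = c :=
  (hf.analyticOnNhd hW).eqOn_of_preconnected_of_eventuallyEq (g := fun _ => c) (fun _ _ => analyticAt_const) hc hz h

lemma exists_log {q : ℂ → ℂ} {c : ℂ} {r : ℝ} (hq : DifferentiableOn ℂ q (ball c r)) (hn : ∀ z ∈ ball c r, q z ≠ 0) (a : ℂ) (ha : Complex.exp a = q c) :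
    ∃ l : ℂ → ℂ, DifferentiableOn ℂ l (ball c r) ∧ l c = a ∧ ∀ z ∈ ball c r, Complex.exp (l z) = q z := by
  rcases le_or_gt r 0 with hr | hr
  · rw [ball_eq_empty.mpr hr]
    exact ⟨fun _ => a, by simp, rfl, by simp⟩
  obtain ⟨g, hg⟩ := DifferentiableOn.isExactOn_ball (f := fun z => deriv q z / q z) ((hq.deriv isOpen_ball).div hq hn)
  have hd : DifferentiableOn ℂ (fun z => a + (g z - g c)) (ball c r) := fun z hz =>
    (((hg z hz).sub_const (g c)).const_add a).differentiableAt.differentiableWithinAt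
  refine ⟨fun z => a + (g z - g c), hd, by simp, ?_⟩
  have hz : ∀ z ∈ ball c r, deriv (fun z => Complex.exp (-(a + (g z - g c))) * q z) z = 0 := by
    intro z hz
    have h1 := (((hg z hz).sub_const (g c)).const_add a).fun_neg.cexp.fun_mul (hq.differentiableAt (isOpen_ball.mem_nhds hz)).hasDerivAt
    rw [h1.deriv]
    have := hn z hz
    field_simp
    ring
  have hdd : DifferentiableOn ℂ (fun z => Complex.exp (-(a + (g z - g c))) * q z) (ball c r) := hd.fun_neg.cexp.fun_mul hq
  intro z hzz
  have := (convex_ball c r).is_const_of_fderivWithin_eq_zero (𝕜 := ℂ) hdd (by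
    intro x hx
    rw [fderivWithin_of_isOpen isOpen_ball hx]
    ext
    simpa using hz x hx) hzz (mem_ball_self hr)
  simp only [sub_self, add_zero] at this
  rw [← ha, ← Complex.exp_add, neg_add_cancel, Complex.exp_zero] at this
  rw [Complex.exp_neg] at this
  have he := Complex.exp_ne_zero (a + (g z - g c))
  field_simp at this
  exact this.symm

end DB


namespace DB
open scoped Topology
open Filter

/-- disc automorphism -/
def mob (a z : ℂ) : ℂ := (z - a) / (1 - starRingEnd ℂ a * z)

lemma mob_den {a z : ℂ} (ha : ‖a‖ < 1) (hz : ‖z‖ ≤ 1) : 1 - starRingEnd ℂ a * z ≠ 0 := by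
  intro h
  have : ‖starRingEnd ℂ a * z‖ = 1 := by rw [← sub_eq_zero.mp h]; simp
  rw [norm_mul, RCLike.norm_conj] at this
  nlinarith [norm_nonneg a, norm_nonneg z]

lemma mob_id (a z : ℂ) : ‖1 - starRingEnd ℂ a * z‖^2 - ‖z - a‖^2 = (1 - ‖a‖^2) * (1 - ‖z‖^2) := by
  simp only [← Complex.normSq_eq_norm_sq, Complex.normSq_apply]
  simp
  ring

lemma mob_le {a z : ℂ} (ha : ‖a‖ < 1) (hz : ‖z‖ ≤ 1) : ‖mob a z‖ ≤ 1 := by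
  have h := mob_id a z
  rw [mob, norm_div, div_le_one (norm_pos_iff.mpr (mob_den ha hz))]
  have h1 : 0 ≤ (1 - ‖a‖^2) * (1 - ‖z‖^2) := mul_nonneg (by nlinarith [norm_nonneg a]) (by nlinarith [norm_nonneg z])
  exact abs_le_of_sq_le_sq' (by linarith) (norm_nonneg _) |>.2

lemma mob_lt {a z : ℂ} (ha : ‖a‖ < 1) (hz : ‖z‖ < 1) : ‖mob a z‖ < 1 := by
  have h := mob_id a z
  rw [mob, norm_div, div_lt_one (norm_pos_iff.mpr (mob_den ha hz.le))]
  have h1 : 0 < (1 - ‖a‖^2) * (1 - ‖z‖^2) := mul_pos (by nlinarith [norm_nonneg a]) (by nlinarith [norm_nonneg z])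
  exact lt_of_pow_lt_pow_left₀ 2 (norm_nonneg _) (by linarith)

lemma mob_inv {a z : ℂ} (ha : ‖a‖ < 1) (hz : ‖z‖ ≤ 1) : mob (-a) (mob a z) = z := by
  have h1 := mob_den ha hz
  have h2 : 1 - starRingEnd ℂ a * a ≠ 0 := mob_den ha ha.le
  have h3 : 1 - starRingEnd ℂ (-a) * mob a z ≠ 0 := mob_den (by simpa using ha) (mob_le ha hz)
  rw [mob, div_eq_iff h3]
  have hq : mob a z * (1 - starRingEnd ℂ a * z) = z - a := by rw [mob, div_mul_cancel₀ _ h1]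
  rw [map_neg]
  linear_combination hq

lemma mob_inv' {a z : ℂ} (ha : ‖a‖ < 1) (hz : ‖z‖ ≤ 1) : mob a (mob (-a) z) = z := by
  have := mob_inv (a := -a) (z := z) (by simpa using ha) hz
  rwa [neg_neg] at this

lemma mob_self (a : ℂ) : mob a a = 0 := by simp [mob]
lemma mob_zero (a : ℂ) : mob a 0 = -a := by simp [mob]

lemma mob_diff {a : ℂ} (ha : ‖a‖ < 1) : DifferentiableOn ℂ (mob a) (ball 0 1) := by
  intro z hz
  have := mob_den ha (z := z) (by simp at hz; exact hz.le)
  unfold mob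
  exact (DifferentiableAt.div (differentiableAt_id.sub_const a) ((differentiableAt_const _).sub (differentiableAt_id.const_mul _)) this).differentiableWithinAt

lemma mob_cont {a : ℂ} (ha : ‖a‖ < 1) : ContinuousOn (mob a) (closedBall 0 1) := by
  intro z hz
  have := mob_den ha (z := z) (by simpa using hz)
  unfold mob
  exact (ContinuousAt.div (continuousAt_id.sub continuousAt_const) (continuousAt_const.sub (continuousAt_const.mul continuousAt_id)) this).continuousWithinAt

/-- the domains we consider -/
structure Dom (Ω : Set ℂ) : Prop where
  op : IsOpen Ω
  conn : IsPreconnected Ω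
  sub : Ω ⊆ ball 0 1
  zero : (0:ℂ) ∈ Ω
  compl : IsPreconnected (closedBall 0 1 \ Ω)

lemma sqrt_chain {V E : Set ℂ} {δ : ℝ} (hδ : 0 < δ) (hE : IsPreconnected E) (hd : ∀ z ∈ V, ∀ c ∈ E, δ ≤ dist z c) {b a : ℂ} (hb : b ∈ E) (ha : a ∈ E)
    (hs : ∃ h : ℂ → ℂ, DifferentiableOn ℂ h V ∧ ∀ z ∈ V, h z^2 = z - b) : ∃ h : ℂ → ℂ, DifferentiableOn ℂ h V ∧ ∀ z ∈ V, h z^2 = z - a := by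
  set Q : ℂ → Prop := fun c => ∃ h : ℂ → ℂ, DifferentiableOn ℂ h V ∧ ∀ z ∈ V, h z^2 = z - c with hQ
  have step : ∀ c ∈ E, ∀ c' ∈ E, dist c c' < δ → Q c → Q c' := by
    rintro c hc c' hc' hcc ⟨h, hh, he⟩
    have hne : ∀ z ∈ V, z - c ≠ 0 := by
      intro z hz h0
      have := hd z hz c hc
      rw [sub_eq_zero.mp h0, dist_self] at this
      linarith
    have hslit : ∀ z ∈ V, (z - c') / (z - c) ∈ Complex.slitPlane := by
      intro z hz
      have e : (z - c') / (z - c) = 1 + (c - c') / (z - c) := by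
        have := hne z hz
        field_simp
        ring
      rw [e]
      apply Complex.mem_slitPlane_of_norm_lt_one
      rw [norm_div, div_lt_one (norm_pos_iff.mpr (hne z hz)), ← dist_eq_norm, ← dist_eq_norm]
      exact lt_of_lt_of_le hcc (hd z hz c hc)
    refine ⟨fun z => h z * Complex.exp (Complex.log ((z - c') / (z - c)) / 2), ?_, ?_⟩
    · apply hh.fun_mul
      apply DifferentiableOn.cexp
      apply DifferentiableOn.div_const
      apply DifferentiableOn.clog _ hslit
      exact DifferentiableOn.div (by fun_prop) (by fun_prop) hne
    · intro z hz
      rw [mul_pow, he z hz, ← Complex.exp_nat_mul]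
      have e : ((2:ℕ):ℂ) * (Complex.log ((z - c') / (z - c)) / 2) = Complex.log ((z - c') / (z - c)) := by push_cast; ring
      rw [e, Complex.exp_log (Complex.slitPlane_ne_zero (hslit z hz))]
      have := hne z hz
      field_simp
  by_contra hna
  have := hE (⋃ c ∈ {c | c ∈ E ∧ Q c}, ball c (δ/2)) (⋃ c ∈ {c | c ∈ E ∧ ¬ Q c}, ball c (δ/2))
    (isOpen_biUnion fun _ _ => isOpen_ball) (isOpen_biUnion fun _ _ => isOpen_ball) (by
      intro c hc
      by_cases hq : Q c
      · left; exact mem_biUnion (show c ∈ {c | c ∈ E ∧ Q c} from ⟨hc, hq⟩) (mem_ball_self (by linarith))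
      · right; exact mem_biUnion (show c ∈ {c | c ∈ E ∧ ¬ Q c} from ⟨hc, hq⟩) (mem_ball_self (by linarith)))
    ⟨b, hb, mem_biUnion (show b ∈ {c | c ∈ E ∧ Q c} from ⟨hb, hs⟩) (mem_ball_self (by linarith))⟩
    ⟨a, ha, mem_biUnion (show a ∈ {c | c ∈ E ∧ ¬ Q c} from ⟨ha, hna⟩) (mem_ball_self (by linarith))⟩
  obtain ⟨x, hx, hx1, hx2⟩ := this
  simp only [mem_iUnion, mem_ball, mem_ofPred_eq, exists_prop] at hx1 hx2
  obtain ⟨c, ⟨hc, hqc⟩, hxc⟩ := hx1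
  obtain ⟨c', ⟨hc', hqc'⟩, hxc'⟩ := hx2
  apply hqc' (step c hc c' hc' _ hqc)
  rw [dist_comm] at hxc
  linarith [dist_triangle c x c']

lemma sqrt_exists {Ω : Set ℂ} (hΩ : Dom Ω) {a : ℂ} (ha : a ∈ closedBall (0:ℂ) 1 \ Ω) :
    ∃ h : ℂ → ℂ, DifferentiableOn ℂ h Ω ∧ ∀ z ∈ Ω, h z^2 = z - a := by
  set E := closedBall (0:ℂ) 1 \ Ω with hE
  have hEc : IsClosed E := isClosed_closedBall.sdiff hΩ.op
  have h1 : (1:ℂ) ∈ E := ⟨by simp, fun h => by simpa using hΩ.sub h⟩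
  obtain ⟨l, hl, -, hle⟩ := exists_log (q := fun z => z - 1) (c := 0) (r := 1) (by fun_prop) (by
    intro z hz h0
    rw [sub_eq_zero.mp h0] at hz; simp at hz) (Complex.log (0-1)) (Complex.exp_log (by norm_num))
  have hj : ∀ j : ℕ, ∃ h : ℂ → ℂ, DifferentiableOn ℂ h {z ∈ Ω | 1/((j:ℝ)+1) < infDist z E} ∧ ∀ z ∈ {z ∈ Ω | 1/((j:ℝ)+1) < infDist z E}, h z^2 = z - a := by
    intro j
    refine sqrt_chain (δ := 1/((j:ℝ)+1)) (by positivity) hΩ.compl ?_ h1 ha ?_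
    · intro z hz c hc
      exact hz.2.le.trans (infDist_le_dist_of_mem hc)
    · refine ⟨fun z => Complex.exp (l z / 2), ?_, ?_⟩
      · apply DifferentiableOn.cexp
        apply DifferentiableOn.div_const
        exact hl.mono (fun z hz => hΩ.sub hz.1)
      · intro z hz
        rw [← hle z (hΩ.sub hz.1), ← Complex.exp_nat_mul]
        congr 1; push_cast; ring
  choose h hd he using hj
  have hnh : ∀ z ∈ Ω, ∃ r > 0, ∀ᶠ j : ℕ in atTop, ball z r ⊆ {z ∈ Ω | 1/((j:ℝ)+1) < infDist z E} := by
    intro z hz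
    have hpos : 0 < infDist z E := (hEc.notMem_iff_infDist_pos ⟨1, h1⟩).mp (fun h => h.2 hz)
    obtain ⟨r, hr, hrs⟩ := Metric.isOpen_iff.mp hΩ.op z hz
    refine ⟨min r (infDist z E / 2), by positivity, ?_⟩
    have ht := (tendsto_one_div_add_atTop_nhds_zero_nat (𝕜 := ℝ)).eventually (gt_mem_nhds (show 0 < infDist z E / 2 by positivity))
    filter_upwards [ht] with j hj x hx
    refine ⟨hrs (ball_subset_ball (min_le_left _ _) hx), ?_⟩
    have h1 : dist x z < infDist z E / 2 := lt_of_lt_of_le hx (min_le_right _ _)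
    have h2 := infDist_le_infDist_add_dist (s := E) (x := z) (y := x)
    rw [dist_comm] at h2
    linarith
  obtain ⟨f, hf⟩ := montel (hyperfilter ℕ) h Ω 2 (by
    intro z hz
    obtain ⟨r, hr, hev⟩ := hnh z hz
    refine ⟨r, hr, (hev.filter_mono (Nat.hyperfilter_le_atTop)).mono ?_⟩
    intro j hj
    refine ⟨(hd j).mono hj, fun x hx => ?_⟩
    have h1 := he j x (hj hx)
    have h2 : ‖x‖ < 1 := by simpa using hΩ.sub (hj hx).1
    have h3 : ‖a‖ ≤ 1 := by simpa using ha.1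
    have h4 : ‖h j x‖^2 ≤ 2 := by
      rw [← norm_pow, h1]
      exact (norm_sub_le _ _).trans (by linarith)
    nlinarith [norm_nonneg (h j x)])
  refine ⟨f, ?_, ?_⟩
  · intro z hz
    obtain ⟨r, hr, -, h2, -⟩ := hf z hz
    exact (h2.differentiableAt (ball_mem_nhds z hr)).differentiableWithinAt
  · intro z hz
    obtain ⟨r, hr, h1, h2, h3⟩ := hf z hz
    have ht := (h3.tendsto_at (mem_ball_self hr)).pow 2
    refine tendsto_nhds_unique ht (tendsto_const_nhds.congr' ?_)
    obtain ⟨r', hr', hev⟩ := hnh z hz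
    filter_upwards [hev.filter_mono (Nat.hyperfilter_le_atTop)] with j hj using (he j z (hj (mem_ball_self hr'))).symm

lemma sq_open : IsOpenMap (fun z : ℂ => z^2) := by
  have h := AnalyticOnNhd.is_constant_or_isOpen (g := fun z : ℂ => z^2) (U := univ) (fun z _ => by fun_prop) isPreconnected_univ
  rcases h with ⟨w, hw⟩ | h
  · exfalso
    have h0 := hw 0 trivial
    have h1 := hw 1 trivial
    simp at h0 h1
    exact zero_ne_one (h0.trans h1.symm)
  · exact fun s hs => h s (subset_univ s) hs

lemma sq_preimage {E : Set ℂ} (hE : IsPreconnected E) (hEc : IsCompact E) (h0 : (0:ℂ) ∈ E) : IsPreconnected {w : ℂ | w^2 ∈ E} := by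
  set S := {w : ℂ | w^2 ∈ E} with hS
  have hScl : IsClosed S := hEc.isClosed.preimage (continuous_pow 2)
  have hSc : IsCompact S := by
    obtain ⟨R, hR⟩ := hEc.isBounded.subset_closedBall 0
    refine (isCompact_closedBall (0:ℂ) (R+1)).of_isClosed_subset hScl ?_
    intro w hw
    have := hR hw
    simp only [mem_closedBall_zero_iff, norm_pow] at this ⊢
    nlinarith [norm_nonneg w]
  have main : ∀ u v : Set ℂ, IsOpen u → IsOpen v → S ⊆ u ∪ v → (0:ℂ) ∈ u → (S ∩ v).Nonempty → (S ∩ (u ∩ v)).Nonempty := by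
    intro u v hu hv hsub h0u ⟨x, hxS, hxv⟩
    have hcl : IsClosed ((fun z : ℂ => z^2) '' (S \ u)) := ((hSc.diff hu).image (continuous_pow 2)).isClosed
    obtain ⟨y, hyE, ⟨w, hw, rfl⟩, hy2⟩ := hE ((fun z : ℂ => z^2) '' v) ((fun z : ℂ => z^2) '' (S \ u))ᶜ (sq_open v hv) hcl.isOpen_compl (by
      intro y hy
      by_cases hyc : y ∈ (fun z : ℂ => z^2) '' (S \ u)
      · left
        obtain ⟨w, ⟨hwS, hwu⟩, rfl⟩ := hyc
        exact ⟨w, (hsub hwS).resolve_left hwu, rfl⟩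
      · right; exact hyc) ⟨x^2, hxS, x, hxv, rfl⟩ ⟨0, h0, by
        rintro ⟨w, ⟨hwS, hwu⟩, hw0⟩
        have : w = 0 := by simpa using hw0
        rw [this] at hwu; exact hwu h0u⟩
    refine ⟨w, hyE, ?_, hw⟩
    by_contra hwu
    exact hy2 ⟨w, ⟨hyE, hwu⟩, rfl⟩
  intro u v hu hv hsub hSu hSv
  have h0S : (0:ℂ) ∈ S := by simp [hS, h0]
  rcases hsub h0S with h | h
  · exact main u v hu hv hsub h hSv
  · rw [inter_comm u v]
    exact main v u hv hu (by rwa [union_comm]) h hSu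

end DB


namespace DB
open scoped Topology
open Filter

lemma mob_inj {a z w : ℂ} (ha : ‖a‖ < 1) (hz : ‖z‖ ≤ 1) (hw : ‖w‖ ≤ 1) (h : mob a z = mob a w) : z = w := by
  rw [← mob_inv ha hz, h, mob_inv ha hw]

lemma mob_deriv {a z : ℂ} (ha : ‖a‖ < 1) (hz : ‖z‖ ≤ 1) : HasDerivAt (mob a) ((1 - starRingEnd ℂ a * a) / (1 - starRingEnd ℂ a * z)^2) z := by
  have h := ((hasDerivAt_id z).sub_const a).div (((hasDerivAt_id z).const_mul (starRingEnd ℂ a)).const_sub 1) (mob_den ha hz)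
  refine HasDerivAt.congr_deriv h ?_
  simp
  ring

lemma conj_mul_norm (a : ℂ) : starRingEnd ℂ a * a = ((‖a‖^2 : ℝ) : ℂ) := by
  rw [mul_comm, Complex.mul_conj, Complex.normSq_eq_norm_sq]

lemma koebe_compl {Ω : Set ℂ} (hΩ : Dom Ω) {a : ℂ} (ha : a ∈ closedBall (0:ℂ) 1 \ Ω) (ha1 : ‖a‖ < 1) {h : ℂ → ℂ}
    (hop : IsOpen (h '' Ω)) (hc : ContinuousOn h Ω) (hh : ∀ z ∈ Ω, h z^2 = mob a z) (hlt : ∀ z ∈ Ω, ‖h z‖ < 1) :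
    IsPreconnected (closedBall (0:ℂ) 1 \ h '' Ω) := by
  have hn : ∀ z ∈ Ω, ‖z‖ ≤ 1 := fun z hz => by simpa using (ball_subset_closedBall (hΩ.sub hz))
  have hma : ‖-a‖ < 1 := by simpa using ha1
  have hS : IsPreconnected {w : ℂ | w^2 ∈ mob a '' (closedBall 0 1 \ Ω)} := by
    apply sq_preimage
    · exact hΩ.compl.image _ ((mob_cont ha1).mono sdiff_subset)
    · exact ((isCompact_closedBall _ _).diff hΩ.op).image_of_continuousOn ((mob_cont ha1).mono sdiff_subset)
    · exact ⟨a, ha, mob_self a⟩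
  obtain ⟨N, hN⟩ : ∃ N : Set ℂ, N = (fun z => - h z) '' Ω := ⟨_, rfl⟩
  obtain ⟨S, hSd⟩ : ∃ S : Set ℂ, S = {w : ℂ | w^2 ∈ mob a '' (closedBall 0 1 \ Ω)} := ⟨_, rfl⟩
  rw [← hSd] at hS
  have hdis : Disjoint N (h '' Ω) := by
    rw [Set.disjoint_left]
    rintro w hw ⟨z', hz', hw'⟩
    rw [hN] at hw
    obtain ⟨z, hz, rfl⟩ := hw
    have e : mob a z = mob a z' := by rw [← hh z hz, ← hh z' hz', hw']; ring
    have e2 := mob_inj ha1 (hn z hz) (hn z' hz') e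
    rw [e2] at hw'
    have e3 : h z' = 0 := by simp only [] at hw'; linear_combination (1/2) * hw'
    have e4 : mob a z' = mob a a := by rw [← hh z' hz', e3, mob_self]; simp
    have := mob_inj ha1 (hn z' hz') ha1.le e4
    rw [this] at hz'
    exact ha.2 hz'
  have hU : closedBall (0:ℂ) 1 \ h '' Ω = S ∪ N := by
    apply Subset.antisymm
    · rintro w ⟨hw, hw'⟩
      have hw1 : ‖w^2‖ ≤ 1 := by
        rw [norm_pow]; simp at hw; nlinarith [norm_nonneg w]
      have hy := mob_le hma hw1
      have e := mob_inv' ha1 hw1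
      by_cases hyΩ : mob (-a) (w^2) ∈ Ω
      · right
        rw [hN]
        refine ⟨_, hyΩ, ?_⟩
        have e1 := hh _ hyΩ
        rw [e] at e1
        rcases sq_eq_sq_iff_eq_or_eq_neg.mp e1 with h1 | h1
        · exact absurd ⟨_, hyΩ, h1⟩ hw'
        · simp [h1]
      · left
        rw [hSd]
        exact ⟨mob (-a) (w^2), ⟨by simpa using hy, hyΩ⟩, e⟩
    · rintro w (hw | hw)
      · rw [hSd] at hw
        obtain ⟨y, hy, hyw⟩ := hw
        have hy1 : ‖y‖ ≤ 1 := by simpa using hy.1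
        refine ⟨?_, ?_⟩
        · have := mob_le ha1 hy1
          rw [hyw, norm_pow] at this
          simp; nlinarith [norm_nonneg w]
        · rintro ⟨z, hz, rfl⟩
          have := mob_inj ha1 hy1 (hn z hz) (hyw.trans (hh z hz))
          rw [this] at hy
          exact hy.2 hz
      · refine ⟨?_, fun h' => (Set.disjoint_left.mp hdis) hw h'⟩
        rw [hN] at hw
        obtain ⟨z, hz, rfl⟩ := hw
        simpa using (hlt z hz).le
  have hNc : IsPreconnected N := by rw [hN]; exact hΩ.conn.image _ hc.neg
  have hNcl : closure N ⊆ closedBall 0 1 := by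
    apply closure_minimal _ isClosed_closedBall
    rw [hN]
    rintro _ ⟨z, hz, rfl⟩
    simpa using (hlt z hz).le
  have hNo : IsOpen N := by
    have : N = (fun z => -z) ⁻¹' (h '' Ω) := by
      rw [hN]; ext w; constructor
      · rintro ⟨z, hz, rfl⟩; exact ⟨z, hz, by simp⟩
      · rintro ⟨z, hz, hw⟩; exact ⟨z, hz, by simp [hw]⟩
    rw [this]; exact hop.preimage continuous_neg
  obtain ⟨x, hx⟩ : (frontier N).Nonempty := by
    apply nonempty_frontier_iff.mpr
    refine ⟨by rw [hN]; exact ⟨_, 0, hΩ.zero, rfl⟩, ?_⟩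
    intro hu
    have : (2:ℂ) ∈ closedBall (0:ℂ) 1 := hNcl (subset_closure (by rw [hu]; trivial))
    simp at this
  rw [hNo.frontier_eq] at hx
  have hxS : x ∈ S := by
    have : x ∈ closedBall (0:ℂ) 1 \ h '' Ω := ⟨hNcl hx.1, fun h' => (Set.disjoint_left.mp (hdis.closure_left hop)) hx.1 h'⟩
    rw [hU] at this
    exact this.resolve_right hx.2
  have h2 : IsPreconnected (insert x N) := hNc.subset_closure (subset_insert _ _) (insert_subset hx.1 subset_closure)
  have e : S ∪ N = S ∪ insert x N := by
    ext w; constructor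
    · rintro (h | h); exacts [Or.inl h, Or.inr (Or.inr h)]
    · rintro (h | rfl | h); exacts [Or.inl h, Or.inl hxS, Or.inr h]
  rw [hU, e]
  exact hS.union x hxS (mem_insert _ _) h2

lemma mob_compl {A : Set ℂ} {b : ℂ} (hb : ‖b‖ < 1) (hA : ∀ w ∈ A, ‖w‖ ≤ 1) (h : IsPreconnected (closedBall (0:ℂ) 1 \ A)) :
    IsPreconnected (closedBall (0:ℂ) 1 \ mob b '' A) := by
  have : closedBall (0:ℂ) 1 \ mob b '' A = mob b '' (closedBall (0:ℂ) 1 \ A) := by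
    apply Subset.antisymm
    · rintro w ⟨hw, hw'⟩
      have hw1 : ‖w‖ ≤ 1 := by simpa using hw
      refine ⟨mob (-b) w, ⟨by simpa using mob_le (by simpa using hb) hw1, fun h' => hw' ⟨_, h', mob_inv' hb hw1⟩⟩, mob_inv' hb hw1⟩
    · rintro _ ⟨u, ⟨hu, hu'⟩, rfl⟩
      have hu1 : ‖u‖ ≤ 1 := by simpa using hu
      refine ⟨by simpa using mob_le hb hu1, ?_⟩
      rintro ⟨u2, h2, h3⟩
      rw [mob_inj hb (hA _ h2) hu1 h3] at h2
      exact hu' h2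
  rw [this]
  exact h.image _ ((mob_cont hb).mono sdiff_subset)

lemma koebe_step {Ω : Set ℂ} (hΩ : Dom Ω) {a : ℂ} (ha : a ∈ closedBall (0:ℂ) 1 \ Ω) (ha1 : ‖a‖ < 1) :
    ∃ κ : ℂ → ℂ, DifferentiableOn ℂ κ Ω ∧ InjOn κ Ω ∧ κ 0 = 0 ∧ Dom (κ '' Ω) ∧ ‖deriv κ 0‖ * (2 * √‖a‖) = 1 + ‖a‖ := by
  have hn : ∀ z ∈ Ω, ‖z‖ < 1 := fun z hz => by simpa using (hΩ.sub hz)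
  have ha0 : a ≠ 0 := fun h => ha.2 (h ▸ hΩ.zero)
  obtain ⟨q, hq, hqe⟩ := sqrt_exists hΩ ha
  obtain ⟨l, hl, -, hle⟩ := exists_log (q := fun z => 1 - starRingEnd ℂ a * z) (c := 0) (r := 1) (by fun_prop) (by
    intro z hz
    exact mob_den ha1 (by simpa using (ball_subset_closedBall hz))) 0 (by simp)
  obtain ⟨h, hh⟩ : ∃ h : ℂ → ℂ, h = fun z => q z * Complex.exp (- l z / 2) := ⟨_, rfl⟩
  have hd : DifferentiableOn ℂ h Ω := by
    rw [hh]
    exact hq.fun_mul (((hl.mono hΩ.sub).fun_neg.div_const 2).cexp)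
  have hsq : ∀ z ∈ Ω, h z^2 = mob a z := by
    intro z hz
    have e : (Complex.exp (- l z / 2))^2 = (Complex.exp (l z))⁻¹ := by
      rw [← Complex.exp_nat_mul, ← Complex.exp_neg]; congr 1; push_cast; ring
    rw [hh]
    simp only [mul_pow]
    rw [hqe z hz, e, hle z (hΩ.sub hz), mob, div_eq_mul_inv]
  have hlt : ∀ z ∈ Ω, ‖h z‖ < 1 := by
    intro z hz
    have := mob_lt ha1 (hn z hz)
    rw [← hsq z hz, norm_pow] at this
    nlinarith [norm_nonneg (h z)]
  have hinj : InjOn h Ω := by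
    intro z hz w hw he
    exact mob_inj ha1 (hn z hz).le (hn w hw).le (by rw [← hsq z hz, ← hsq w hw, he])
  have hb := hlt 0 hΩ.zero
  have hb2 : h 0^2 = -a := by rw [hsq 0 hΩ.zero, mob_zero]
  have hbn : ‖h 0‖^2 = ‖a‖ := by rw [← norm_pow, hb2, norm_neg]
  have hkd : DifferentiableOn ℂ (fun z => mob (h 0) (h z)) Ω := (mob_diff hb).comp hd (fun z hz => by simpa using hlt z hz)
  have hki : InjOn (fun z => mob (h 0) (h z)) Ω := fun z hz w hw he => hinj hz hw (mob_inj hb (hlt z hz).le (hlt w hw).le he)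
  have him : (fun z => mob (h 0) (h z)) '' Ω = mob (h 0) '' (h '' Ω) := by rw [image_image]
  refine ⟨fun z => mob (h 0) (h z), hkd, hki, mob_self _, ⟨inj_isOpen hΩ.op hkd hki, hΩ.conn.image _ hkd.continuousOn, ?_, ⟨0, hΩ.zero, mob_self _⟩, ?_⟩, ?_⟩
  · rintro _ ⟨z, hz, rfl⟩
    simpa using mob_lt hb (hlt z hz)
  · rw [him]
    refine mob_compl hb ?_ (koebe_compl hΩ ha ha1 (inj_isOpen hΩ.op hd hinj) hd.continuousOn hsq hlt)
    rintro _ ⟨z, hz, rfl⟩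
    exact (hlt z hz).le
  · have hnh := hΩ.op.mem_nhds hΩ.zero
    have hhd := (hd.differentiableAt hnh).hasDerivAt
    have h1 := (hhd.fun_pow 2).unique ((mob_deriv (z := 0) ha1 (by simp)).congr_of_eventuallyEq (by
      filter_upwards [hnh] with z hz using hsq z hz))
    have h2 := ((mob_deriv (z := h 0) hb hb.le).comp 0 hhd).deriv
    have h2' : deriv (fun z => mob (h 0) (h z)) 0 = (1 - (starRingEnd ℂ) (h 0) * h 0) / (1 - (starRingEnd ℂ) (h 0) * h 0) ^ 2 * deriv h 0 := h2
    rw [conj_mul_norm] at h2' h1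
    have hba : √‖a‖ = ‖h 0‖ := by rw [← hbn]; exact Real.sqrt_sq (norm_nonneg _)
    rw [hba, h2', ← hbn]
    have e1 : 1 - ((‖h 0‖^2 : ℝ):ℂ) = ((1 - ‖h 0‖^2 : ℝ):ℂ) := by push_cast; ring
    have e2 : 1 - ((‖a‖^2 : ℝ):ℂ) = ((1 - ‖a‖^2 : ℝ):ℂ) := by push_cast; ring
    have hp : 0 < 1 - ‖h 0‖^2 := by nlinarith [norm_nonneg (h 0)]
    have hp2 : 0 < 1 - ‖a‖^2 := by nlinarith [norm_nonneg a]
    rw [e2] at h1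
    have h3 := congrArg norm h1
    simp only [norm_mul, norm_div, norm_pow, Complex.norm_real, Real.norm_of_nonneg hp2.le, mul_zero, sub_zero, norm_one] at h3
    rw [e1, norm_mul, norm_div, norm_pow, Complex.norm_real, Real.norm_of_nonneg hp.le]
    have h4 : 2 * ‖h 0‖ * ‖deriv h 0‖ = 1 - ‖a‖^2 := by simpa using h3
    rw [← hbn] at h4
    field_simp
    linear_combination h4

end DB


namespace DB
open scoped Topology
open Filter

/-- locally uniform convergence data -/
def LUC {ι : Type*} (U : Filter ι) (F : ι → ℂ → ℂ) (f : ℂ → ℂ) (W : Set ℂ) : Prop :=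
  ∀ z ∈ W, ∃ r > 0, (∀ᶠ i in U, DifferentiableOn ℂ (F i) (ball z r)) ∧
      (DifferentiableOn ℂ f (ball z r)) ∧ TendstoUniformlyOn F f U (ball z r)

lemma LUC.diff {ι : Type*} {U : Filter ι} {F : ι → ℂ → ℂ} {f : ℂ → ℂ} {W : Set ℂ} (h : LUC U F f W) : DifferentiableOn ℂ f W := by
  intro z hz
  obtain ⟨r, hr, -, h2, -⟩ := h z hz
  exact (h2.differentiableAt (ball_mem_nhds z hr)).differentiableWithinAt

lemma LUC.tendsto {ι : Type*} {U : Filter ι} {F : ι → ℂ → ℂ} {f : ℂ → ℂ} {W : Set ℂ} (h : LUC U F f W) {z : ℂ} (hz : z ∈ W) :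
    Tendsto (fun i => F i z) U (𝓝 (f z)) := by
  obtain ⟨r, hr, -, -, h3⟩ := h z hz
  exact h3.tendsto_at (mem_ball_self hr)

lemma LUC.comp {ι : Type*} {U : Filter ι} {F : ι → ℂ → ℂ} {f : ℂ → ℂ} {W : Set ℂ} (h : LUC U F f W) {z : ℂ} (hz : z ∈ W)
    {g : ι → ℂ} (hg : Tendsto g U (𝓝 z)) : Tendsto (fun i => F i (g i)) U (𝓝 (f z)) := by
  obtain ⟨r, hr, -, h2, h3⟩ := h z hz
  refine tendsto_comp_of_locally_uniform_limit (h2.differentiableAt (ball_mem_nhds z hr)).continuousAt hg ?_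
  intro u hu
  exact ⟨ball z r, ball_mem_nhds z hr, h3 u hu⟩

lemma LUC.deriv {ι : Type*} {U : Filter ι} [U.NeBot] {F : ι → ℂ → ℂ} {f : ℂ → ℂ} {W : Set ℂ} (h : LUC U F f W) {z : ℂ} (hz : z ∈ W) :
    Tendsto (fun i => deriv (F i) z) U (𝓝 (deriv f z)) := by
  obtain ⟨r, hr, h1, h2, h3⟩ := h z hz
  exact (h3.tendstoLocallyUniformlyOn.deriv h1 isOpen_ball).tendsto_at (mem_ball_self hr)

lemma LUC.avoid {ι : Type*} {U : Filter ι} [U.NeBot] {F : ι → ℂ → ℂ} {f : ℂ → ℂ} {W : Set ℂ} (h : LUC U F f W) (hW : IsOpen W) (hWc : IsPreconnected W)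
    {c : ι → ℂ} {c0 : ℂ} (hc : Tendsto c U (𝓝 c0)) (hav : ∀ z ∈ W, ∃ r > 0, ∀ᶠ i in U, ∀ x ∈ ball z r, F i x ≠ c i)
    {z : ℂ} (hz : z ∈ W) (hfz : f z = c0) : ∀ x ∈ W, f x = c0 := by
  obtain ⟨r, hr, h1, h2, h3⟩ := h z hz
  obtain ⟨r', hr', h4⟩ := hav z hz
  apply const_of_ev hW hWc h.diff hz
  have hs1 : ball z (min r r') ⊆ ball z r := ball_subset_ball (min_le_left _ _)
  have hs2 : ball z (min r r') ⊆ ball z r' := ball_subset_ball (min_le_right _ _)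
  have := hurwitz (F := fun i x => F i x - c i) (f := fun x => f x - c0) (U := U) (z := z) (r := min r r') (by positivity) (by
    filter_upwards [h1, h4] with i hi1 hi2
    exact ⟨(hi1.mono hs1).sub_const _, fun x hx => sub_ne_zero.mpr (hi2 x (hs2 hx))⟩) (by
    have hcu : TendstoUniformlyOn (fun i (_ : ℂ) => c i) (fun _ => c0) U (ball z (min r r')) := by
      intro u hu
      have := hc (UniformSpace.ball_mem_nhds c0 hu)
      filter_upwards [this] with i hi x hx using hi
    exact (h3.mono hs1).sub hcu) ((h2.mono hs1).sub_const _) (by simp [hfz])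
  filter_upwards [this] with x hx using sub_eq_zero.mp hx

lemma strict_of_le {f : ℂ → ℂ} {W : Set ℂ} {M : ℝ} (hW : IsOpen W) (hWc : IsPreconnected W) (hf : DifferentiableOn ℂ f W) {z0 : ℂ} (h0 : z0 ∈ W) (hz0 : ‖f z0‖ < M)
    (hle : ∀ z ∈ W, ‖f z‖ ≤ M) : ∀ z ∈ W, ‖f z‖ < M := by
  intro z hz
  refine lt_of_le_of_ne (hle z hz) fun he => ?_
  have := Complex.norm_eqOn_of_isPreconnected_of_isMaxOn hWc hW hf hz (by
    intro x hx
    simp only [Function.comp, Set.mem_ofPred_eq]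
    rw [he]; exact hle x hx) h0
  simp only [Function.comp, Function.const] at this
  linarith

theorem rmt {Ω : Set ℂ} (hΩ : Dom Ω) : ∃ f φ : ℂ → ℂ, DifferentiableOn ℂ f (ball 0 1) ∧ DifferentiableOn ℂ φ Ω ∧ MapsTo f (ball 0 1) Ω ∧
    MapsTo φ Ω (ball 0 1) ∧ (∀ z ∈ Ω, f (φ z) = z) ∧ (∀ z ∈ ball (0:ℂ) 1, φ (f z) = z) ∧ f 0 = 0 := by
  obtain ⟨S, hS⟩ : ∃ S : Set (ℂ → ℂ), S = {φ | DifferentiableOn ℂ φ Ω ∧ InjOn φ Ω ∧ φ 0 = 0 ∧ Dom (φ '' Ω)} := ⟨_, rfl⟩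
  obtain ⟨r0, hr0, hr0s⟩ := Metric.isOpen_iff.mp hΩ.op 0 hΩ.zero
  have hnh := hΩ.op.mem_nhds hΩ.zero
  have hbd : ∀ φ ∈ S, ‖deriv φ 0‖ ≤ 1 / (r0/2) := by
    intro φ hφ
    rw [hS] at hφ
    have hcb : closedBall (0:ℂ) (r0/2) ⊆ Ω := (closedBall_subset_ball (by linarith)).trans hr0s
    apply Complex.norm_deriv_le_of_forall_mem_sphere_norm_le (by linarith)
    · refine DifferentiableOn.diffContOnCl ?_
      rw [closure_ball _ (by linarith)]
      exact hφ.1.mono hcb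
    · intro z hz
      have := hφ.2.2.2.sub ⟨z, hcb (sphere_subset_closedBall hz), rfl⟩
      simpa using (ball_subset_closedBall this)
  have hid : (fun z => z) ∈ S := by
    rw [hS]
    refine ⟨differentiableOn_id, injOn_id _, rfl, ?_⟩
    rwa [image_id']
  obtain ⟨m, hm⟩ : ∃ m : ℝ, m = sSup ((fun φ : ℂ → ℂ => ‖deriv φ 0‖) '' S) := ⟨_, rfl⟩
  have hba : BddAbove ((fun φ : ℂ → ℂ => ‖deriv φ 0‖) '' S) := ⟨1/(r0/2), by rintro _ ⟨φ, hφ, rfl⟩; exact hbd φ hφ⟩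
  have hle : ∀ φ ∈ S, ‖deriv φ 0‖ ≤ m := fun φ hφ => by rw [hm]; exact le_csSup hba ⟨φ, hφ, rfl⟩
  have hm1 : 1 ≤ m := by simpa using hle _ hid
  have hk : ∀ k : ℕ, ∃ φ ∈ S, m - 1/((k:ℝ)+1) < ‖deriv φ 0‖ := by
    intro k
    have : m - 1/((k:ℝ)+1) < sSup ((fun φ : ℂ → ℂ => ‖deriv φ 0‖) '' S) := by
      rw [← hm]; have : 0 < 1/((k:ℝ)+1) := by positivity
      linarith
    obtain ⟨_, ⟨φ, hφ, rfl⟩, h⟩ := exists_lt_of_lt_csSup (Set.Nonempty.image _ ⟨_, hid⟩) this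
    exact ⟨φ, hφ, h⟩
  choose φ hφS hφm using hk
  have hφ : ∀ k, DifferentiableOn ℂ (φ k) Ω ∧ InjOn (φ k) Ω ∧ φ k 0 = 0 ∧ Dom (φ k '' Ω) := by
    intro k; have := hφS k; rw [hS] at this; exact this
  have hcov : ∀ ρ : ℝ, 0 < ρ → ρ < 1 → ∀ᶠ k : ℕ in atTop, ball (0:ℂ) ρ ⊆ φ k '' Ω := by
    intro ρ hρ0 hρ
    have hs1 : √ρ < 1 := by rw [Real.sqrt_lt' one_pos]; simpa using hρ
    obtain ⟨c, hc⟩ : ∃ c : ℝ, c = (1 - √ρ)^2/2 := ⟨_, rfl⟩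
    have hcp : 0 < c := by rw [hc]; have : 0 < 1 - √ρ := by linarith
                           positivity
    have ht : Tendsto (fun k : ℕ => (m - 1/((k:ℝ)+1)) * (1 + c)) atTop (𝓝 ((m - 0) * (1+c))) :=
      (tendsto_const_nhds.sub (tendsto_one_div_add_atTop_nhds_zero_nat (𝕜 := ℝ))).mul_const _
    have hlt : m < (m - 0) * (1+c) := by nlinarith
    filter_upwards [ht.eventually (lt_mem_nhds hlt)] with k hk a ha
    by_contra hna
    have ha' : ‖a‖ < ρ := by simpa using ha
    obtain ⟨κ, hκ1, hκ2, hκ3, hκ4, hκ5⟩ := koebe_step (hφ k).2.2.2 (a := a) ⟨by simp; linarith, hna⟩ (by linarith)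
    have hmem : (fun z => κ (φ k z)) ∈ S := by
      rw [hS]
      refine ⟨hκ1.comp (hφ k).1 (mapsTo_image _ _), ?_, by simp [(hφ k).2.2.1, hκ3], ?_⟩
      · intro z hz w hw he
        exact (hφ k).2.1 hz hw (hκ2 ⟨z, hz, rfl⟩ ⟨w, hw, rfl⟩ he)
      · rw [← image_image (g := κ) (f := φ k)]; exact hκ4
    have h1 := hle _ hmem
    have hd : deriv (fun z => κ (φ k z)) 0 = deriv κ 0 * deriv (φ k) 0 := by
      have hd1 : DifferentiableAt ℂ κ (φ k 0) := hκ1.differentiableAt ((hφ k).2.2.2.op.mem_nhds ⟨0, hΩ.zero, rfl⟩)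
      have hd2 : DifferentiableAt ℂ (φ k) 0 := (hφ k).1.differentiableAt hnh
      have := deriv_comp 0 hd1 hd2
      rw [(hφ k).2.2.1] at this
      exact this
    rw [hd, norm_mul] at h1
    have hb0 : 0 < √‖a‖ := by
      apply Real.sqrt_pos.mpr
      rw [norm_pos_iff]
      rintro rfl
      exact hna (hφ k).2.2.2.zero
    have hb1 : √‖a‖ ≤ √ρ := Real.sqrt_le_sqrt ha'.le
    have hb2 : √‖a‖^2 = ‖a‖ := Real.sq_sqrt (norm_nonneg a)
    rw [← hb2] at hκ5
    rw [Real.sqrt_sq hb0.le] at hκ5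
    generalize √‖a‖ = b at *
    have h2 : 1 + c ≤ ‖deriv κ 0‖ := by
      by_contra hcon
      push Not at hcon
      have h3 : (1 + c) * (2 * b) > 1 + b^2 := by
        rw [← hκ5]; exact mul_lt_mul_of_pos_right hcon (by linarith)
      have h4 : 2 * c ≤ (1 - b)^2 := by rw [hc]; nlinarith
      nlinarith
    have h3 := hφm k
    have h4 : 0 ≤ ‖deriv (φ k) 0‖ := norm_nonneg _
    nlinarith
  have hlinv : ∀ k, ∀ z ∈ Ω, Function.invFunOn (φ k) Ω (φ k z) = z := fun k z hz => (hφ k).2.1.leftInvOn_invFunOn hz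
  have hψd : ∀ k, DifferentiableOn ℂ (Function.invFunOn (φ k) Ω) (φ k '' Ω) := fun k => inj_inv hΩ.op (hφ k).1 (hφ k).2.1 (hlinv k)
  obtain ⟨ψ, hψ⟩ : ∃ ψ : ℕ → ℂ → ℂ, ψ = fun k => Function.invFunOn (φ k) Ω := ⟨_, rfl⟩
  have hψ1 : ∀ k, ∀ z ∈ Ω, ψ k (φ k z) = z := by rw [hψ]; exact hlinv
  have hψ2 : ∀ k, DifferentiableOn ℂ (ψ k) (φ k '' Ω) := by rw [hψ]; exact hψd
  have hψ3 : ∀ k, ∀ w ∈ φ k '' Ω, ψ k w ∈ Ω ∧ φ k (ψ k w) = w := by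
    rintro k _ ⟨z, hz, rfl⟩
    rw [hψ1 k z hz]; exact ⟨hz, rfl⟩
  have hcov' : ∀ z ∈ ball (0:ℂ) 1, ∃ r > 0, ∀ᶠ k in (hyperfilter ℕ : Filter ℕ), ball z r ⊆ φ k '' Ω := by
    intro z hz
    have hz1 : ‖z‖ < 1 := by simpa using hz
    refine ⟨(1 - ‖z‖)/2, by linarith, ?_⟩
    have := (hcov ((1 + ‖z‖)/2) (by positivity) (by linarith)).filter_mono Nat.hyperfilter_le_atTop
    filter_upwards [this] with k hk
    refine subset_trans ?_ hk
    apply ball_subset_ball'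
    rw [dist_zero_right]; linarith
  have hΩn : ∀ z ∈ Ω, ‖z‖ < 1 := fun z hz => by simpa using (hΩ.sub hz)
  have hφn : ∀ k, ∀ z ∈ Ω, ‖φ k z‖ < 1 := fun k z hz => by simpa using ((hφ k).2.2.2.sub ⟨z, hz, rfl⟩)
  obtain ⟨f, hf⟩ := montel (hyperfilter ℕ) ψ (ball 0 1) 1 (by
    intro z hz
    obtain ⟨r, hr, hev⟩ := hcov' z hz
    refine ⟨r, hr, ?_⟩
    filter_upwards [hev] with k hk
    exact ⟨(hψ2 k).mono hk, fun x hx => (hΩn _ (hψ3 k x (hk hx)).1).le⟩)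
  obtain ⟨F, hF⟩ := montel (hyperfilter ℕ) φ Ω 1 (by
    intro z hz
    obtain ⟨r, hr, hrs⟩ := Metric.isOpen_iff.mp hΩ.op z hz
    exact ⟨r, hr, Eventually.of_forall fun k => ⟨(hφ k).1.mono hrs, fun x hx => (hφn k x (hrs hx)).le⟩⟩)
  have hf' : LUC (hyperfilter ℕ : Filter ℕ) ψ f (ball 0 1) := hf
  have hF' : LUC (hyperfilter ℕ : Filter ℕ) φ F Ω := hF
  have hF0 : F 0 = 0 := by
    refine tendsto_nhds_unique (hF'.tendsto hΩ.zero) (tendsto_const_nhds.congr fun k => (hφ k).2.2.1.symm)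
  have hf0 : f 0 = 0 := by
    refine tendsto_nhds_unique (hf'.tendsto (by simp)) (tendsto_const_nhds.congr fun k => ?_)
    have := hψ1 k 0 hΩ.zero
    rw [(hφ k).2.2.1] at this
    exact this.symm
  have hFlt : ∀ z ∈ Ω, ‖F z‖ < 1 := by
    refine strict_of_le hΩ.op hΩ.conn hF'.diff hΩ.zero (by simp [hF0]) ?_
    intro z hz
    exact le_of_tendsto (hF'.tendsto hz).norm (Eventually.of_forall fun k => (hφn k z hz).le)
  have hfΩ : ∀ z ∈ ball (0:ℂ) 1, f z ∈ Ω := by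
    intro z hz
    by_contra hcon
    have := hf'.avoid isOpen_ball (convex_ball _ _).isPreconnected (c := fun _ => f z) (c0 := f z) tendsto_const_nhds (by
      intro y hy
      obtain ⟨r, hr, hev⟩ := hcov' y hy
      refine ⟨r, hr, ?_⟩
      filter_upwards [hev] with k hk x hx he
      exact hcon (he ▸ (hψ3 k x (hk hx)).1)) hz rfl 0 (by simp)
    rw [hf0] at this
    exact hcon (this ▸ hΩ.zero)
  refine ⟨f, F, hf'.diff, hF'.diff, hfΩ, fun z hz => by simpa using hFlt z hz, ?_, ?_, hf0⟩
  · intro z hz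
    have := hf'.comp (show F z ∈ ball (0:ℂ) 1 by simpa using hFlt z hz) (hF'.tendsto hz)
    exact tendsto_nhds_unique this (tendsto_const_nhds.congr fun k => (hψ1 k z hz).symm)
  · intro z hz
    have := hF'.comp (hfΩ z hz) (hf'.tendsto hz)
    refine tendsto_nhds_unique this (tendsto_const_nhds.congr' ?_)
    obtain ⟨r, hr, hev⟩ := hcov' z hz
    filter_upwards [hev] with k hk
    exact (hψ3 k z (hk (mem_ball_self hr))).2.symm

end DB


namespace DB
open scoped Topology
open Filter

/-- component of `0` in the disc minus `A` -/
def Om (A : Set ℂ) : Set ℂ := connectedComponentIn (ball 0 1 \ A) 0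

lemma Om_sub (A : Set ℂ) : Om A ⊆ ball 0 1 \ A := connectedComponentIn_subset _ _

lemma Om_dom {A : Set ℂ} (hA : IsCompact A) (hAb : A ⊆ closedBall 0 1) (hs : sphere (0:ℂ) 1 ⊆ A) (hAc : IsPreconnected A) (h0 : (0:ℂ) ∉ A) : Dom (Om A) := by
  have hB : IsOpen (ball (0:ℂ) 1 \ A) := isOpen_ball.sdiff hA.isClosed
  have h0B : (0:ℂ) ∈ ball (0:ℂ) 1 \ A := ⟨by simp, h0⟩
  refine ⟨hB.connectedComponentIn, isPreconnected_connectedComponentIn, fun z hz => (Om_sub A hz).1, mem_connectedComponentIn h0B, ?_⟩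
  have h1A : (1:ℂ) ∈ A := hs (by simp)
  have hAE : A ⊆ closedBall 0 1 \ Om A := fun z hz => ⟨hAb hz, fun h => (Om_sub A h).2 hz⟩
  apply isPreconnected_of_forall (1:ℂ)
  intro x hx
  by_cases hxA : x ∈ A
  · exact ⟨A, hAE, h1A, hxA, hAc⟩
  have hxB : x ∈ ball (0:ℂ) 1 \ A := by
    refine ⟨?_, hxA⟩
    by_contra h
    apply hxA (hs _)
    simp at h hx ⊢
    linarith [hx.1]
  obtain ⟨C, hC⟩ : ∃ C, C = connectedComponentIn (ball (0:ℂ) 1 \ A) x := ⟨_, rfl⟩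
  have hCB : C ⊆ ball (0:ℂ) 1 \ A := by rw [hC]; exact connectedComponentIn_subset _ _
  have hxC : x ∈ C := by rw [hC]; exact mem_connectedComponentIn hxB
  have hCo : IsOpen C := by rw [hC]; exact hB.connectedComponentIn
  have hCd : ∀ y ∈ C, y ∉ Om A := by
    intro y hy hyO
    rw [hC] at hy
    have e1 := connectedComponentIn_eq hy
    have e2 := connectedComponentIn_eq hyO
    apply hx.2
    change x ∈ connectedComponentIn _ _
    rw [e2, ← e1]; exact mem_connectedComponentIn hxB
  have hCcl : closure C ⊆ closedBall 0 1 := closure_minimal (fun y hy => ball_subset_closedBall (hCB hy).1) isClosed_closedBall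
  obtain ⟨y, hy⟩ : (frontier C).Nonempty := by
    apply nonempty_frontier_iff.mpr
    refine ⟨⟨x, hxC⟩, fun hu => ?_⟩
    have : (1:ℂ) ∈ C := by rw [hu]; trivial
    exact (hCB this).2 h1A
  rw [hCo.frontier_eq] at hy
  have hyA : y ∈ A := by
    by_contra hyA
    have hyB : y ∈ ball (0:ℂ) 1 \ A := by
      refine ⟨?_, hyA⟩
      by_contra h
      apply hyA (hs _)
      have := hCcl hy.1
      simp at h this ⊢
      linarith
    obtain ⟨w, hw1, hw2⟩ := mem_closure_iff.mp hy.1 _ (hB.connectedComponentIn (x := y)) (mem_connectedComponentIn hyB)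
    have e1 := connectedComponentIn_eq hw1
    rw [hC] at hw2
    have e2 := connectedComponentIn_eq hw2
    apply hy.2
    rw [hC, e2, ← e1]; exact mem_connectedComponentIn hyB
  refine ⟨A ∪ insert y C, ?_, Or.inl h1A, Or.inr (Or.inr hxC), ?_⟩
  · rintro w (h | rfl | h)
    · exact hAE h
    · exact hAE hyA
    · exact ⟨ball_subset_closedBall (hCB h).1, hCd w h⟩
  · have hCc : IsPreconnected C := by rw [hC]; exact isPreconnected_connectedComponentIn
    exact hAc.union y hyA (mem_insert _ _) (hCc.subset_closure (subset_insert _ _) (insert_subset hy.1 subset_closure))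

/-- Riemann map with its inverse -/
structure RM (Ω : Set ℂ) (f φ : ℂ → ℂ) (R : ℝ) : Prop where
  fd : DifferentiableOn ℂ f (ball 0 1)
  pd : DifferentiableOn ℂ φ Ω
  fm : MapsTo f (ball 0 1) Ω
  pm : MapsTo φ Ω (ball 0 1)
  fp : ∀ z ∈ Ω, f (φ z) = z
  pf : ∀ z ∈ ball (0:ℂ) 1, φ (f z) = z
  f0 : f 0 = 0
  fR : deriv f 0 = (R:ℂ)
  Rp : 0 < R

lemma RM.inj {Ω f φ R} (h : RM Ω f φ R) : InjOn f (ball 0 1) := by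
  intro z hz w hw he
  rw [← h.pf z hz, he, h.pf w hw]

lemma rmt' {Ω : Set ℂ} (hΩ : Dom Ω) : ∃ f φ R, RM Ω f φ R := by
  obtain ⟨f, φ, h1, h2, h3, h4, h5, h6, h7⟩ := rmt hΩ
  have hinj : InjOn f (ball 0 1) := by
    intro z hz w hw he
    rw [← h6 z hz, he, h6 w hw]
  have hne := inj_deriv_ne isOpen_ball h1 hinj (z := 0) (by simp)
  have hnn : (‖deriv f 0‖ : ℂ) ≠ 0 := by exact_mod_cast norm_ne_zero_iff.mpr hne
  obtain ⟨c, hc⟩ : ∃ c : ℂ, c = (‖deriv f 0‖ : ℂ) / deriv f 0 := ⟨_, rfl⟩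
  have hcn : ‖c‖ = 1 := by
    rw [hc, norm_div, Complex.norm_real, norm_norm, div_self (norm_ne_zero_iff.mpr hne)]
  have hc0 : c ≠ 0 := norm_ne_zero_iff.mp (by rw [hcn]; exact one_ne_zero)
  have hm : MapsTo (fun z => c * z) (ball (0:ℂ) 1) (ball 0 1) := by
    intro z hz
    simpa [hcn] using hz
  refine ⟨fun z => f (c * z), fun z => c⁻¹ * φ z, ‖deriv f 0‖, ?_⟩
  refine ⟨h1.comp (by fun_prop) hm, h2.const_mul _, fun z hz => h3 (hm hz), ?_, ?_, ?_, by simp [h7], ?_, norm_pos_iff.mpr hne⟩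
  · intro z hz
    have := h4 hz
    simp [hcn] at this ⊢
    exact this
  · intro z hz
    rw [mul_inv_cancel_left₀ hc0, h5 z hz]
  · intro z hz
    rw [h6 _ (hm hz), inv_mul_cancel_left₀ hc0]
  · have hd : HasDerivAt f (deriv f 0) (c * 0) := by
      rw [mul_zero]; exact (h1.differentiableAt (ball_mem_nhds 0 one_pos)).hasDerivAt
    have := (hd.comp 0 ((hasDerivAt_id (0:ℂ)).const_mul c)).deriv
    have e : deriv (fun z => f (c * z)) 0 = deriv f 0 * (c * 1) := this
    rw [e, hc]
    field_simp

/-- subordination of a map into the image of a Riemann map -/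
lemma RM.sub {Ω f φ R} (h : RM Ω f φ R) (hΩ : IsOpen Ω) {g : ℂ → ℂ} (hg : DifferentiableOn ℂ g (ball 0 1)) (hgm : MapsTo g (ball 0 1) Ω) (hg0 : g 0 = 0) :
    DifferentiableOn ℂ (fun z => φ (g z)) (ball 0 1) ∧ MapsTo (fun z => φ (g z)) (ball 0 1) (ball 0 1) ∧ φ (g 0) = 0 ∧
    (∀ z ∈ ball (0:ℂ) 1, f (φ (g z)) = g z) ∧ deriv g 0 = R * deriv (fun z => φ (g z)) 0 ∧ ‖deriv g 0‖ ≤ R := by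
  have hd : DifferentiableOn ℂ (fun z => φ (g z)) (ball 0 1) := h.pd.comp hg hgm
  have hm : MapsTo (fun z => φ (g z)) (ball 0 1) (ball 0 1) := fun z hz => h.pm (hgm hz)
  have h0 : φ (g 0) = 0 := by
    have := h.pf 0 (by simp)
    rw [h.f0] at this
    rw [hg0, this]
  have he : ∀ z ∈ ball (0:ℂ) 1, f (φ (g z)) = g z := fun z hz => h.fp _ (hgm hz)
  have hde : deriv g 0 = R * deriv (fun z => φ (g z)) 0 := by
    have h1 : HasDerivAt f (deriv f 0) (φ (g 0)) := by
      rw [h0]; exact (h.fd.differentiableAt (ball_mem_nhds 0 one_pos)).hasDerivAt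
    have h2 := h1.comp 0 (hd.differentiableAt (ball_mem_nhds 0 one_pos)).hasDerivAt
    rw [← h.fR, ← h2.deriv]
    apply Filter.EventuallyEq.deriv_eq
    filter_upwards [ball_mem_nhds (0:ℂ) one_pos] with z hz using (he z hz).symm
  refine ⟨hd, hm, h0, he, hde, ?_⟩
  have := Complex.norm_deriv_le_one_of_mapsTo_ball hd (by rw [h0]; exact hm.mono_right ball_subset_closedBall) one_pos
  rw [hde, norm_mul, Complex.norm_real, Real.norm_of_nonneg h.Rp.le]
  nlinarith [h.Rp]

end DB


namespace DB
open scoped Topology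
open Filter

/-- hypotheses on the curve -/
structure Cv (Γ : ℝ → ℂ) : Prop where
  co : Continuous Γ
  ne : ∀ x ∈ Icc (0:ℝ) 2, Γ x ≠ 0
  le : ∀ x ∈ Icc (0:ℝ) 2, ‖Γ x‖ ≤ 1
  en : ‖Γ 2‖ = 1

def CA (Γ : ℝ → ℂ) (u : ℝ) : Set ℂ := Γ '' Icc u 2 ∪ sphere 0 1

lemma sphere_pre : IsPreconnected (sphere (0:ℂ) 1) := by
  apply isPreconnected_sphere
  rw [Complex.rank_real_complex]
  exact Cardinal.one_lt_two

lemma CA_dom {Γ : ℝ → ℂ} (h : Cv Γ) {u : ℝ} (hu : u ∈ Icc (0:ℝ) 2) : Dom (Om (CA Γ u)) := by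
  have hsub : Icc u 2 ⊆ Icc (0:ℝ) 2 := Icc_subset_Icc_left hu.1
  apply Om_dom
  · exact (isCompact_Icc.image h.co).union (isCompact_sphere _ _)
  · rintro z (⟨x, hx, rfl⟩ | hz)
    · simpa using h.le x (hsub hx)
    · exact sphere_subset_closedBall hz
  · exact subset_union_right
  · refine (isPreconnected_Icc.image _ h.co.continuousOn).union (Γ 2) ⟨2, ⟨hu.2, le_rfl⟩, rfl⟩ (by simpa using h.en) sphere_pre
  · rintro (⟨x, hx, hx0⟩ | hz)
    · exact h.ne x (hsub hx) hx0
    · simp at hz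

lemma CA_mono {Γ : ℝ → ℂ} {u v : ℝ} (huv : u ≤ v) : Om (CA Γ u) ⊆ Om (CA Γ v) := by
  apply connectedComponentIn_mono
  apply sdiff_subset_sdiff_right
  exact union_subset_union_left _ (image_mono (Icc_subset_Icc_left huv))

lemma CA_two {Γ : ℝ → ℂ} (h : Cv Γ) : Om (CA Γ 2) = ball 0 1 := by
  have : ball (0:ℂ) 1 \ CA Γ 2 = ball 0 1 := by
    rw [sdiff_eq_left, Set.disjoint_left]
    rintro z hz (⟨x, hx, rfl⟩ | h')
    · have : x = 2 := le_antisymm hx.2 hx.1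
      rw [this] at hz
      simp [h.en] at hz
    · simp at hz h'; linarith
  rw [Om, this]
  exact ((convex_ball _ _).isPreconnected.connectedComponentIn (by simp))

/-- if preconnected set avoids then it is inside -/
lemma in_Om {A C : Set ℂ} (hC : IsPreconnected C) (h0 : (0:ℂ) ∈ C) (hb : C ⊆ ball 0 1) (hd : ∀ z ∈ C, z ∉ A) : C ⊆ Om A :=
  hC.subset_connectedComponentIn h0 (fun z hz => ⟨hb hz, hd z hz⟩)

lemma R_cont {Γ : ℝ → ℂ} (h : Cv Γ) {f φ : ℝ → ℂ → ℂ} {R : ℝ → ℝ} (hR : ∀ u ∈ Icc (0:ℝ) 2, RM (Om (CA Γ u)) (f u) (φ u) (R u)) :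
    ContinuousOn R (Icc 0 2) := by
  intro u hu
  change Tendsto R _ _
  rw [tendsto_iff_ultrafilter]
  intro V hV
  have hVm : ∀ᶠ v in (V : Filter ℝ), v ∈ Icc (0:ℝ) 2 := hV self_mem_nhdsWithin
  have hVt : Tendsto (fun v : ℝ => v) V (𝓝 u) := hV.trans nhdsWithin_le_nhds
  have hfn : ∀ v ∈ Icc (0:ℝ) 2, ∀ z ∈ ball (0:ℂ) 1, ‖f v z‖ < 1 := by
    intro v hv z hz
    simpa using (CA_dom h hv).sub ((hR v hv).fm hz)
  have hin : ∀ z ∈ ball (0:ℂ) 1, ∃ r > 0, ball z r ⊆ ball (0:ℂ) 1 := fun z hz => Metric.isOpen_iff.mp isOpen_ball z hz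
  obtain ⟨g, hg⟩ := montel V f (ball 0 1) 1 (by
    intro z hz
    obtain ⟨r, hr, hrs⟩ := hin z hz
    refine ⟨r, hr, ?_⟩
    filter_upwards [hVm] with v hv
    exact ⟨(hR v hv).fd.mono hrs, fun x hx => (hfn v hv x (hrs hx)).le⟩)
  have hg' : LUC (V : Filter ℝ) f g (ball 0 1) := hg
  have hg0 : g 0 = 0 := by
    refine tendsto_nhds_unique (hg'.tendsto (by simp)) (tendsto_const_nhds.congr' ?_)
    filter_upwards [hVm] with v hv using (hR v hv).f0.symm
  have hgt : Tendsto R V (𝓝 (deriv g 0).re) := by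
    have := (Complex.continuous_re.tendsto _).comp (hg'.deriv (show (0:ℂ) ∈ ball (0:ℂ) 1 by simp))
    refine this.congr' ?_
    filter_upwards [hVm] with v hv
    simp [(hR v hv).fR]
  have hgn : ∀ z ∈ ball (0:ℂ) 1, ‖g z‖ < 1 := by
    refine strict_of_le isOpen_ball (convex_ball _ _).isPreconnected hg'.diff (z0 := 0) (by simp) (by simp [hg0]) ?_
    intro z hz
    refine le_of_tendsto (hg'.tendsto hz).norm ?_
    filter_upwards [hVm] with v hv using (hfn v hv z hz).le
  have hgm : MapsTo g (ball 0 1) (Om (CA Γ u)) := by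
    rw [mapsTo_iff_image_subset]
    refine in_Om ((convex_ball _ _).isPreconnected.image _ hg'.diff.continuousOn) ⟨0, by simp, hg0⟩ ?_ ?_
    · rintro _ ⟨z, hz, rfl⟩; simpa using hgn z hz
    · rintro _ ⟨z, hz, rfl⟩ hzA
      rcases hzA with ⟨x, hx, hxz⟩ | hz'
      · have hct : Tendsto (fun v => Γ (max x v)) V (𝓝 (Γ x)) := by
          have h1 : Tendsto (fun v => max x v) V (𝓝 (max x u)) := tendsto_const_nhds.max hVt
          rw [max_eq_left hx.1] at h1
          exact (h.co.tendsto x).comp h1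
        have := hg'.avoid isOpen_ball (convex_ball _ _).isPreconnected hct (by
          intro y hy
          obtain ⟨r, hr, hrs⟩ := hin y hy
          refine ⟨r, hr, ?_⟩
          filter_upwards [hVm] with v hv w hw he
          exact (Om_sub _ ((hR v hv).fm (hrs hw))).2 (Or.inl ⟨max x v, ⟨le_max_right _ _, max_le hx.2 hv.2⟩, he.symm⟩)) hz hxz.symm 0 (by simp)
        rw [hg0] at this
        exact h.ne x ⟨hu.1.trans hx.1, hx.2⟩ this.symm
      · have := hgn z hz
        simp at hz'
        linarith
  have h1 : (deriv g 0).re ≤ R u := by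
    have := ((hR u hu).sub (CA_dom h hu).op hg'.diff hgm hg0).2.2.2.2.2
    exact (Complex.re_le_norm _).trans this
  have h2 : ∀ ρ : ℝ, 0 < ρ → ρ < 1 → ρ * R u ≤ (deriv g 0).re := by
    intro ρ hρ0 hρ
    have hcb : closedBall (0:ℂ) ρ ⊆ ball 0 1 := closedBall_subset_ball hρ
    have hCc : IsCompact (f u '' closedBall 0 ρ) := (isCompact_closedBall _ _).image_of_continuousOn ((hR u hu).fd.continuousOn.mono hcb)
    have hdis : Disjoint (f u '' closedBall 0 ρ) (Γ '' Icc u 2) := by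
      rw [Set.disjoint_left]
      rintro _ ⟨z, hz, rfl⟩ h'
      exact (Om_sub _ ((hR u hu).fm (hcb hz))).2 (Or.inl h')
    obtain ⟨δ, hδ, hδ2⟩ := (isCompact_Icc.image h.co).exists_thickening_subset_open hCc.isClosed.isOpen_compl (Set.subset_compl_iff_disjoint_left.mpr hdis)
    have huc := isCompact_Icc.uniformContinuousOn_of_continuous (s := Icc (0:ℝ) 2) h.co.continuousOn
    obtain ⟨ε, hε, hε2⟩ := Metric.uniformContinuousOn_iff.mp huc δ hδ
    refine ge_of_tendsto hgt ?_
    filter_upwards [hVm, hVt (Metric.ball_mem_nhds u hε)] with v hv hvu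
    have hm : f u '' closedBall 0 ρ ⊆ Om (CA Γ v) := by
      refine in_Om ((convex_closedBall _ _).isPreconnected.image _ ((hR u hu).fd.continuousOn.mono hcb)) ⟨0, by simp [hρ0.le], (hR u hu).f0⟩ ?_ ?_
      · rintro _ ⟨z, hz, rfl⟩; simpa using hfn u hu z (hcb hz)
      · rintro w hw (⟨x, hx, hxw⟩ | hw')
        · have hx0 : x ∈ Icc (0:ℝ) 2 := ⟨hv.1.trans hx.1, hx.2⟩
          have hmx : max x u ∈ Icc u 2 := ⟨le_max_right _ _, max_le hx.2 hu.2⟩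
          have hd : dist x (max x u) < ε := by
            rcases le_total x u with hxu | hxu
            · rw [max_eq_right hxu, Real.dist_eq, abs_lt]
              rw [mem_ball, Real.dist_eq, abs_lt] at hvu
              constructor <;> linarith [hx.1]
            · rw [max_eq_left hxu, dist_self]; exact hε
          have := hε2 x hx0 (max x u) ⟨hu.1.trans hmx.1, hmx.2⟩ hd
          have h3 : Γ x ∈ thickening δ (Γ '' Icc u 2) := mem_thickening_iff.mpr ⟨_, ⟨_, hmx, rfl⟩, this⟩
          exact hδ2 h3 (hxw ▸ hw)
        · obtain ⟨z, hz, rfl⟩ := hw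
          have := hfn u hu z (hcb hz)
          simp at hw'
          linarith
    have hsc : MapsTo (fun z => (ρ:ℂ) * z) (ball (0:ℂ) 1) (closedBall 0 ρ) := by
      intro z hz
      simp at hz ⊢
      rw [abs_of_pos hρ0]; nlinarith
    have h5 := ((hR v hv).sub (CA_dom h hv).op (g := fun z => f u (ρ * z)) ((hR u hu).fd.comp (by fun_prop) (fun z hz => hcb (hsc hz))) (fun z hz => hm ⟨_, hsc hz, rfl⟩) (by simp [(hR u hu).f0])).2.2.2.2.2
    have hd : HasDerivAt (f u) (R u) ((ρ:ℂ) * 0) := by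
      rw [mul_zero, ← (hR u hu).fR]; exact ((hR u hu).fd.differentiableAt (ball_mem_nhds 0 one_pos)).hasDerivAt
    have h6 := (hd.comp 0 ((hasDerivAt_id (0:ℂ)).const_mul (ρ:ℂ))).deriv
    have h7 : deriv (fun z => f u (ρ * z)) 0 = R u * (ρ * 1) := h6
    rw [h7, mul_one, norm_mul, Complex.norm_real, Complex.norm_real, Real.norm_of_nonneg hρ0.le, Real.norm_of_nonneg (hR u hu).Rp.le] at h5
    linarith
  have h3 : R u ≤ (deriv g 0).re := by
    have ht : Tendsto (fun ρ : ℝ => ρ * R u) (𝓝[<] 1) (𝓝 (1 * R u)) := (tendsto_id.mono_left nhdsWithin_le_nhds).mul_const _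
    rw [one_mul] at ht
    refine le_of_tendsto ht ?_
    filter_upwards [Ioo_mem_nhdsLT (show (0:ℝ) < 1 by norm_num)] with ρ hρ using h2 ρ hρ.1 hρ.2
  rw [le_antisymm h3 h1]
  exact hgt

end DB


namespace DB
open scoped Topology
open Filter

lemma exp_unique {A B : ℂ → ℂ} (hA : DifferentiableOn ℂ A (ball 0 1)) (hB : DifferentiableOn ℂ B (ball 0 1)) (h0 : A 0 = B 0)
    (he : ∀ z ∈ ball (0:ℂ) 1, Complex.exp (A z) = Complex.exp (B z)) : ∀ z ∈ ball (0:ℂ) 1, A z = B z := by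
  refine isOpen_ball.eqOn_of_deriv_eq (convex_ball _ _).isPreconnected hA hB ?_ (x := 0) (by simp) h0
  intro z hz
  have hn := isOpen_ball.mem_nhds hz
  have h1 := (hA.differentiableAt hn).hasDerivAt.cexp
  have h2 := (hB.differentiableAt hn).hasDerivAt.cexp
  have h3 := h1.unique (h2.congr_of_eventuallyEq (by filter_upwards [hn] with w hw using he w hw))
  rw [he z hz] at h3
  exact mul_left_cancel₀ (Complex.exp_ne_zero _) h3

lemma dslope_ne {f : ℂ → ℂ} (hf : DifferentiableOn ℂ f (ball 0 1)) (hi : InjOn f (ball 0 1)) (h0 : f 0 = 0) : ∀ z ∈ ball (0:ℂ) 1, dslope f 0 z ≠ 0 := by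
  intro z hz
  by_cases hz0 : z = 0
  · rw [hz0, dslope_same]
    exact inj_deriv_ne isOpen_ball hf hi (by simp)
  · rw [dslope_of_ne _ hz0, slope_def_field, h0]
    intro h
    have : f z = 0 := by
      rcases div_eq_zero_iff.mp h with h | h
      · simpa using h
      · simp [hz0] at h
    exact hz0 (hi hz (by simp) (this.trans h0.symm))

lemma chain_milin {Γ : ℝ → ℂ} (h : Cv Γ) {g : ℂ → ℂ} {b : ℝ} (hb : 0 < b) (hg : DifferentiableOn ℂ g (ball 0 1)) (hgi : InjOn g (ball 0 1))
    (hg0 : g 0 = 0) (hgb : deriv g 0 = (b:ℂ)) (himg : g '' ball 0 1 = Om (CA Γ 0)) :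
    ∃ L : ℂ → ℂ, DifferentiableOn ℂ L (ball 0 1) ∧ L 0 = 0 ∧ (∀ z ∈ ball (0:ℂ) 1, g z = z * (b * Complex.exp (L z))) ∧
      ∀ n : ℕ, ∑ k ∈ Finset.Icc 1 n, ((n:ℝ)+1-k)*(k*‖co L k‖^2 - 4/k) ≤ 0 := by
  have hex : ∀ u : ℝ, ∃ (f φ : ℂ → ℂ) (R : ℝ), u ∈ Icc (0:ℝ) 2 → RM (Om (CA Γ u)) f φ R ∧ (u = 0 → f = g ∧ R = b) ∧ (u = 2 → R = 1) := by
    intro u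
    by_cases hu : u ∈ Icc (0:ℝ) 2
    · by_cases hu0 : u = 0
      · refine ⟨g, Function.invFunOn g (ball 0 1), b, fun _ => ⟨?_, fun _ => ⟨rfl, rfl⟩, fun h => by rw [hu0] at h; norm_num at h⟩⟩
        have hl : ∀ z ∈ ball (0:ℂ) 1, Function.invFunOn g (ball 0 1) (g z) = z := fun z hz => hgi.leftInvOn_invFunOn hz
        rw [hu0, ← himg]
        refine ⟨hg, inj_inv isOpen_ball hg hgi hl, mapsTo_image _ _, ?_, ?_, hl, hg0, hgb, hb⟩
        · rintro _ ⟨z, hz, rfl⟩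
          rw [hl z hz]; exact hz
        · rintro _ ⟨z, hz, rfl⟩
          rw [hl z hz]
      · by_cases hu2 : u = 2
        · refine ⟨fun z => z, fun z => z, 1, fun _ => ⟨?_, fun h => absurd h hu0, fun _ => rfl⟩⟩
          rw [hu2, CA_two h]
          exact ⟨differentiableOn_id, differentiableOn_id, mapsTo_id _, mapsTo_id _, fun _ _ => rfl, fun _ _ => rfl, rfl, by simp, one_pos⟩
        · obtain ⟨f, φ, R, hR⟩ := rmt' (CA_dom h hu)
          exact ⟨f, φ, R, fun _ => ⟨hR, fun h => absurd h hu0, fun h => absurd h hu2⟩⟩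
    · exact ⟨id, id, 0, fun h => absurd h hu⟩
  choose f φ R hfR using hex
  have hR : ∀ u ∈ Icc (0:ℝ) 2, RM (Om (CA Γ u)) (f u) (φ u) (R u) := fun u hu => (hfR u hu).1
  have h0m : (0:ℝ) ∈ Icc (0:ℝ) 2 := by simp
  have h2m : (2:ℝ) ∈ Icc (0:ℝ) 2 := by simp
  have hR0 : R 0 = b := ((hfR 0 h0m).2.1 rfl).2
  have hf0 : f 0 = g := ((hfR 0 h0m).2.1 rfl).1
  have hR2 : R 2 = 1 := (hfR 2 h2m).2.2 rfl
  have hmm : ∀ u ∈ Icc (0:ℝ) 2, ∀ v ∈ Icc (0:ℝ) 2, u ≤ v → MapsTo (f u) (ball 0 1) (Om (CA Γ v)) := fun u hu v hv huv z hz => CA_mono huv ((hR u hu).fm hz)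
  have hmono : ∀ u ∈ Icc (0:ℝ) 2, ∀ v ∈ Icc (0:ℝ) 2, u ≤ v → R u ≤ R v := by
    intro u hu v hv huv
    have := ((hR v hv).sub (CA_dom h hv).op (hR u hu).fd (hmm u hu v hv huv) (hR u hu).f0).2.2.2.2.2
    rwa [(hR u hu).fR, Complex.norm_real, Real.norm_of_nonneg (hR u hu).Rp.le] at this
  have hb1 : b ≤ 1 := by rw [← hR0, ← hR2]; exact hmono 0 h0m 2 h2m (by norm_num)
  obtain ⟨T, hTd⟩ : ∃ T, T = - Real.log b := ⟨_, rfl⟩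
  have hT : 0 ≤ T := by rw [hTd]; have := Real.log_nonpos hb.le hb1; linarith
  have hTe : Real.exp T = 1 / b := by rw [hTd, Real.exp_neg, Real.exp_log hb, one_div]
  have hu : ∀ t : ℝ, ∃ u : ℝ, t ∈ Icc 0 T → u ∈ Icc (0:ℝ) 2 ∧ R u = b * Real.exp t ∧ (t = 0 → u = 0) := by
    intro t
    by_cases ht : t ∈ Icc 0 T
    · by_cases ht0 : t = 0
      · exact ⟨0, fun _ => ⟨h0m, by rw [hR0, ht0]; simp, fun _ => rfl⟩⟩
      · have := intermediate_value_Icc (show (0:ℝ) ≤ 2 by norm_num) (R_cont h hR)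
        have h1 : b * Real.exp t ∈ Icc (R 0) (R 2) := by
          rw [hR0, hR2]
          constructor
          · have := Real.one_le_exp ht.1
            nlinarith
          · have := Real.exp_le_exp.mpr ht.2
            rw [hTe] at this
            calc b * Real.exp t ≤ b * (1/b) := by gcongr
              _ = 1 := by field_simp
        obtain ⟨u, hu1, hu2⟩ := this h1
        exact ⟨u, fun _ => ⟨hu1, hu2, fun h => absurd h ht0⟩⟩
    · exact ⟨0, fun h => absurd h ht⟩
  choose u hu using hu
  have hbc : (b:ℂ) ≠ 0 := by exact_mod_cast hb.ne'
  have hLex : ∀ t : ℝ, ∃ L : ℂ → ℂ, t ∈ Icc 0 T → DifferentiableOn ℂ L (ball 0 1) ∧ L 0 = (t:ℂ) ∧ ∀ z ∈ ball (0:ℂ) 1, Complex.exp (L z) = dslope (f (u t)) 0 z / b := by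
    intro t
    by_cases ht : t ∈ Icc 0 T
    · have hr := hR _ (hu t ht).1
      obtain ⟨L, hL1, hL2, hL3⟩ := exists_log (q := fun z => dslope (f (u t)) 0 z / b) (c := 0) (r := 1)
        ((dslope_diff one_pos hr.fd).div_const _) (fun z hz => div_ne_zero (dslope_ne hr.fd hr.inj hr.f0 z hz) hbc) (t:ℂ) (by
          simp only [dslope_same]
          rw [hr.fR, (hu t ht).2.1]
          push_cast
          field_simp)
      exact ⟨L, fun _ => ⟨hL1, hL2, hL3⟩⟩
    · exact ⟨id, fun h => absurd h ht⟩
  choose L hL using hLex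
  have hfL : ∀ t ∈ Icc 0 T, ∀ z ∈ ball (0:ℂ) 1, f (u t) z = z * (b * Complex.exp (L t z)) := by
    intro t ht z hz
    rw [(hL t ht).2.2 z hz, mul_div_cancel₀ _ hbc]
    have := sub_smul_dslope (f (u t)) 0 z
    rw [(hR _ (hu t ht).1).f0] at this
    simpa using this.symm
  have h0T : (0:ℝ) ∈ Icc 0 T := ⟨le_rfl, hT⟩
  refine ⟨L 0, (hL 0 h0T).1, by rw [(hL 0 h0T).2.1]; simp, ?_, fun n => milin_of_chain T hT L (fun t ht => (hL t ht).1) (fun t ht => (hL t ht).2.1) ?_ ?_ n⟩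
  · intro z hz
    have := hfL 0 h0T z hz
    rwa [(hu 0 h0T).2.2 rfl, hf0] at this
  · intro t ht z hz
    have hr := hR _ (hu t ht).1
    have h1 := Complex.norm_dslope_le_div_of_mapsTo_ball (R₂ := 1) hr.fd (by
      rw [hr.f0]
      exact fun z hz => ball_subset_closedBall ((CA_dom h (hu t ht).1).sub (hr.fm hz))) hz
    rw [div_one] at h1
    have h2 : Real.exp (L t z).re = ‖dslope (f (u t)) 0 z‖ / b := by
      rw [← Complex.norm_exp, (hL t ht).2.2 z hz, norm_div, Complex.norm_real, Real.norm_of_nonneg hb.le]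
    apply Real.exp_le_exp.mp
    rw [h2, hTe]
    gcongr
  · intro s t hs hst htT
    have hsm : s ∈ Icc 0 T := ⟨hs, hst.trans htT⟩
    have htm : t ∈ Icc 0 T := ⟨hs.trans hst, htT⟩
    have hrs := hR _ (hu s hsm).1
    have hrt := hR _ (hu t htm).1
    have hust : u s ≤ u t := by
      rcases hst.eq_or_lt with rfl | hlt
      · exact le_rfl
      · by_contra hcon
        push Not at hcon
        have := hmono _ (hu t htm).1 _ (hu s hsm).1 hcon.le
        rw [(hu s hsm).2.1, (hu t htm).2.1] at this
        have h2 := Real.exp_lt_exp.mpr hlt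
        nlinarith
    obtain ⟨w1, w2, w3, w4, w5, -⟩ := hrt.sub (CA_dom h (hu t htm).1).op hrs.fd (hmm _ (hu s hsm).1 _ (hu t htm).1 hust) hrs.f0
    obtain ⟨w, hw⟩ : ∃ w : ℂ → ℂ, w = fun z => φ (u t) (f (u s) z) := ⟨_, rfl⟩
    have hw0 : w 0 = 0 := by rw [hw]; exact w3
    rw [← hw] at w1 w2 w5
    have w4' : ∀ z ∈ ball (0:ℂ) 1, f (u t) (w z) = f (u s) z := by rw [hw]; exact w4
    have hwi : InjOn w (ball 0 1) := by
      intro x hx y hy he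
      apply hrs.inj hx hy
      rw [← w4' x hx, ← w4' y hy, he]
    have hwd : deriv w 0 = Complex.exp (-((t - s : ℝ):ℂ)) := by
      rw [hrs.fR, (hu s hsm).2.1, (hu t htm).2.1] at w5
      have e : ((b * Real.exp s : ℝ):ℂ) = ((b * Real.exp t : ℝ):ℂ) * Complex.exp (-((t - s : ℝ):ℂ)) := by
        push_cast
        rw [mul_assoc, ← Complex.exp_add]; congr 2; ring
      rw [e] at w5
      refine (mul_left_cancel₀ ?_ w5).symm
      have : 0 < b * Real.exp t := by positivity
      exact_mod_cast this.ne'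
    obtain ⟨Q, hQ1, hQ2, hQ3⟩ := exists_log (q := dslope w 0) (c := 0) (r := 1) (dslope_diff one_pos w1) (dslope_ne w1 hwi hw0) (-((t - s : ℝ):ℂ)) (by rw [dslope_same, hwd])
    have hwQ : ∀ z ∈ ball (0:ℂ) 1, w z = z * Complex.exp (Q z) := by
      intro z hz
      rw [hQ3 z hz]
      have := sub_smul_dslope w 0 z
      rw [hw0] at this
      simpa using this.symm
    refine ⟨fun z => - Q z, hQ1.neg, ?_, by change -Q 0 = _; rw [hQ2, neg_neg], ?_⟩
    · intro z hz
      have h1 := Complex.norm_dslope_le_div_of_mapsTo_ball (R₂ := 1) w1 (by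
        rw [hw0]; exact w2.mono_right ball_subset_closedBall) hz
      rw [div_one, ← hQ3 z hz, Complex.norm_exp, Real.exp_le_one_iff] at h1
      simp; exact h1
    · have hLw : DifferentiableOn ℂ (fun z => L t (w z)) (ball 0 1) := (hL t htm).1.comp w1 w2
      have huq := exp_unique (A := L s) (B := fun z => Q z + L t (w z)) (hL s hsm).1 (hQ1.fun_add hLw) (by
        rw [(hL s hsm).2.1, hw0, hQ2, (hL t htm).2.1]; push_cast; ring) (by
        intro z hz
        by_cases hz0 : z = 0
        · rw [hz0, (hL s hsm).2.1, hw0, hQ2, (hL t htm).2.1]; congr 1; push_cast; ring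
        · have h1 := w4' z hz
          rw [hfL t htm _ (w2 hz), hfL s hsm z hz] at h1
          nth_rewrite 1 [hwQ z hz] at h1
          rw [mul_assoc] at h1
          have h2 := mul_left_cancel₀ hz0 h1
          rw [Complex.exp_add]
          refine mul_left_cancel₀ hbc ?_
          rw [← h2]; ring)
      intro z hz
      rw [huq z hz, neg_neg, hwQ z hz]

end DB


namespace DB
open scoped Topology
open Filter

lemma norm_circ (z0 : ℂ) (h : ‖z0‖ = 1) (x : ℝ) : ‖z0 * Complex.exp (((2 * Real.pi * x : ℝ):ℂ) * Complex.I)‖ = 1 := by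
  rw [norm_mul, Complex.norm_exp_ofReal_mul_I, h, one_mul]

lemma circ_surj {z0 w : ℂ} (h : ‖z0‖ = 1) (hw : ‖w‖ = 1) : ∃ x ∈ Icc (0:ℝ) 1, z0 * Complex.exp (((2 * Real.pi * x : ℝ):ℂ) * Complex.I) = w := by
  have hz0 : z0 ≠ 0 := norm_ne_zero_iff.mp (by rw [h]; exact one_ne_zero)
  have hn : ‖w / z0‖ = 1 := by rw [norm_div, h, hw, div_one]
  have harg : Complex.exp ((Complex.arg (w/z0) : ℂ) * Complex.I) = w / z0 := by
    have := Complex.norm_mul_exp_arg_mul_I (w/z0)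
    rwa [hn, Complex.ofReal_one, one_mul] at this
  have hpi := Real.pi_pos
  have hb := Complex.arg_mem_Ioc (w/z0)
  rcases le_or_gt 0 (Complex.arg (w/z0)) with h0 | h0
  · refine ⟨Complex.arg (w/z0) / (2 * Real.pi), ⟨by positivity, ?_⟩, ?_⟩
    · rw [div_le_one (by positivity)]; linarith [hb.2]
    · rw [mul_div_cancel₀ _ (by positivity), harg, mul_div_cancel₀ _ hz0]
  · refine ⟨Complex.arg (w/z0) / (2 * Real.pi) + 1, ⟨?_, ?_⟩, ?_⟩
    · have : -1 ≤ Complex.arg (w/z0) / (2 * Real.pi) := by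
        rw [le_div_iff₀ (by positivity)]; linarith [hb.1]
      linarith
    · have : Complex.arg (w/z0) / (2 * Real.pi) ≤ 0 := div_nonpos_of_nonpos_of_nonneg h0.le (by positivity)
      linarith
    · rw [mul_add, mul_div_cancel₀ _ (by positivity), mul_one]
      have : ((Complex.arg (w/z0) + 2 * Real.pi : ℝ):ℂ) * Complex.I = (Complex.arg (w/z0) : ℂ) * Complex.I + 2 * Real.pi * Complex.I := by push_cast; ring
      rw [this, Complex.exp_periodic, harg, mul_div_cancel₀ _ hz0]

lemma milin_half {h : ℂ → ℂ} {R b : ℝ} (hR : 1 < R) (hb : 0 < b) (hd : DifferentiableOn ℂ h (ball 0 R)) (hi : InjOn h (ball 0 R)) (h0 : h 0 = 0) (hhb : deriv h 0 = (b:ℂ))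
    {z0 : ℂ} (hz0 : ‖z0‖ = 1) (hm : ‖h z0‖ = 1/2) (hmax : ∀ z, ‖z‖ = 1 → ‖h z‖ ≤ 1/2) :
    ∃ L : ℂ → ℂ, DifferentiableOn ℂ L (ball 0 1) ∧ L 0 = 0 ∧ (∀ z ∈ ball (0:ℂ) 1, h z = z * (b * Complex.exp (L z))) ∧
      ∀ n : ℕ, ∑ k ∈ Finset.Icc 1 n, ((n:ℝ)+1-k)*(k*‖co L k‖^2 - 4/k) ≤ 0 := by
  have hs1 : closedBall (0:ℂ) 1 ⊆ ball 0 R := closedBall_subset_ball hR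
  have hs2 : ball (0:ℂ) 1 ⊆ ball 0 R := ball_subset_ball hR.le
  have hc1 : ∀ z : ℂ, ‖z‖ = 1 → z ∈ ball (0:ℂ) R := fun z hz => hs1 (by simp [hz])
  have hle : ∀ z ∈ ball (0:ℂ) 1, ‖h z‖ ≤ 1/2 := by
    intro z hz
    refine Complex.norm_le_of_forall_mem_frontier_norm_le (U := ball 0 1) isBounded_ball ?_ ?_ (subset_closure hz)
    · refine DifferentiableOn.diffContOnCl ?_
      rw [closure_ball _ one_ne_zero]; exact hd.mono hs1
    · intro w hw
      rw [frontier_ball _ one_ne_zero] at hw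
      exact hmax w (by simpa using hw)
  have hlt := strict_of_le isOpen_ball (convex_ball _ _).isPreconnected (hd.mono hs2) (z0 := 0) (by simp) (M := 1/2) (by simp [h0]) hle
  obtain ⟨Γ, hΓ⟩ : ∃ Γ : ℝ → ℂ, Γ = fun x => if x ≤ 1 then h (z0 * Complex.exp (((2 * Real.pi * x : ℝ):ℂ) * Complex.I)) else x * h z0 := ⟨_, rfl⟩
  have hΓ1 : ∀ x, x ≤ 1 → Γ x = h (z0 * Complex.exp (((2 * Real.pi * x : ℝ):ℂ) * Complex.I)) := fun x hx => by rw [hΓ]; exact if_pos hx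
  have hΓ2 : ∀ x, 1 < x → Γ x = x * h z0 := fun x hx => by rw [hΓ]; exact if_neg (not_le.mpr hx)
  have hcv : Cv Γ := by
    refine ⟨?_, ?_, ?_, ?_⟩
    · rw [hΓ]
      refine Continuous.if_le ?_ (by fun_prop) continuous_id continuous_const ?_
      · refine hd.continuousOn.comp_continuous (by fun_prop) (fun x => hc1 _ (norm_circ z0 hz0 x))
      · intro x hx
        rw [hx]
        have : ((2 * Real.pi * 1 : ℝ):ℂ) * Complex.I = 2 * Real.pi * Complex.I := by push_cast; ring
        rw [this, Complex.exp_two_pi_mul_I]; simp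
    · intro x hx
      rcases le_or_gt x 1 with hx1 | hx1
      · rw [hΓ1 x hx1]
        intro he
        have := hi (hc1 _ (norm_circ z0 hz0 x)) (hs2 (by simp)) (he.trans h0.symm)
        have h2 := norm_circ z0 hz0 x
        rw [this] at h2; simp at h2
      · rw [hΓ2 x hx1]
        refine mul_ne_zero (by exact_mod_cast (by linarith : x ≠ 0)) ?_
        rw [← norm_ne_zero_iff, hm]; norm_num
    · intro x hx
      rcases le_or_gt x 1 with hx1 | hx1
      · rw [hΓ1 x hx1]
        have := hmax _ (norm_circ z0 hz0 x)
        linarith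
      · rw [hΓ2 x hx1, norm_mul, hm, Complex.norm_real, Real.norm_of_nonneg hx.1]
        linarith [hx.2]
    · rw [hΓ2 2 (by norm_num), norm_mul, hm]; simp
  refine chain_milin hcv hb (hd.mono hs2) (hi.mono hs2) h0 hhb ?_
  apply Subset.antisymm
  · refine in_Om ((convex_ball _ _).isPreconnected.image _ (hd.mono hs2).continuousOn) ⟨0, by simp, h0⟩ ?_ ?_
    · rintro _ ⟨z, hz, rfl⟩
      have := hlt z hz
      simp; linarith
    · rintro _ ⟨z, hz, rfl⟩ hA
      have hz1 := hlt z hz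
      rcases hA with ⟨x, hx, hxz⟩ | hA
      · rcases le_or_gt x 1 with hx1 | hx1
        · rw [hΓ1 x hx1] at hxz
          have := hi (hc1 _ (norm_circ z0 hz0 x)) (hs2 hz) hxz
          have h2 := norm_circ z0 hz0 x
          rw [this] at h2
          simp at hz; linarith
        · rw [hΓ2 x hx1] at hxz
          rw [← hxz, norm_mul, hm, Complex.norm_real, Real.norm_of_nonneg hx.1] at hz1
          linarith
      · simp at hA; linarith
  · refine (CA_dom hcv (by simp)).conn.subset_of_closure_inter_subset (inj_isOpen isOpen_ball (hd.mono hs2) (hi.mono hs2)) ⟨0, (CA_dom hcv (by simp)).zero, ⟨0, by simp, h0⟩⟩ ?_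
    rintro w ⟨hw1, hw2⟩
    have hcl : IsClosed (h '' closedBall 0 1) := ((isCompact_closedBall _ _).image_of_continuousOn (hd.continuousOn.mono hs1)).isClosed
    obtain ⟨z, hz, rfl⟩ := closure_minimal (image_mono ball_subset_closedBall) hcl hw1
    refine ⟨z, ?_, rfl⟩
    by_contra hcon
    have hz1 : ‖z‖ = 1 := by
      simp at hcon hz; linarith
    obtain ⟨x, hx, hxz⟩ := circ_surj hz0 hz1
    apply (Om_sub _ hw2).2
    left
    refine ⟨x, ⟨hx.1, by linarith [hx.2]⟩, ?_⟩
    rw [hΓ1 x hx.2, hxz]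

lemma milin_smooth {g : ℂ → ℂ} {R : ℝ} (hR : 1 < R) (hd : DifferentiableOn ℂ g (ball 0 R)) (hi : InjOn g (ball 0 R)) (h0 : g 0 = 0) (h1 : deriv g 0 = 1) :
    ∃ L : ℂ → ℂ, DifferentiableOn ℂ L (ball 0 1) ∧ L 0 = 0 ∧ (∀ z ∈ ball (0:ℂ) 1, g z = z * Complex.exp (L z)) ∧
      ∀ n : ℕ, ∑ k ∈ Finset.Icc 1 n, ((n:ℝ)+1-k)*(k*‖co L k‖^2 - 4/k) ≤ 0 := by
  have hs : sphere (0:ℂ) 1 ⊆ ball 0 R := sphere_subset_closedBall.trans (closedBall_subset_ball hR)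
  obtain ⟨z0, hz0, hmax⟩ := (isCompact_sphere (0:ℂ) 1).exists_isMaxOn ⟨1, by simp⟩ (hd.continuousOn.mono hs).norm
  have hm : 0 < ‖g z0‖ := by
    rw [norm_pos_iff]
    intro he
    have := hi (hs hz0) (by simp; linarith) (he.trans h0.symm)
    rw [this] at hz0; simp at hz0
  obtain ⟨c, hc⟩ : ∃ c : ℝ, c = 1/(2 * ‖g z0‖) := ⟨_, rfl⟩
  have hcp : 0 < c := by rw [hc]; positivity
  have hcc : (c:ℂ) ≠ 0 := by exact_mod_cast hcp.ne'
  have hcm : c * ‖g z0‖ = 1/2 := by rw [hc]; field_simp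
  obtain ⟨L, hL1, hL2, hL3, hL4⟩ := milin_half (h := fun z => c * g z) (b := c) hR hcp (hd.const_mul _) (fun x hx y hy he => hi hx hy (mul_left_cancel₀ hcc he)) (by simp [h0])
    (by
      have := ((hd.differentiableAt (ball_mem_nhds 0 (by linarith))).hasDerivAt.const_mul (c:ℂ)).deriv
      rw [this, h1, mul_one]) (z0 := z0) (by simpa using hz0) (by
      rw [norm_mul, Complex.norm_real, Real.norm_of_nonneg hcp.le, hcm]) (by
      intro z hz
      have : ‖g z‖ ≤ ‖g z0‖ := hmax (show z ∈ sphere (0:ℂ) 1 by simpa using hz)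
      rw [norm_mul, Complex.norm_real, Real.norm_of_nonneg hcp.le, ← hcm]
      gcongr)
  refine ⟨L, hL1, hL2, ?_, hL4⟩
  intro z hz
  have := hL3 z hz
  refine mul_left_cancel₀ hcc ?_
  rw [this]; ring

end DB


namespace DB
open scoped Topology
open Filter

lemma exp_rec {L : ℂ → ℂ} (hL : DifferentiableOn ℂ L (ball 0 1)) (k : ℕ) (hk : 1 ≤ k) :
    (k:ℂ) * co (fun z => Complex.exp (L z / 2)) k = ∑ j ∈ Finset.Icc 1 k, (j:ℂ) * (co L j / 2) * co (fun z => Complex.exp (L z / 2)) (k-j) := by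
  obtain ⟨m, rfl⟩ : ∃ m, k = m + 1 := ⟨k - 1, by omega⟩
  have hH : DifferentiableOn ℂ (fun z => Complex.exp (L z / 2)) (ball 0 1) := (hL.div_const 2).cexp
  have e : deriv (fun z => Complex.exp (L z / 2)) =ᶠ[𝓝 0] fun z => ((1/2) * deriv L z) * Complex.exp (L z / 2) := by
    filter_upwards [ball_mem_nhds (0:ℂ) one_pos] with z hz
    have := ((hL.differentiableAt (isOpen_ball.mem_nhds hz)).hasDerivAt.div_const 2).cexp
    rw [this.deriv]; ring
  have h1 := co_deriv (fun z => Complex.exp (L z / 2)) m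
  rw [co_congr e, co_mul (f := fun z => (1/2) * deriv L z) ((analyticAt_const).fun_mul (anAt one_pos (hL.deriv isOpen_ball))) (anAt one_pos hH)] at h1
  push_cast
  have hI : Finset.Icc 1 (m+1) = Finset.Ico (0+1) (m+1+1) := by ext i; simp
  rw [← h1, Finset.range_eq_Ico, hI, ← Finset.sum_Ico_add' (fun j : ℕ => (j:ℂ) * (co L j / 2) * co (fun z => Complex.exp (L z / 2)) (m + 1 -j)) 0 (m+1) 1]
  apply Finset.sum_congr rfl
  intro i hi
  rw [co_const_mul, co_deriv, Nat.add_sub_add_right]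
  push_cast; ring

lemma robertson_L {L : ℂ → ℂ} (hL : DifferentiableOn ℂ L (ball 0 1)) (h0 : L 0 = 0)
    (n : ℕ) (hm : ∑ k ∈ Finset.Icc 1 n, ((n:ℝ)+1-k)*(k*‖co L k‖^2 - 4/k) ≤ 0) :
    ∑ k ∈ Finset.range (n+1), ‖co (fun z => Complex.exp (L z / 2)) k‖^2 ≤ n + 1 := by
  refine robertson_of_milin (fun k => co L k / 2) _ ?_ (fun k hk => exp_rec hL k hk) n ?_
  · rw [co_zero, h0]; simp
  · have : ∑ k ∈ Finset.Icc 1 n, ((n:ℝ)+1-k)*(k*‖co L k‖^2 - 4/k) = 4 * ∑ k ∈ Finset.Icc 1 n, ((n:ℝ)+1-k)*(k*‖co L k / 2‖^2 - 1/k) := by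
      rw [Finset.mul_sum]
      apply Finset.sum_congr rfl
      intro k hk
      rw [norm_div]; simp only [RCLike.norm_ofNat]; ring
    linarith

lemma robertson {ψ : ℂ → ℂ} (hd : DifferentiableOn ℂ ψ (ball 0 1)) (hi : InjOn ψ (ball 0 1)) (h0 : ψ 0 = 0) (h1 : deriv ψ 0 = 1) :
    ∃ H : ℂ → ℂ, DifferentiableOn ℂ H (ball 0 1) ∧ (∀ z ∈ ball (0:ℂ) 1, ψ z = z * (H z * H z)) ∧
      ∀ n : ℕ, ∑ k ∈ Finset.range (n+1), ‖co H k‖^2 ≤ n + 1 := by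
  obtain ⟨l, hl, hl0, hle⟩ := exists_log (q := dslope ψ 0) (c := 0) (r := 1) (dslope_diff one_pos hd) (dslope_ne hd hi h0) 0 (by rw [dslope_same, h1, Complex.exp_zero])
  have hψ : ∀ z ∈ ball (0:ℂ) 1, ψ z = z * Complex.exp (l z) := by
    intro z hz
    rw [eq_dslope ψ z, hle z hz, h0, zero_add]
  have hH : DifferentiableOn ℂ (fun z => Complex.exp (l z / 2)) (ball 0 1) := (hl.div_const 2).cexp
  refine ⟨fun z => Complex.exp (l z / 2), hH, ?_, ?_⟩
  · intro z hz
    rw [hψ z hz, ← Complex.exp_add]; congr 2; ring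
  intro n
  have key : ∀ r ∈ Ioo (0:ℝ) 1, ∑ k ∈ Finset.range (n+1), (r^k * ‖co (fun z => Complex.exp (l z / 2)) k‖)^2 ≤ n + 1 := by
    intro r hr
    have hrc : (r:ℂ) ≠ 0 := by exact_mod_cast hr.1.ne'
    have hmap : MapsTo (fun z : ℂ => (r:ℂ) * z) (ball 0 (1/r)) (ball 0 1) := by
      intro z hz
      rw [mem_ball_zero_iff] at hz ⊢
      rw [norm_mul, Complex.norm_real, Real.norm_of_nonneg hr.1.le]
      rw [lt_div_iff₀ hr.1] at hz; linarith
    have hmap1 : MapsTo (fun z : ℂ => (r:ℂ) * z) (ball 0 1) (ball 0 1) :=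
      hmap.mono_left (ball_subset_ball (by rw [le_div_iff₀ hr.1]; linarith [hr.2]))
    have hlin : Differentiable ℂ (fun z : ℂ => (r:ℂ) * z) := by fun_prop
    obtain ⟨L, hL, hL0, hLe, hLm⟩ := milin_smooth (g := fun z => ψ (r * z) / r) (R := 1/r) (by rw [lt_div_iff₀ hr.1]; linarith [hr.2])
      ((hd.comp hlin.differentiableOn hmap).div_const _) (by
        intro a ha b hb hab
        have hab' : ψ (r*a) = ψ (r*b) := by
          have : ψ (r * a) / r = ψ (r*b) / r := hab
          field_simp at this; exact this
        have := hi (hmap ha) (hmap hb) hab'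
        exact mul_left_cancel₀ hrc this) (by simp [h0]) (by
        have hh : HasDerivAt ψ 1 (r * 0) := by
          rw [mul_zero, ← h1]
          exact (hd.differentiableAt (ball_mem_nhds 0 one_pos)).hasDerivAt
        have h2 : HasDerivAt (fun z : ℂ => (r:ℂ) * z) (r * 1) 0 := (hasDerivAt_id (0:ℂ)).const_mul _
        have h3 := (HasDerivAt.comp (0:ℂ) hh h2).div_const (r:ℂ)
        have := h3.deriv
        rw [show ((fun z => ψ (r * z) / r) : ℂ → ℂ) = fun x => (ψ ∘ fun z => (r:ℂ) * z) x / r from rfl, this]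
        field_simp)
    have hu := exp_unique (A := L) (B := fun z => l (r * z)) hL (hl.comp hlin.differentiableOn hmap1) (by simp [hL0, hl0]) (by
      intro z hz
      by_cases hz0 : z = 0
      · simp [hz0, hL0, hl0]
      · have h2 := hLe z hz
        rw [hψ _ (hmap1 hz)] at h2
        have : z * Complex.exp (l (r * z)) = z * Complex.exp (L z) := by
          rw [← h2]; field_simp
        exact (mul_left_cancel₀ hz0 this).symm)
    have h3 := robertson_L hL hL0 n (hLm n)
    refine le_trans (le_of_eq ?_) h3
    apply Finset.sum_congr rfl
    intro k hk
    have e : (fun z => Complex.exp (L z / 2)) =ᶠ[𝓝 0] fun z => (fun z => Complex.exp (l z / 2)) (r * z) := by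
      filter_upwards [ball_mem_nhds (0:ℂ) one_pos] with z hz
      rw [hu z hz]
    rw [co_congr e, co_scale (anAt one_pos hH), norm_mul, norm_pow, Complex.norm_real, Real.norm_of_nonneg hr.1.le]
  have ht : Tendsto (fun r : ℝ => ∑ k ∈ Finset.range (n+1), (r^k * ‖co (fun z => Complex.exp (l z / 2)) k‖)^2) (𝓝[<] 1) (𝓝 (∑ k ∈ Finset.range (n+1), ‖co (fun z => Complex.exp (l z / 2)) k‖^2)) := by
    have hc : Continuous (fun r : ℝ => ∑ k ∈ Finset.range (n+1), (r^k * ‖co (fun z => Complex.exp (l z / 2)) k‖)^2) := by fun_prop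
    have := (hc.tendsto 1).mono_left (nhdsWithin_le_nhds (s := Iio 1))
    simpa using this
  refine le_of_tendsto ht ?_
  filter_upwards [Ioo_mem_nhdsLT (zero_lt_one' ℝ)] with r hr using key r hr
end DB


namespace DB
open scoped Topology
open Filter

lemma circ_inner {f : ℂ → ℂ} (hf : DifferentiableOn ℂ f (ball 0 1)) {r : ℝ} (hr : r ∈ Ioo (0:ℝ) 1) (c : ℕ → ℂ) (n : ℕ) :
    ∫ θ in (0:ℝ)..(2*Real.pi), f (circleMap 0 r θ) * (starRingEnd ℂ) (∑ k ∈ Finset.range n, c k * (circleMap 0 r θ)^k)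
      = 2 * Real.pi * ∑ k ∈ Finset.range n, co f k * (starRingEnd ℂ) (c k) * (r^2)^k := by
  have hpi : (Real.pi : ℂ) ≠ 0 := by exact_mod_cast Real.pi_ne_zero
  have hcont : Continuous (fun θ => f (circleMap 0 r θ)) := by
    refine hf.continuousOn.comp_continuous (continuous_circleMap 0 r) (fun θ => ?_)
    rw [mem_ball_zero_iff, norm_circleMap_zero, abs_of_pos hr.1]; exact hr.2
  have e : ∀ θ : ℝ, f (circleMap 0 r θ) * (starRingEnd ℂ) (∑ k ∈ Finset.range n, c k * (circleMap 0 r θ)^k)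
      = ∑ k ∈ Finset.range n, ((starRingEnd ℂ) (c k) * r^k) * (f (circleMap 0 r θ) * Complex.exp (-(k * θ * Complex.I))) := by
    intro θ
    rw [map_sum, Finset.mul_sum]
    apply Finset.sum_congr rfl
    intro k hk
    simp only [circleMap, zero_add, map_mul, map_pow, Complex.conj_ofReal, ← Complex.exp_conj, Complex.conj_I, mul_pow, ← Complex.exp_nat_mul, map_natCast]
    rw [show (k:ℂ) * ((θ:ℂ) * -Complex.I) = -(k * θ * Complex.I) by ring]
    ring
  simp only [e]
  rw [intervalIntegral.integral_finsetSum]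
  · rw [Finset.mul_sum]
    apply Finset.sum_congr rfl
    intro k hk
    rw [intervalIntegral.integral_const_mul]
    have := co_circle hf hr.1 hr.2 k
    have h2 : ∫ θ in (0:ℝ)..(2 * Real.pi), f (circleMap 0 r θ) * Complex.exp (-(k * θ * Complex.I)) = 2 * Real.pi * (co f k * r^k) := by
      rw [this, mul_inv_cancel_left₀ (mul_ne_zero two_ne_zero hpi)]
    rw [h2]; ring
  · intro k hk
    apply Continuous.intervalIntegrable
    exact continuous_const.mul (hcont.mul (by fun_prop))

lemma bessel {f : ℂ → ℂ} (hf : DifferentiableOn ℂ f (ball 0 1)) {r : ℝ} (hr : r ∈ Ioo (0:ℝ) 1) (n : ℕ) :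
    2 * Real.pi * ∑ k ∈ Finset.range n, ‖co f k‖^2 * (r^2)^k ≤ ∫ θ in (0:ℝ)..(2*Real.pi), ‖f (circleMap 0 r θ)‖^2 := by
  obtain ⟨P, hP⟩ : ∃ P : ℂ → ℂ, P = fun z => ∑ k ∈ Finset.range n, co f k * z^k := ⟨_, rfl⟩
  have hPd : Differentiable ℂ P := by rw [hP]; fun_prop
  have hcont : Continuous (fun θ => f (circleMap 0 r θ)) := by
    refine hf.continuousOn.comp_continuous (continuous_circleMap 0 r) (fun θ => ?_)
    rw [mem_ball_zero_iff, norm_circleMap_zero, abs_of_pos hr.1]; exact hr.2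
  have hPc : Continuous (fun θ => P (circleMap 0 r θ)) := hPd.continuous.comp (continuous_circleMap 0 r)
  have h1 := circ_inner hf hr (co f) n
  have hcoP : ∀ k ∈ Finset.range n, co P k = co f k := by
    intro k hk
    rw [hP, co_sum _ _ (fun i _ => by fun_prop)]
    rw [Finset.sum_eq_single k]
    · have := co_zpow_mul (f := fun _ => co f k) (analyticAt_const) k k
      rw [show (fun z : ℂ => co f k * z^k) = fun z => z^k * co f k by ext; ring, this]
      simp [co_const]
    · intro b _ hb
      have := co_zpow_mul (f := fun _ => co f b) (analyticAt_const) b k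
      rw [show (fun z : ℂ => co f b * z^b) = fun z => z^b * co f b by ext; ring, this]
      split_ifs with h
      · rfl
      · rw [co_const, if_neg (by omega)]
    · intro h; exact absurd hk h
  have h2 := circ_inner hPd.differentiableOn hr (co f) n
  rw [Finset.sum_congr rfl (fun k hk => by rw [hcoP k hk])] at h2
  have hS : (∑ k ∈ Finset.range n, co f k * (starRingEnd ℂ) (co f k) * ((r:ℂ)^2)^k) = ((∑ k ∈ Finset.range n, ‖co f k‖^2 * (r^2)^k : ℝ) : ℂ) := by
    push_cast
    apply Finset.sum_congr rfl
    intro k hk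
    rw [Complex.mul_conj, Complex.normSq_eq_norm_sq]; push_cast; ring
  rw [hS] at h1 h2
  have h3 : ∫ θ in (0:ℝ)..(2*Real.pi), (f (circleMap 0 r θ) - P (circleMap 0 r θ)) * (starRingEnd ℂ) (P (circleMap 0 r θ)) = 0 := by
    simp only [sub_mul]
    rw [intervalIntegral.integral_sub]
    · rw [hP] at h2 ⊢
      rw [h1, h2, sub_self]
    · exact (hcont.mul (Complex.continuous_conj.comp hPc)).intervalIntegrable _ _
    · exact (hPc.mul (Complex.continuous_conj.comp hPc)).intervalIntegrable _ _
  have h4 : ∫ θ in (0:ℝ)..(2*Real.pi), ((f (circleMap 0 r θ) - P (circleMap 0 r θ)) * (starRingEnd ℂ) (P (circleMap 0 r θ))).re = 0 := by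
    have := intervalIntegral.intervalIntegral_re (𝕜 := ℂ) (μ := MeasureTheory.volume) (a := 0) (b := 2 * Real.pi) (f := fun θ => (f (circleMap 0 r θ) - P (circleMap 0 r θ)) * (starRingEnd ℂ) (P (circleMap 0 r θ)))
      (((hcont.sub hPc).mul (Complex.continuous_conj.comp hPc)).intervalIntegrable _ _)
    rw [h3] at this
    simpa using this
  have h5 : ∫ θ in (0:ℝ)..(2*Real.pi), ((P (circleMap 0 r θ)) * (starRingEnd ℂ) (P (circleMap 0 r θ))).re = 2 * Real.pi * ∑ k ∈ Finset.range n, ‖co f k‖^2 * (r^2)^k := by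
    have := intervalIntegral.intervalIntegral_re (𝕜 := ℂ) (μ := MeasureTheory.volume) (a := 0) (b := 2 * Real.pi) (f := fun θ => (P (circleMap 0 r θ)) * (starRingEnd ℂ) (P (circleMap 0 r θ)))
      ((hPc.mul (Complex.continuous_conj.comp hPc)).intervalIntegrable _ _)
    have e2 : ∫ θ in (0:ℝ)..(2*Real.pi), P (circleMap 0 r θ) * (starRingEnd ℂ) (P (circleMap 0 r θ)) = ((2 * Real.pi * ∑ k ∈ Finset.range n, ‖co f k‖^2 * (r^2)^k : ℝ):ℂ) := by
      rw [hP] at h2 ⊢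
      rw [h2]; push_cast; rfl
    rw [e2] at this
    simpa only [RCLike.re_to_complex, Complex.ofReal_re] using this
  have h6 : ∫ θ in (0:ℝ)..(2*Real.pi), (2 * ((f (circleMap 0 r θ) - P (circleMap 0 r θ)) * (starRingEnd ℂ) (P (circleMap 0 r θ))).re + ((P (circleMap 0 r θ)) * (starRingEnd ℂ) (P (circleMap 0 r θ))).re) = 2 * Real.pi * ∑ k ∈ Finset.range n, ‖co f k‖^2 * (r^2)^k := by
    rw [intervalIntegral.integral_add, intervalIntegral.integral_const_mul, h4, h5]
    · ring
    · apply Continuous.intervalIntegrable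
      exact continuous_const.mul (Complex.continuous_re.comp ((hcont.sub hPc).mul (Complex.continuous_conj.comp hPc)))
    · apply Continuous.intervalIntegrable
      exact (Complex.continuous_re.comp ((hPc).mul (Complex.continuous_conj.comp hPc)))
  rw [← h6]
  apply intervalIntegral.integral_mono_on (by positivity)
  · apply Continuous.intervalIntegrable
    exact (continuous_const.mul (Complex.continuous_re.comp ((hcont.sub hPc).mul (Complex.continuous_conj.comp hPc)))).add (Complex.continuous_re.comp ((hPc).mul (Complex.continuous_conj.comp hPc)))
  · apply Continuous.intervalIntegrable
    exact hcont.norm.pow 2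
  · intro θ _
    generalize f (circleMap 0 r θ) = a
    generalize P (circleMap 0 r θ) = b
    rw [← Complex.normSq_eq_norm_sq, Complex.normSq_apply]
    simp only [Complex.mul_re, Complex.sub_re, Complex.sub_im, Complex.conj_re, Complex.conj_im]
    nlinarith [sq_nonneg (a.re - b.re), sq_nonneg (a.im - b.im)]

lemma contract {u R : ℂ → ℂ} (hu : DifferentiableOn ℂ u (ball 0 1)) (hb : ∀ z ∈ ball (0:ℂ) 1, ‖u z‖ ≤ 1)
    (hR : DifferentiableOn ℂ R (ball 0 1)) (n : ℕ) :
    ∑ k ∈ Finset.range n, ‖co (fun z => u z * R z) k‖^2 ≤ ∑ k ∈ Finset.range n, ‖co R k‖^2 := by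
  obtain ⟨T, hT⟩ : ∃ T : ℂ → ℂ, T = fun z => ∑ k ∈ Finset.range n, co R k * z^k := ⟨_, rfl⟩
  have hTd : Differentiable ℂ T := by rw [hT]; fun_prop
  obtain ⟨h, hh, hRe⟩ := taylor_rem one_pos hR n
  have hRe' : ∀ z, R z = T z + z^n * h z := by intro z; rw [hRe z, hT]
  have hcT : ∀ k < n, co T k = co R k := by
    intro k hk
    have e : R = fun z => T z + z^n * h z := funext hRe'
    have : co R k = co (fun z => T z + z^n * h z) k := by rw [← e]
    rw [this, co_add (hTd.analyticAt 0) (by exact ((analyticAt_id).fun_pow n).fun_mul (anAt one_pos hh)), co_zpow_mul (anAt one_pos hh), if_pos (by omega), add_zero]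
  have hc : ∀ k < n, co (fun z => u z * R z) k = co (fun z => u z * T z) k := by
    intro k hk
    rw [co_mul (anAt one_pos hu) (anAt one_pos hR), co_mul (anAt one_pos hu) (hTd.analyticAt 0)]
    apply Finset.sum_congr rfl
    intro i hi
    rw [hcT _ (by omega)]
  have hball : ∀ r ∈ Ioo (0:ℝ) 1, ∀ θ, circleMap 0 r θ ∈ ball (0:ℂ) 1 := by
    intro r hr θ
    rw [mem_ball_zero_iff, norm_circleMap_zero, abs_of_pos hr.1]; exact hr.2
  have hTp : ∀ r ∈ Ioo (0:ℝ) 1, ∫ θ in (0:ℝ)..(2*Real.pi), ‖T (circleMap 0 r θ)‖^2 = 2 * Real.pi * ∑ k ∈ Finset.range n, ‖co R k‖^2 * (r^2)^k := by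
    intro r hr
    have h2 := circ_inner hTd.differentiableOn hr (co R) n
    have hTc : Continuous (fun θ => T (circleMap 0 r θ)) := hTd.continuous.comp (continuous_circleMap 0 r)
    rw [Finset.sum_congr rfl (fun k hk => by rw [hcT k (Finset.mem_range.mp hk)])] at h2
    have e1 : ∀ θ, T (circleMap 0 r θ) * (starRingEnd ℂ) (∑ k ∈ Finset.range n, co R k * (circleMap 0 r θ)^k) = ((‖T (circleMap 0 r θ)‖^2 : ℝ) : ℂ) := by
      intro θ
      have : ∑ k ∈ Finset.range n, co R k * (circleMap 0 r θ)^k = T (circleMap 0 r θ) := by rw [hT]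
      rw [this, Complex.mul_conj, Complex.normSq_eq_norm_sq]
    simp only [e1] at h2
    rw [intervalIntegral.integral_ofReal] at h2
    have hS : (2 * Real.pi * ∑ k ∈ Finset.range n, co R k * (starRingEnd ℂ) (co R k) * ((r:ℂ)^2)^k) = ((2 * Real.pi * ∑ k ∈ Finset.range n, ‖co R k‖^2 * (r^2)^k : ℝ) : ℂ) := by
      push_cast
      congr 1
      apply Finset.sum_congr rfl
      intro k hk
      rw [Complex.mul_conj, Complex.normSq_eq_norm_sq]; push_cast; ring
    rw [hS] at h2
    exact_mod_cast h2
  have key : ∀ r ∈ Ioo (0:ℝ) 1, ∑ k ∈ Finset.range n, ‖co (fun z => u z * R z) k‖^2 * (r^2)^k ≤ ∑ k ∈ Finset.range n, ‖co R k‖^2 * (r^2)^k := by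
    intro r hr
    have huT : DifferentiableOn ℂ (fun z => u z * T z) (ball 0 1) := hu.fun_mul hTd.differentiableOn
    have h1 := bessel huT hr n
    rw [Finset.sum_congr rfl (fun k hk => by rw [← hc k (Finset.mem_range.mp hk)])] at h1
    have hTc : Continuous (fun θ => T (circleMap 0 r θ)) := hTd.continuous.comp (continuous_circleMap 0 r)
    have huTc : Continuous (fun θ => u (circleMap 0 r θ) * T (circleMap 0 r θ)) :=
      huT.continuousOn.comp_continuous (continuous_circleMap 0 r) (hball r hr)
    have h2 : ∫ θ in (0:ℝ)..(2*Real.pi), ‖u (circleMap 0 r θ) * T (circleMap 0 r θ)‖^2 ≤ ∫ θ in (0:ℝ)..(2*Real.pi), ‖T (circleMap 0 r θ)‖^2 := by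
      apply intervalIntegral.integral_mono_on (by positivity)
      · exact (huTc.norm.pow 2).intervalIntegrable _ _
      · exact (hTc.norm.pow 2).intervalIntegrable _ _
      · intro θ _
        rw [norm_mul]
        have := hb _ (hball r hr θ)
        gcongr
        exact mul_le_of_le_one_left (norm_nonneg _) this
    rw [hTp r hr] at h2
    have := h1.trans h2
    exact le_of_mul_le_mul_left this (by positivity)
  have ht : ∀ a : ℕ → ℝ, Tendsto (fun r : ℝ => ∑ k ∈ Finset.range n, a k * (r^2)^k) (𝓝[<] 1) (𝓝 (∑ k ∈ Finset.range n, a k)) := by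
    intro a
    have hc : Continuous (fun r : ℝ => ∑ k ∈ Finset.range n, a k * (r^2)^k) := by fun_prop
    have := (hc.tendsto 1).mono_left (nhdsWithin_le_nhds (s := Iio 1))
    simpa using this
  refine le_of_tendsto_of_tendsto (ht _) (ht _) ?_
  filter_upwards [Ioo_mem_nhdsLT (zero_lt_one' ℝ)] with r hr using key r hr

lemma littlewood {v u : ℂ → ℂ} (hv : DifferentiableOn ℂ v (ball 0 1)) (hm : MapsTo v (ball 0 1) (ball 0 1)) (hu : DifferentiableOn ℂ u (ball 0 1))
    (hb : ∀ z ∈ ball (0:ℂ) 1, ‖u z‖ ≤ 1) (hvu : ∀ z, v z = z * u z) (n : ℕ) :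
    ∀ Q : ℂ → ℂ, DifferentiableOn ℂ Q (ball 0 1) → ∑ k ∈ Finset.range n, ‖co (fun z => Q (v z)) k‖^2 ≤ ∑ k ∈ Finset.range n, ‖co Q k‖^2 := by
  induction n with
  | zero => intro Q hQ; simp
  | succ n ih =>
    intro Q hQ
    have hR := dslope_diff one_pos hQ
    have hRv : DifferentiableOn ℂ (fun z => dslope Q 0 (v z)) (ball 0 1) := hR.comp hv hm
    have huR : DifferentiableOn ℂ (fun z => u z * dslope Q 0 (v z)) (ball 0 1) := hu.fun_mul hRv
    have hv0 : v 0 = 0 := by rw [hvu]; simp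
    rw [Finset.sum_range_succ', Finset.sum_range_succ', co_zero, co_zero, hv0]
    gcongr ?_ + _
    have e : (fun z => Q (v z)) = fun z => Q 0 + z * (u z * dslope Q 0 (v z)) := by
      ext z
      rw [eq_dslope Q (v z), ← mul_assoc, ← hvu]
    have e2 : ∀ k, co (fun z => Q (v z)) (k+1) = co (fun z => u z * dslope Q 0 (v z)) k := by
      intro k
      rw [e, co_add (f := fun _ => Q 0) (g := fun z => z * (u z * dslope Q 0 (v z))) analyticAt_const (analyticAt_id.fun_mul (anAt one_pos huR)), co_const, co_zmul_succ (anAt one_pos huR)]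
      simp
    simp only [e2]
    refine (contract hu hb hRv n).trans ((ih _ hR).trans (le_of_eq ?_))
    apply Finset.sum_congr rfl
    intro k hk
    rw [co_dslope one_pos hQ]

lemma rogosinski {ψ v : ℂ → ℂ} (hd : DifferentiableOn ℂ ψ (ball 0 1)) (hi : InjOn ψ (ball 0 1)) (h0 : ψ 0 = 0) (h1 : deriv ψ 0 = 1)
    (hv : DifferentiableOn ℂ v (ball 0 1)) (hm : MapsTo v (ball 0 1) (ball 0 1)) (hv0 : v 0 = 0) (s : ℕ) (hs : 1 ≤ s) :
    ‖co (fun z => ψ (v z)) s‖ ≤ s := by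
  obtain ⟨H, hH, hψ, hHb⟩ := robertson hd hi h0 h1
  obtain ⟨m, rfl⟩ : ∃ m, s = m + 1 := ⟨s - 1, by omega⟩
  have hu := dslope_diff one_pos hv
  have hb : ∀ z ∈ ball (0:ℂ) 1, ‖dslope v 0 z‖ ≤ 1 := by
    intro z hz
    have := Complex.norm_dslope_le_div_of_mapsTo_ball (f := v) (c := 0) (R₁ := 1) (R₂ := 1) (z := z) hv (by rw [hv0]; exact hm.mono_right ball_subset_closedBall) hz
    simpa using this
  have hvu : ∀ z, v z = z * dslope v 0 z := by intro z; have := eq_dslope v z; rw [hv0, zero_add] at this; exact this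
  have hHv : DifferentiableOn ℂ (fun z => H (v z)) (ball 0 1) := hH.comp hv hm
  have huH : DifferentiableOn ℂ (fun z => dslope v 0 z * H (v z)) (ball 0 1) := hu.fun_mul hHv
  have hP : DifferentiableOn ℂ (fun z => dslope v 0 z * H (v z) * H (v z)) (ball 0 1) := huH.fun_mul hHv
  have e : (fun z => ψ (v z)) =ᶠ[𝓝 0] fun z => z * (dslope v 0 z * H (v z) * H (v z)) := by
    filter_upwards [ball_mem_nhds (0:ℂ) one_pos] with z hz
    rw [hψ _ (hm hz)]
    nth_rewrite 1 [hvu z]; ring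
  rw [co_congr e, co_zmul_succ (anAt one_pos hP), co_mul (anAt one_pos huH) (anAt one_pos hHv)]
  have hA : ∑ k ∈ Finset.range (m+1), ‖co (fun z => H (v z)) k‖^2 ≤ (m:ℝ) + 1 := (littlewood hv hm hu hb hvu (m+1) H hH).trans (hHb m)
  have hB : ∑ k ∈ Finset.range (m+1), ‖co (fun z => dslope v 0 z * H (v z)) k‖^2 ≤ (m:ℝ) + 1 := (contract hu hb hHv (m+1)).trans hA
  have hA' : ∑ k ∈ Finset.range (m+1), ‖co (fun z => H (v z)) (m - k)‖^2 ≤ (m:ℝ) + 1 := by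
    have := Finset.sum_range_reflect (fun k => ‖co (fun z => H (v z)) k‖^2) (m+1)
    simp only [Nat.add_sub_cancel] at this
    rw [this]; exact hA
  calc _ ≤ ∑ i ∈ Finset.range (m+1), ‖co (fun z => dslope v 0 z * H (v z)) i * co (fun z => H (v z)) (m - i)‖ := norm_sum_le _ _
    _ ≤ ∑ i ∈ Finset.range (m+1), (‖co (fun z => dslope v 0 z * H (v z)) i‖^2 + ‖co (fun z => H (v z)) (m - i)‖^2) / 2 := by
        apply Finset.sum_le_sum
        intro i _
        rw [norm_mul]
        nlinarith [sq_nonneg (‖co (fun z => dslope v 0 z * H (v z)) i‖ - ‖co (fun z => H (v z)) (m - i)‖)]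
    _ ≤ _ := by
        rw [← Finset.sum_div, Finset.sum_add_distrib]
        push_cast
        linarith
end DB


namespace DB
open scoped Topology
open Filter

lemma line_deriv {X : Type*} [NormedAddCommGroup X] [NormedSpace ℂ X] {G : X → X} {w : X} {γ : ℂ → ℂ}
    (hγ : DifferentiableOn ℂ γ (ball 0 1)) (hG : ∀ t ∈ ball (0:ℂ) 1, G (t • w) = γ t • w) (n : ℕ) :
    ∀ t ∈ ball (0:ℂ) 1, iteratedFDeriv ℂ n G (t • w) (fun _ => w) = 0 ∨
      iteratedFDeriv ℂ n G (t • w) (fun _ => w) = iteratedDeriv n γ t • w := by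
  induction n with
  | zero => intro t ht; right; simp [hG t ht]
  | succ n ih =>
    intro t ht
    rw [iteratedFDeriv_succ_apply_left]
    by_cases hd : DifferentiableAt ℂ (iteratedFDeriv ℂ n G) (t • w)
    swap
    · left; rw [fderiv_zero_of_not_differentiableAt hd]; rfl
    have hline : HasDerivAt (fun t : ℂ => t • w) w t := by simpa using (hasDerivAt_id t).smul_const w
    have hA0 := hd.hasFDerivAt.comp_hasDerivAt t hline
    have hA : HasDerivAt (fun t : ℂ => iteratedFDeriv ℂ n G (t • w) (fun _ => w)) (fderiv ℂ (iteratedFDeriv ℂ n G) (t • w) w (fun _ => w)) t :=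
      ((ContinuousMultilinearMap.apply ℂ (fun _ : Fin n => X) X (fun _ => w)).hasFDerivAt.comp_hasDerivAt t hA0)
    have hBd : HasDerivAt (fun t => iteratedDeriv n γ t • w) (iteratedDeriv (n+1) γ t • w) t := by
      refine HasDerivAt.smul_const ?_ w
      rw [iteratedDeriv_succ]
      have := ((hγ.analyticAt (isOpen_ball.mem_nhds ht)).iterated_deriv n)
      rw [← iteratedDeriv_eq_iterate] at this
      exact this.differentiableAt.hasDerivAt
    change fderiv ℂ (iteratedFDeriv ℂ n G) (t • w) w (fun _ => w) = 0 ∨ fderiv ℂ (iteratedFDeriv ℂ n G) (t • w) w (fun _ => w) = _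
    by_contra hcon
    push Not at hcon
    have h1 := hA.eventually_ne (c := 0) hcon.1
    have h2 := (hA.fun_sub hBd).eventually_ne (c := 0) (sub_ne_zero.mpr hcon.2)
    have h3 : ∀ᶠ z in 𝓝[≠] t, z ∈ ball (0:ℂ) 1 := nhdsWithin_le_nhds (isOpen_ball.mem_nhds ht)
    obtain ⟨z, hz1, hz2, hz3⟩ := (h1.and (h2.and h3)).exists
    rcases ih z hz3 with h | h
    · exact hz1 h
    · exact hz2 (sub_eq_zero.mpr h)

lemma main {X : Type*} [NormedAddCommGroup X] [NormedSpace ℂ X]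
    (f g : X → ℂ)
    (hf : DifferentiableOn ℂ f (ball (0 : X) 1))
    (hg : DifferentiableOn ℂ g (ball (0 : X) 1))
    (F G V : X → X)
    (hF : ∀ x ∈ ball (0 : X) 1, F x = f x • x)
    (hG : ∀ x ∈ ball (0 : X) 1, G x = g x • x)
    (hd : DifferentiableOn ℂ F (ball (0 : X) 1)) (hi : InjOn F (ball (0 : X) 1))
    (hV : DifferentiableOn ℂ V (ball (0 : X) 1)) (hVm : MapsTo V (ball (0 : X) 1) (ball (0 : X) 1))
    (hGV : ∀ x ∈ ball (0 : X) 1, G x = F (V x)) (s : ℕ) (hs : 1 ≤ s) (w : X) (hw : ‖w‖ = 1) :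
      ‖((s.factorial : ℂ))⁻¹ • iteratedFDeriv ℂ s G 0 (fun _ => w)‖ ≤ s * ‖fderiv ℂ F 0‖ := by
  have hw0 : w ≠ 0 := by intro h; rw [h, norm_zero] at hw; exact zero_ne_one hw
  have hnorm : ∀ z : ℂ, ‖z • w‖ = ‖z‖ := by intro z; rw [norm_smul, hw, mul_one]
  have hmem : MapsTo (fun z : ℂ => z • w) (ball 0 1) (ball 0 1) := by
    intro z hz
    rw [mem_ball_zero_iff] at hz ⊢
    rw [hnorm]; exact hz
  have hlin : Differentiable ℂ (fun z : ℂ => z • w) := by fun_prop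
  have hfd : DifferentiableOn ℂ (fun z : ℂ => f (z • w)) (ball 0 1) := hf.comp hlin.differentiableOn hmem
  have hgd : DifferentiableOn ℂ (fun z : ℂ => g (z • w)) (ball 0 1) := hg.comp hlin.differentiableOn hmem
  have hVd : DifferentiableOn ℂ (fun z : ℂ => V (z • w)) (ball 0 1) := hV.comp hlin.differentiableOn hmem
  have hfVd : DifferentiableOn ℂ (fun z : ℂ => f (V (z • w))) (ball 0 1) := hf.comp hVd (hVm.comp hmem)
  have hφd : DifferentiableOn ℂ (fun z : ℂ => f (z • w) * z) (ball 0 1) := hfd.fun_mul differentiableOn_id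
  have hγd : DifferentiableOn ℂ (fun z : ℂ => g (z • w) * z) (ball 0 1) := hgd.fun_mul differentiableOn_id
  have hφF : ∀ z ∈ ball (0:ℂ) 1, F (z • w) = (f (z • w) * z) • w := by
    intro z hz
    rw [hF _ (hmem hz), smul_smul]
  have hγG : ∀ z ∈ ball (0:ℂ) 1, G (z • w) = (g (z • w) * z) • w := by
    intro z hz
    rw [hG _ (hmem hz), smul_smul]
  have hφi : InjOn (fun z : ℂ => f (z • w) * z) (ball 0 1) := by
    intro a ha b hb hab
    have : F (a • w) = F (b • w) := by
      rw [hφF a ha, hφF b hb]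
      exact congrArg (· • w) hab
    exact smul_left_injective ℂ hw0 (hi (hmem ha) (hmem hb) this)
  have h0b : (0:ℂ) ∈ ball (0:ℂ) 1 := by simp
  have hφ' : HasDerivAt (fun z : ℂ => f (z • w) * z) (f 0) 0 := by
    have h1 := (hfd.differentiableAt (isOpen_ball.mem_nhds h0b)).hasDerivAt.fun_mul (hasDerivAt_id (0:ℂ))
    simpa using h1
  have hf0 : f 0 ≠ 0 := by
    have := inj_deriv_ne isOpen_ball hφd hφi h0b
    rwa [hφ'.deriv] at this
  have hfne : ∀ x ∈ ball (0:X) 1, f x ≠ 0 := by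
    intro x hx h
    have h0 : (0:X) ∈ ball (0:X) 1 := by simp
    have h1 : F x = F 0 := by rw [hF x hx, hF 0 h0, h]; simp
    have := hi hx h0 h1
    rw [this] at h
    exact hf0 h
  obtain ⟨v, hv⟩ : ∃ v : ℂ → ℂ, v = fun z => g (z • w) * z / f (V (z • w)) := ⟨_, rfl⟩
  have hvV : ∀ z ∈ ball (0:ℂ) 1, V (z • w) = v z • w := by
    intro z hz
    have h1 := hGV _ (hmem hz)
    have hVz := hVm (hmem hz)
    rw [hγG z hz, hF _ hVz] at h1
    rw [hv]
    change _ = (g (z • w) * z / f (V (z • w))) • w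
    rw [div_eq_inv_mul, mul_smul, h1, smul_smul, inv_mul_cancel₀ (hfne _ hVz), one_smul]
  have hvd : DifferentiableOn ℂ v (ball 0 1) := by
    rw [hv]; exact hγd.fun_div hfVd (fun z hz => hfne _ (hVm (hmem hz)))
  have hvm : MapsTo v (ball 0 1) (ball 0 1) := by
    intro z hz
    have := hVm (hmem hz)
    change V (z • w) ∈ _ at this
    rw [hvV z hz, mem_ball_zero_iff, hnorm] at this
    rw [mem_ball_zero_iff]; exact this
  have hv0 : v 0 = 0 := by rw [hv]; simp
  have hγφ : ∀ z ∈ ball (0:ℂ) 1, g (z • w) * z = f (v z • w) * v z := by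
    intro z hz
    rw [← hvV z hz, hv]
    change _ = f (V (z • w)) * (g (z • w) * z / f (V (z • w)))
    rw [mul_div_cancel₀ _ (hfne _ (hVm (hmem hz)))]
  have hrog := rogosinski (ψ := fun z => (f 0)⁻¹ * (f (z • w) * z)) (v := v) (hφd.const_mul _)
    (by intro a ha b hb hab; exact hφi ha hb (mul_left_cancel₀ (inv_ne_zero hf0) hab)) (by simp)
    (by rw [(hφ'.const_mul (f 0)⁻¹).deriv, inv_mul_cancel₀ hf0]) hvd hvm hv0 s hs
  have e : (fun z => (f 0)⁻¹ * (f (v z • w) * v z)) =ᶠ[𝓝 0] fun z => (f 0)⁻¹ * (g (z • w) * z) := by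
    filter_upwards [ball_mem_nhds (0:ℂ) one_pos] with z hz
    rw [hγφ z hz]
  rw [co_congr e, co_const_mul, norm_mul, norm_inv] at hrog
  have hfp : 0 < ‖f 0‖ := norm_pos_iff.mpr hf0
  have hco : ‖co (fun z => g (z • w) * z) s‖ ≤ s * ‖f 0‖ := by
    rw [inv_mul_le_iff₀ hfp] at hrog; linarith
  have hFd : ‖f 0‖ ≤ ‖fderiv ℂ F 0‖ := by
    have h1 : HasDerivAt (fun z : ℂ => F (z • w)) (fderiv ℂ F 0 w) 0 := by
      have hline : HasDerivAt (fun t : ℂ => t • w) w 0 := by simpa using (hasDerivAt_id (0:ℂ)).smul_const w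
      have h2 : HasFDerivAt F (fderiv ℂ F 0) ((0:ℂ) • w) := by
        rw [zero_smul]; exact (hd.differentiableAt (ball_mem_nhds 0 one_pos)).hasFDerivAt
      exact h2.comp_hasDerivAt 0 hline
    have h2 : HasDerivAt (fun z : ℂ => F (z • w)) (f 0 • w) 0 := by
      refine (hφ'.smul_const w).congr_of_eventuallyEq ?_
      filter_upwards [ball_mem_nhds (0:ℂ) one_pos] with z hz using hφF z hz
    have h3 := (fderiv ℂ F 0).le_opNorm w
    rw [h1.unique h2, hnorm, hw, mul_one] at h3
    exact h3
  have hl := line_deriv hγd hγG s 0 h0b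
  rw [zero_smul] at hl
  rcases hl with h | h
  · rw [h, smul_zero, norm_zero]; positivity
  · rw [h, smul_smul, hnorm]
    have : ((s.factorial : ℂ))⁻¹ * iteratedDeriv s (fun z => g (z • w) * z) 0 = co (fun z => g (z • w) * z) s := by
      unfold co; ring
    rw [this]
    exact hco.trans (by gcongr)
end DB


/-- **Generalized Bieberbach (Rogosinski) conjecture.** Let `F(x) = f(x)·x` and
`G(x) = g(x)·x` on the unit ball `𝔹` of a complex Banach space, with `f, g` holomorphic.
If `F` is biholomorphic on `𝔹` and `G` is subordinate to `F`, then for every `s ≥ 1`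
and every `w` with `‖w‖ = 1`, the `s`-th homogeneous Taylor term
`P_s(w) = (1/s!)·DˢG(0)(w,…,w)` of `G` satisfies `‖P_s(w)‖ ≤ s·‖DF(0)‖`. -/
theorem stmt3 {X : Type*} [NormedAddCommGroup X] [NormedSpace ℂ X] [CompleteSpace X]
    (f g : X → ℂ)
    (hf : DifferentiableOn ℂ f (ball (0 : X) 1))
    (hg : DifferentiableOn ℂ g (ball (0 : X) 1))
    (F G : X → X)
    (hF : ∀ x ∈ ball (0 : X) 1, F x = f x • x)
    (hG : ∀ x ∈ ball (0 : X) 1, G x = g x • x)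
    (hbi : IsBiholoOn F (ball (0 : X) 1))
    (hsub : Subordinate G F) :
    ∀ s : ℕ, 1 ≤ s → ∀ w : X, ‖w‖ = 1 →
      ‖((s.factorial : ℂ))⁻¹ • iteratedFDeriv ℂ s G 0 (fun _ => w)‖
        ≤ s * ‖fderiv ℂ F 0‖ := by
  obtain ⟨V, hV, hVm, _, hGV⟩ := hsub
  intro s hs w hw
  exact DB.main f g hf hg F G V hF hG hbi.1 hbi.2.1 hV hVm hGV s hs w hw
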